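/- arXiv:dg-ga/9708012 — 2 statements merged into one kernel-verified Lean document; each statement's English description precedes it below -/
import Mathlib

section
/- Let R > 0, λ ∈ (0,1) and n ≥ 1. There exists a constant c₁ = c₁(R, λ) > 0 with the following property: for every bounded function h : ℂ → ℂⁿ that is λ-Hölder on the closed disc of radius R, say ‖h(ζ) − h(ζ')‖ ≤ H·|ζ − ζ'|^λ for ζ, ζ' in that disc, the Cauchy transform (Th)(w) = −(1/π) ∫_{𝔻_R} (ζ − w)⁻¹ · h(ζ) dA(ζ) (integration with respect to two-dimensional Lebesgue measure, and (ζ − w)⁻¹·h(ζ) denotes complex scalar multiplication) is ℝ-Fréchet-differentiable at every w ∈ 𝔻_R; its Wirtinger derivatives ∂(Th)(w) = ½(∂_x − i∂_y)(Th)(w) and ∂̄(Th)(w) = ½(∂_x + i∂_y)(Th)(w) satisfy ∂̄(Th) = h on 𝔻_R, and both ∂(Th) and ∂̄(Th) are λ-Hölder on 𝔻_R with sup-norm plus λ-Hölder constant bounded by c₁·(sup_{𝔻_R}‖h‖ + H). -/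
open Metric Set Filter
open scoped ENNReal Topology

noncomputable section

abbrev Cn (n : ℕ) := EuclideanSpace ℂ (Fin n)

def IsAlmostComplexOn (n : ℕ) (Ω : Set (Cn n)) (J : Cn n → (Cn n →L[ℝ] Cn n)) : Prop :=
  ContDiffOn ℝ (⊤ : ℕ∞) J Ω ∧
    ∀ x ∈ Ω, (J x).comp (J x) = -ContinuousLinearMap.id ℝ (Cn n)

def IsJHolomorphicOn (n : ℕ) (Ω : Set (Cn n)) (J : Cn n → (Cn n →L[ℝ] Cn n))
    (R : ℝ) (f : ℂ → Cn n) : Prop :=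
  MapsTo f (ball (0:ℂ) R) Ω ∧
    ∀ z ∈ ball (0:ℂ) R, DifferentiableAt ℝ f z ∧
      ∀ ξ : ℂ, fderiv ℝ f z (Complex.I * ξ) = J (f z) (fderiv ℝ f z ξ)

def kobayashiRoyden (n : ℕ) (Ω : Set (Cn n)) (J : Cn n → (Cn n →L[ℝ] Cn n))
    (p v : Cn n) : ℝ≥0∞ :=
  sInf {c : ℝ≥0∞ | ∃ r : ℝ, 0 < r ∧
    (∃ f : ℂ → Cn n, IsJHolomorphicOn n Ω J 1 f ∧ f 0 = p ∧ fderiv ℝ f 0 1 = r • v) ∧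
    c = ENNReal.ofReal (1 / r)}

/-- The inverse hyperbolic tangent, `arctanh x = ½ log((1 + x)/(1 - x))`. -/
def arctanh (x : ℝ) : ℝ := (1 / 2) * Real.log ((1 + x) / (1 - x))

/-- The Poincaré distance on the unit disc. -/
def poincareDist (z w : ℂ) : ℝ :=
  arctanh (‖z - w‖ / ‖1 - (starRingEnd ℂ) z * w‖)

/-- The Kobayashi pseudodistance `d_Ω(p, q)` of the almost complex manifold `(Ω, J)`. -/
def kobayashiDist (n : ℕ) (Ω : Set (Cn n)) (J : Cn n → (Cn n →L[ℝ] Cn n))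
    (p q : Cn n) : ℝ≥0∞ :=
  sInf {c : ℝ≥0∞ | ∃ m : ℕ, ∃ z w : Fin (m + 1) → ℂ, ∃ f : Fin (m + 1) → ℂ → Cn n,
    (∀ k, z k ∈ ball (0:ℂ) 1 ∧ w k ∈ ball (0:ℂ) 1 ∧ IsJHolomorphicOn n Ω J 1 (f k)) ∧
    f 0 (z 0) = p ∧
    (∀ k : Fin m, f k.castSucc (w k.castSucc) = f k.succ (z k.succ)) ∧
    f (Fin.last m) (w (Fin.last m)) = q ∧
    c = ENNReal.ofReal (∑ k, poincareDist (z k) (w k))}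

/-- `γ` is a piecewise continuously differentiable path in `Ω`, parametrized by `[0,1]`. -/
def IsPiecewiseC1PathIn (n : ℕ) (Ω : Set (Cn n)) (γ : ℝ → Cn n) : Prop :=
  ContinuousOn γ (Icc (0:ℝ) 1) ∧ MapsTo γ (Icc (0:ℝ) 1) Ω ∧
    ∃ (k : ℕ) (t : Fin (k + 1) → ℝ), StrictMono t ∧ t 0 = 0 ∧ t (Fin.last k) = 1 ∧
      ∀ i : Fin k, ContDiffOn ℝ 1 γ (Icc (t i.castSucc) (t i.succ))

/-- The Kobayashi–Royden length `∫₀¹ F_Ω(γ(t), γ′(t)) dt` of a path. -/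
def kobayashiRoydenLength (n : ℕ) (Ω : Set (Cn n)) (J : Cn n → (Cn n →L[ℝ] Cn n))
    (γ : ℝ → Cn n) : ℝ≥0∞ :=
  ∫⁻ t in Icc (0:ℝ) 1, kobayashiRoyden n Ω J (γ t) (deriv γ t)

/-- The integrated Kobayashi–Royden pseudodistance `d̄_Ω(p, q)`. -/
def integratedKRDist (n : ℕ) (Ω : Set (Cn n)) (J : Cn n → (Cn n →L[ℝ] Cn n))
    (p q : Cn n) : ℝ≥0∞ :=
  ⨅ γ : {γ : ℝ → Cn n // IsPiecewiseC1PathIn n Ω γ ∧ γ 0 = p ∧ γ 1 = q},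
    kobayashiRoydenLength n Ω J γ

section aux
open MeasureTheory

lemma rad_gen (f : ℝ → ℝ) (a : ℂ) (hf : IntegrableOn (fun y : ℝ => y * f y) (Ioi 0)) :
    Integrable (fun z : ℂ => f ‖z - a‖) ∧
      ∫ z : ℂ, f ‖z - a‖ = 2 * Real.pi * ∫ y in Ioi (0:ℝ), y * f y := by
  constructor
  · have : Integrable (fun z : ℂ => f ‖z‖) := by
      rw [integrable_fun_norm_addHaar]
      simpa using hf
    exact this.comp_sub_right a
  · rw [integral_sub_right_eq_self (fun z : ℂ => f ‖z‖) a, integral_fun_norm_addHaar]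
    simp [Measure.real, Complex.volume_ball]
    ring

lemma rad_in (s r : ℝ) (hs : -2 < s) (hr : 0 < r) (a : ℂ) :
    Integrable (fun z : ℂ => (Iio r).indicator (fun y : ℝ => y ^ s) ‖z - a‖) ∧
      ∫ z : ℂ, (Iio r).indicator (fun y : ℝ => y ^ s) ‖z - a‖
        = 2 * Real.pi * (r ^ (s + 2) / (s + 2)) := by
  have key : EqOn (fun y : ℝ => y * (Iio r).indicator (fun y : ℝ => y ^ s) y)
      ((Iio r).indicator (fun y : ℝ => y ^ (s + 1))) (Ioi 0) := by
    intro y hy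
    by_cases h : y < r
    · simp [indicator, h, Real.rpow_add_one (ne_of_gt hy), mul_comm]
    · simp [indicator, h]
  have h1 : IntegrableOn (fun y : ℝ => y ^ (s + 1)) (Ioo 0 r) :=
    (intervalIntegral.integrableOn_Ioo_rpow_iff hr).2 (by linarith)
  have hset : Ioi (0:ℝ) ∩ Iio r = Ioo 0 r := by ext; simp
  have h2 := rad_gen ((Iio r).indicator (fun y : ℝ => y ^ s)) a (by
    rw [integrableOn_congr_fun key measurableSet_Ioi, IntegrableOn,
      integrable_indicator_iff measurableSet_Iio, IntegrableOn, Measure.restrict_restrict measurableSet_Iio, inter_comm, hset]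
    exact h1)
  refine ⟨h2.1, ?_⟩
  rw [h2.2, setIntegral_congr_fun measurableSet_Ioi key, setIntegral_indicator measurableSet_Iio, hset,
    ← integral_Ioc_eq_integral_Ioo, ← intervalIntegral.integral_of_le hr.le, integral_rpow (Or.inl (by linarith))]
  rw [Real.zero_rpow (by linarith)]
  ring_nf

lemma rad_out (s r : ℝ) (hs : s < -2) (hr : 0 < r) (a : ℂ) :
    Integrable (fun z : ℂ => (Ioi r).indicator (fun y : ℝ => y ^ s) ‖z - a‖) ∧
      ∫ z : ℂ, (Ioi r).indicator (fun y : ℝ => y ^ s) ‖z - a‖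
        = 2 * Real.pi * (r ^ (s + 2) / (-(s + 2))) := by
  have key : EqOn (fun y : ℝ => y * (Ioi r).indicator (fun y : ℝ => y ^ s) y)
      ((Ioi r).indicator (fun y : ℝ => y ^ (s + 1))) (Ioi 0) := by
    intro y hy
    by_cases h : r < y
    · simp [indicator, h, Real.rpow_add_one (ne_of_gt hy), mul_comm]
    · simp [indicator, h]
  have h1 : IntegrableOn (fun y : ℝ => y ^ (s + 1)) (Ioi r) :=
    integrableOn_Ioi_rpow_of_lt (by linarith) hr
  have hset : Ioi (0:ℝ) ∩ Ioi r = Ioi r := by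
    ext x; simp; intro h; linarith
  have h2 := rad_gen ((Ioi r).indicator (fun y : ℝ => y ^ s)) a (by
    rw [integrableOn_congr_fun key measurableSet_Ioi, IntegrableOn,
      integrable_indicator_iff measurableSet_Ioi, IntegrableOn, Measure.restrict_restrict measurableSet_Ioi, inter_comm, hset]
    exact h1)
  refine ⟨h2.1, ?_⟩
  rw [h2.2, setIntegral_congr_fun measurableSet_Ioi key, setIntegral_indicator measurableSet_Ioi, hset,
    integral_Ioi_rpow_of_lt (by linarith) hr]
  rw [div_neg, neg_div]
  ring_nf

/-- two-point kernel -/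
lemma two_pt (lam : ℝ) (hl : lam ∈ Ioo (0:ℝ) 1) : ∃ C : ℝ, 0 < C ∧ ∀ a b : ℂ, a ≠ b →
    Integrable (fun z : ℂ => ‖z - a‖ ^ (lam - 2) * ‖z - b‖⁻¹) ∧
    ∫ z : ℂ, ‖z - a‖ ^ (lam - 2) * ‖z - b‖⁻¹ ≤ C * ‖a - b‖ ^ (lam - 1) := by
  obtain ⟨h0, h1⟩ := hl
  refine ⟨2 * Real.pi * ((1/2 : ℝ) ^ (lam - 1) / lam + (1/2 : ℝ) ^ (lam - 1)
    + 3 * ((1/4 : ℝ) ^ (lam - 1) / (1 - lam))), ?_, ?_⟩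
  · have : 0 < 1 - lam := by linarith
    positivity
  intro a b hab
  set d := ‖a - b‖ with hd
  have hdpos : 0 < d := norm_pos_iff.2 (sub_ne_zero.2 hab)
  have e1 := rad_in (lam - 2) (d/2) (by linarith) (by linarith) a
  have e2 := rad_in (-1) (d/2) (by linarith) (by linarith) b
  have e3 := rad_out (lam - 3) (d/4) (by linarith) (by linarith) a
  set F1 := (fun z : ℂ => (Iio (d/2)).indicator (fun y : ℝ => y ^ (lam-2)) ‖z - a‖) with hF1
  set F2 := (fun z : ℂ => (Iio (d/2)).indicator (fun y : ℝ => y ^ (-1:ℝ)) ‖z - b‖) with hF2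
  set F3 := (fun z : ℂ => (Ioi (d/4)).indicator (fun y : ℝ => y ^ (lam-3)) ‖z - a‖) with hF3
  have n1 : ∀ z, 0 ≤ F1 z := fun z => indicator_apply_nonneg fun _ => Real.rpow_nonneg (norm_nonneg _) _
  have n2 : ∀ z, 0 ≤ F2 z := fun z => indicator_apply_nonneg fun _ => Real.rpow_nonneg (norm_nonneg _) _
  have n3 : ∀ z, 0 ≤ F3 z := fun z => indicator_apply_nonneg fun _ => Real.rpow_nonneg (norm_nonneg _) _
  have hG : Integrable (fun z => (d/2)⁻¹ * F1 z + (d/2)^(lam-2) * F2 z + 3 * F3 z) :=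
    ((e1.1.const_mul _).add (e2.1.const_mul _)).add (e3.1.const_mul _)
  have hG12 : Integrable (fun z => (d/2)⁻¹ * F1 z + (d/2)^(lam-2) * F2 z) :=
    (e1.1.const_mul _).add (e2.1.const_mul _)
  have hbound : ∀ z : ℂ, ‖z - a‖ ^ (lam - 2) * ‖z - b‖⁻¹ ≤
      (d/2)⁻¹ * F1 z + (d/2)^(lam-2) * F2 z + 3 * F3 z := by
    intro z
    have t1 : d ≤ ‖z - a‖ + ‖z - b‖ := by
      rw [hd, show a - b = (z - b) - (z - a) by ring, add_comm]; exact norm_sub_le _ _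
    have t2 : ‖z - a‖ ≤ ‖z - b‖ + d := by
      rw [hd, show z - a = (z - b) - (a - b) by ring]; exact norm_sub_le _ _
    have q1 : 0 ≤ (d/2)⁻¹ * F1 z := mul_nonneg (by positivity) (n1 z)
    have q2 : 0 ≤ (d/2)^(lam-2) * F2 z := mul_nonneg (by positivity) (n2 z)
    have q3 : 0 ≤ 3 * F3 z := mul_nonneg (by positivity) (n3 z)
    by_cases c1 : ‖z - a‖ < d/2
    · have : F1 z = ‖z - a‖ ^ (lam-2) := by simp [hF1, indicator, c1]
      have : ‖z - a‖ ^ (lam - 2) * ‖z - b‖⁻¹ ≤ (d/2)⁻¹ * F1 z := by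
        rw [this, mul_comm]
        gcongr
        linarith
      linarith
    by_cases c2 : ‖z - b‖ < d/2
    · have : F2 z = ‖z - b‖⁻¹ := by simp [hF2, indicator, c2, Real.rpow_neg_one]
      have : ‖z - a‖ ^ (lam - 2) * ‖z - b‖⁻¹ ≤ (d/2)^(lam-2) * F2 z := by
        rw [this]
        gcongr ?_ * _
        exact Real.rpow_le_rpow_of_nonpos (by linarith) (by linarith) (by linarith)
      linarith
    · have c3 : d/4 < ‖z - a‖ := by linarith
      have c4 : 0 < ‖z - a‖ := by linarith
      have : F3 z = ‖z - a‖ ^ (lam-3) := by simp [hF3, indicator, c3]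
      have : ‖z - a‖ ^ (lam - 2) * ‖z - b‖⁻¹ ≤ 3 * F3 z := by
        rw [this, show lam - 3 = (lam - 2) - 1 by ring, Real.rpow_sub_one c4.ne', 
          show 3 * (‖z - a‖ ^ (lam - 2) / ‖z - a‖) = ‖z - a‖ ^ (lam - 2) * (‖z - a‖/3)⁻¹ by field_simp]
        gcongr
        linarith
      linarith
  have hI : Integrable (fun z : ℂ => ‖z - a‖ ^ (lam - 2) * ‖z - b‖⁻¹) := by
    refine hG.mono' (by apply Measurable.aestronglyMeasurable; fun_prop) (ae_of_all _ fun z => ?_)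
    rw [Real.norm_of_nonneg (by positivity)]
    exact hbound z
  refine ⟨hI, (integral_mono hI hG hbound).trans (le_of_eq ?_)⟩
  rw [integral_add hG12 (e3.1.const_mul _),
    integral_add (e1.1.const_mul _) (e2.1.const_mul _), integral_const_mul, integral_const_mul, integral_const_mul,
    e1.2, e2.2, e3.2]
  have r1 : (d/2)⁻¹ * (d/2)^lam = (1/2:ℝ)^(lam-1) * d^(lam-1) := by
    rw [← Real.mul_rpow (by norm_num) hdpos.le, show 1/2*d = d/2 by ring, Real.rpow_sub_one (by positivity)]
    ring
  have r2 : (d/2)^(lam-2) * (d/2) = (1/2:ℝ)^(lam-1) * d^(lam-1) := by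
    rw [← Real.mul_rpow (by norm_num) hdpos.le, show 1/2*d = d/2 by ring, ← Real.rpow_add_one (by positivity)]
    ring_nf
  have r3 : (d/4)^(lam-1) = (1/4:ℝ)^(lam-1) * d^(lam-1) := by
    rw [← Real.mul_rpow (by norm_num) hdpos.le, show 1/4*d = d/4 by ring]
  rw [show lam - 2 + 2 = lam by ring, show lam - 3 + 2 = lam - 1 by ring, show (-1:ℝ)+2 = 1 by ring, Real.rpow_one, r3]
  rw [show (-(lam - 1)) = 1 - lam by ring]
  linear_combination (2 * Real.pi / lam) * r1 + 2 * Real.pi * r2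

lemma inv_integrable (R : ℝ) (hR : 0 < R) (w : ℂ) (hw : ‖w‖ < R) (s : ℝ) (hs : -2 < s) :
    IntegrableOn (fun z : ℂ => ‖z - w‖ ^ s) (ball (0:ℂ) R) ∧
    ∫ z in ball (0:ℂ) R, ‖z - w‖ ^ s ≤ 2 * Real.pi * ((2 * R) ^ (s + 2) / (s + 2)) := by
  have e := rad_in s (2 * R) hs (by linarith) w
  have hin : ∀ z ∈ ball (0:ℂ) R, ‖z - w‖ < 2 * R := by
    intro z hz
    have := norm_sub_le z w
    rw [mem_ball_zero_iff] at hz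
    linarith
  have hc : EqOn (fun z : ℂ => (Iio (2*R)).indicator (fun y : ℝ => y ^ s) ‖z - w‖)
      (fun z : ℂ => ‖z - w‖ ^ s) (ball (0:ℂ) R) := by
    intro z hz
    simp [indicator, hin z hz]
  constructor
  · exact (integrableOn_congr_fun hc measurableSet_ball).1 e.1.integrableOn
  · rw [← e.2, ← setIntegral_congr_fun measurableSet_ball hc]
    exact setIntegral_le_integral e.1 (ae_of_all _ fun z =>
      indicator_apply_nonneg fun _ => Real.rpow_nonneg (norm_nonneg _) _)

lemma inv_integrable' (R : ℝ) (hR : 0 < R) (w : ℂ) (hw : ‖w‖ < R) :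
    IntegrableOn (fun z : ℂ => (z - w)⁻¹) (ball (0:ℂ) R) := by
  have := (inv_integrable R hR w hw (-1) (by norm_num)).1
  refine Integrable.mono' this (by apply Measurable.aestronglyMeasurable; fun_prop) (ae_of_all _ fun z => ?_)
  rw [norm_inv, Real.rpow_neg_one]

lemma avg_small (ζ w : ℂ) (h : ‖ζ‖ < ‖w‖) :
    Real.circleAverage (fun u => (u * ζ - w)⁻¹) 0 1 = -w⁻¹ := by
  have hne : ∀ u ∈ closedBall (0:ℂ) 1, u * ζ - w ≠ 0 := by
    intro u hu h0
    rw [mem_closedBall_zero_iff] at hu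
    have : ‖u * ζ‖ = ‖w‖ := by rw [sub_eq_zero.1 h0]
    rw [norm_mul] at this
    nlinarith [norm_nonneg ζ]
  have := circleAverage_of_differentiable_on_off_countable (s := ∅) (c := 0) (R := 1)
    (f := fun u => (u * ζ - w)⁻¹) countable_empty
    (by
      rw [abs_one]
      exact ContinuousOn.inv₀ (by fun_prop) hne)
    (by
      rw [abs_one]
      intro z hz
      exact DifferentiableAt.inv (by fun_prop) (hne z (ball_subset_closedBall hz.1)))
  rw [this]
  simp

lemma avg_large (ζ w : ℂ) (h : ‖w‖ < ‖ζ‖) :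
    Real.circleAverage (fun u => (u * ζ - w)⁻¹) 0 1 = 0 := by
  let g : ℂ → ℂ := fun u => u * ((starRingEnd ℂ) ζ - (starRingEnd ℂ) w * u)⁻¹
  have hne : ∀ u ∈ closedBall (0:ℂ) 1, (starRingEnd ℂ) ζ - (starRingEnd ℂ) w * u ≠ 0 := by
    intro u hu h0
    rw [mem_closedBall_zero_iff] at hu
    have : ‖(starRingEnd ℂ) ζ‖ = ‖(starRingEnd ℂ) w * u‖ := by rw [sub_eq_zero.1 h0]
    rw [norm_mul, Complex.norm_conj, Complex.norm_conj] at this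
    nlinarith [norm_nonneg w]
  have h1 : Real.circleAverage g 0 1 = 0 := by
    have := circleAverage_of_differentiable_on_off_countable (s := ∅) (c := 0) (R := 1)
      (f := g) countable_empty
      (by
        rw [abs_one]
        exact continuousOn_id.mul (ContinuousOn.inv₀ (by fun_prop) hne))
      (by
        rw [abs_one]
        intro z hz
        exact differentiableAt_id.mul (DifferentiableAt.inv (by fun_prop) (hne z (ball_subset_closedBall hz.1))))
    rw [this]
    simp [g]
  have h2 : Real.circleAverage (fun u => (u * ζ - w)⁻¹) 0 1
      = Real.circleAverage (fun u => (starRingEnd ℂ) (g u)) 0 1 := by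
    apply Real.circleAverage_congr_sphere
    intro u hu
    rw [abs_one, mem_sphere_zero_iff_norm] at hu
    have hu0 : u ≠ 0 := by rintro rfl; simp at hu
    have hc : (starRingEnd ℂ) u = u⁻¹ := by
      rw [Complex.inv_def, Complex.normSq_eq_norm_sq, hu]; simp
    simp only [g, map_mul, map_inv₀, map_sub, Complex.conj_conj, hc]
    rw [← mul_inv]
    congr 1
    field_simp
  rw [h2, Real.circleAverage_def, intervalIntegral.integral_of_le (by positivity), integral_conj,
    ← intervalIntegral.integral_of_le (by positivity)]
  rw [Real.circleAverage_def, smul_eq_zero] at h1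
  rcases h1 with h1 | h1
  · rw [h1, zero_smul]
  · rw [h1]; simp

lemma cauchy_one (R : ℝ) (w : ℂ) (hw : ‖w‖ < R) :
    ∫ z in ball (0:ℂ) R, (z - w)⁻¹ = -Real.pi * (starRingEnd ℂ) w := by
  have hR : 0 < R := (norm_nonneg w).trans_lt hw
  let f : ℂ → ℂ := (ball (0:ℂ) R).indicator (fun z => (z - w)⁻¹)
  have hfm : Measurable f := Measurable.indicator (by fun_prop) measurableSet_ball
  have hfi : Integrable f := (integrable_indicator_iff measurableSet_ball).2 (inv_integrable' R hR w hw)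
  have hcm : ∀ θ : ℝ, circleMap 0 1 θ = (Circle.exp θ : ℂ) := by
    intro θ; simp [circleMap]
  have hrot : ∀ θ : ℝ, MeasurePreserving (fun z : ℂ => circleMap 0 1 θ * z) := by
    intro θ
    have := (rotation (Circle.exp θ)).measurePreserving
    convert this using 2 with z
    rw [hcm, rotation_apply]
  have hemb : ∀ θ : ℝ, MeasurableEmbedding (fun z : ℂ => circleMap 0 1 θ * z) := by
    intro θ
    have := (rotation (Circle.exp θ)).toHomeomorph.measurableEmbedding
    convert this using 2 with z
    rw [hcm]; simp
  have hint : ∀ θ : ℝ, ∫ z, f (circleMap 0 1 θ * z) = ∫ z, f z := fun θ =>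
    (hrot θ).integral_comp (hemb θ) f
  have hintn : ∀ θ : ℝ, ∫ z, ‖f (circleMap 0 1 θ * z)‖ = ∫ z, ‖f z‖ := fun θ =>
    (hrot θ).integral_comp (hemb θ) (fun z => ‖f z‖)
  have hprod : Integrable (Function.uncurry fun (θ : ℝ) (z : ℂ) => f (circleMap 0 1 θ * z))
      ((volume.restrict (Ioc 0 (2 * Real.pi))).prod volume) := by
    rw [integrable_prod_iff]
    · refine ⟨ae_of_all _ fun θ => ?_, ?_⟩
      · exact ((hrot θ).integrable_comp_emb (hemb θ)).2 hfi
      · simp only [Function.uncurry, hintn]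
        exact integrable_const _
    · apply Measurable.aestronglyMeasurable
      apply hfm.comp
      have : Continuous (fun p : ℝ × ℂ => circleMap 0 1 p.1 * p.2) := by
        have := continuous_circleMap 0 1
        fun_prop
      exact this.measurable
  have hswap := integral_integral_swap hprod
  have havg : ∀ᵐ z : ℂ, ∫ θ in Ioc 0 (2 * Real.pi), f (circleMap 0 1 θ * z)
      = (ball (0:ℂ) ‖w‖).indicator (fun _ => (2 * Real.pi : ℝ) • (-w⁻¹)) z := by
    have hs : ∀ᵐ z : ℂ, z ∉ sphere (0:ℂ) ‖w‖ := measure_eq_zero_iff_ae_notMem.1 (Measure.addHaar_sphere _ _ _)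
    filter_upwards [hs] with z hz
    rw [mem_sphere_zero_iff_norm] at hz
    have e : ∫ θ in Ioc 0 (2 * Real.pi), f (circleMap 0 1 θ * z) =
        (2 * Real.pi : ℝ) • Real.circleAverage (fun u => f (u * z)) 0 1 := by
      rw [Real.circleAverage_def, ← intervalIntegral.integral_of_le (by positivity), smul_smul,
        mul_inv_cancel₀ (by positivity), one_smul]
    rw [e]
    by_cases hzR : ‖z‖ < R
    · have e2 : Real.circleAverage (fun u => f (u * z)) 0 1 =
          Real.circleAverage (fun u => (u * z - w)⁻¹) 0 1 := by
        apply Real.circleAverage_congr_sphere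
        intro u hu
        rw [abs_one, mem_sphere_zero_iff_norm] at hu
        simp [f, indicator, hu, hzR]
      rw [e2]
      rcases lt_or_gt_of_ne hz with h | h
      · rw [avg_small _ _ h, indicator_of_mem (by simpa using h)]
      · rw [avg_large _ _ h, indicator_of_notMem (by simpa using h.le), smul_zero]
    · have e2 : Real.circleAverage (fun u => f (u * z)) 0 1 =
          Real.circleAverage (fun u => (0:ℂ)) 0 1 := by
        apply Real.circleAverage_congr_sphere
        intro u hu
        rw [abs_one, mem_sphere_zero_iff_norm] at hu
        simp [f, indicator, hu, hzR]
      rw [e2, indicator_of_notMem (by simp; linarith)]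
      simp [Real.circleAverage_def]
  rw [integral_congr_ae havg] at hswap
  simp only [hint] at hswap
  rw [integral_indicator measurableSet_ball, setIntegral_const,
    integral_indicator measurableSet_ball, setIntegral_const] at hswap
  simp only [Measure.real, Complex.volume_ball, Real.volume_Ioc, sub_zero] at hswap
  rw [ENNReal.toReal_ofReal (by positivity)] at hswap
  have h2p : (2 * Real.pi : ℝ) ≠ 0 := by positivity
  rw [smul_comm] at hswap
  have := smul_right_injective ℂ h2p hswap
  rw [this]
  by_cases hw0 : w = 0
  · simp [hw0]
  simp
  rw [← Complex.mul_conj']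
  field_simp

def QQ (n : ℕ) (R : ℝ) (h : ℂ → Cn n) (a : ℂ) : Cn n :=
  ∫ z in ball (0:ℂ) R, ((z - a)⁻¹ * (z - a)⁻¹) • (h z - h a)

def PP (n : ℕ) (R : ℝ) (h : ℂ → Cn n) (a b : ℂ) : Cn n :=
  ∫ z in ball (0:ℂ) R, ((z - a)⁻¹ * (z - b)⁻¹) • (h z - h a)

lemma rpow_aux (x lam H : ℝ) (hx : 0 ≤ x) (hl : lam ∈ Ioo (0:ℝ) 1) :
    x⁻¹ * x⁻¹ * (H * x ^ lam) = H * x ^ (lam - 2) := by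
  rcases hx.eq_or_lt with rfl | hx
  · rw [Real.zero_rpow hl.1.ne', Real.zero_rpow (show lam - 2 ≠ 0 by linarith [hl.2])]; simp
  · rw [show lam - 2 = lam - 1 - 1 by ring, Real.rpow_sub_one hx.ne', Real.rpow_sub_one hx.ne']
    field_simp

lemma meas_aux (n : ℕ) (R : ℝ) (h : ℂ → Cn n) (k : ℂ → ℂ) (hk : Measurable k) (c : Cn n)
    (hm : AEStronglyMeasurable h (volume.restrict (ball (0:ℂ) R))) :
    AEStronglyMeasurable (fun z => k z • (h z - c)) (volume.restrict (ball (0:ℂ) R)) :=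
  hk.aestronglyMeasurable.smul (hm.sub aestronglyMeasurable_const)

lemma QQ_int (n : ℕ) (R lam H : ℝ) (hR : 0 < R) (hl : lam ∈ Ioo (0:ℝ) 1) (h : ℂ → Cn n)
    (hm : AEStronglyMeasurable h (volume.restrict (ball (0:ℂ) R))) (hH : 0 ≤ H)
    (hh : ∀ ζ ∈ ball (0:ℂ) R, ∀ ζ' ∈ ball (0:ℂ) R, ‖h ζ - h ζ'‖ ≤ H * ‖ζ - ζ'‖ ^ lam)
    (a : ℂ) (ha : a ∈ ball (0:ℂ) R) :
    IntegrableOn (fun z => ((z - a)⁻¹ * (z - a)⁻¹) • (h z - h a)) (ball (0:ℂ) R) ∧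
    ‖QQ n R h a‖ ≤ H * (2 * Real.pi * ((2 * R) ^ lam / lam)) := by
  have e := inv_integrable R hR a (by simpa using ha) (lam - 2) (by linarith [hl.1])
  have hb : ∀ᵐ z ∂(volume.restrict (ball (0:ℂ) R)),
      ‖((z - a)⁻¹ * (z - a)⁻¹) • (h z - h a)‖ ≤ H * ‖z - a‖ ^ (lam - 2) := by
    refine ae_restrict_of_forall_mem measurableSet_ball fun z hz => ?_
    rw [norm_smul, norm_mul, norm_inv, ← rpow_aux _ _ _ (norm_nonneg _) hl]
    gcongr
    exact hh z hz a ha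
  constructor
  · exact Integrable.mono' (e.1.const_mul H) (meas_aux n R h _ (by fun_prop) _ hm) hb
  · refine (norm_integral_le_of_norm_le (e.1.const_mul H) hb).trans ?_
    rw [integral_const_mul]
    have := e.2
    rw [show lam - 2 + 2 = lam by ring] at this
    gcongr

lemma PQ (n : ℕ) (R lam H C : ℝ) (hR : 0 < R) (hl : lam ∈ Ioo (0:ℝ) 1) (h : ℂ → Cn n)
    (hm : AEStronglyMeasurable h (volume.restrict (ball (0:ℂ) R))) (hH : 0 ≤ H)
    (hh : ∀ ζ ∈ ball (0:ℂ) R, ∀ ζ' ∈ ball (0:ℂ) R, ‖h ζ - h ζ'‖ ≤ H * ‖ζ - ζ'‖ ^ lam)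
    (hC : ∀ a b : ℂ, a ≠ b →
      Integrable (fun z : ℂ => ‖z - a‖ ^ (lam - 2) * ‖z - b‖⁻¹) ∧
      ∫ z : ℂ, ‖z - a‖ ^ (lam - 2) * ‖z - b‖⁻¹ ≤ C * ‖a - b‖ ^ (lam - 1))
    (a b : ℂ) (ha : a ∈ ball (0:ℂ) R) (hab : a ≠ b) :
    IntegrableOn (fun z => ((z - a)⁻¹ * (z - b)⁻¹) • (h z - h a)) (ball (0:ℂ) R) ∧
    ‖QQ n R h a - PP n R h a b‖ ≤ H * C * ‖a - b‖ ^ lam := by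
  obtain ⟨i1, i2⟩ := hC a b hab
  have hd : 0 < ‖a - b‖ := norm_pos_iff.2 (sub_ne_zero.2 hab)
  have hb : ∀ᵐ z ∂(volume.restrict (ball (0:ℂ) R)),
      ‖((a - b) * ((z - a)⁻¹ * (z - a)⁻¹ * (z - b)⁻¹)) • (h z - h a)‖ ≤
        (H * ‖a - b‖) * (‖z - a‖ ^ (lam - 2) * ‖z - b‖⁻¹) := by
    refine ae_restrict_of_forall_mem measurableSet_ball fun z hz => ?_
    rw [norm_smul, norm_mul, norm_mul, norm_mul, norm_inv, norm_inv]
    calc _ ≤ ‖a - b‖ * (‖z - a‖⁻¹ * ‖z - a‖⁻¹ * ‖z - b‖⁻¹) * (H * ‖z - a‖ ^ lam) := by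
          gcongr
          exact hh z hz a ha
      _ = ‖a - b‖ * ‖z - b‖⁻¹ * (‖z - a‖⁻¹ * ‖z - a‖⁻¹ * (H * ‖z - a‖ ^ lam)) := by ring
      _ = _ := by rw [rpow_aux _ _ _ (norm_nonneg _) hl]; ring
  have hKint : IntegrableOn (fun z => ((a - b) * ((z - a)⁻¹ * (z - a)⁻¹ * (z - b)⁻¹)) • (h z - h a))
      (ball (0:ℂ) R) :=
    Integrable.mono' (i1.integrableOn.const_mul _) (meas_aux n R h _ (by fun_prop) _ hm) hb
  have hQ := (QQ_int n R lam H hR hl h hm hH hh a ha).1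
  have hne : ∀ᵐ z ∂(volume.restrict (ball (0:ℂ) R)), z ≠ b :=
    ae_restrict_of_ae (Measure.ae_ne volume b)
  have hid : ∀ᵐ z ∂(volume.restrict (ball (0:ℂ) R)),
      ((z - a)⁻¹ * (z - a)⁻¹) • (h z - h a) -
        ((a - b) * ((z - a)⁻¹ * (z - a)⁻¹ * (z - b)⁻¹)) • (h z - h a) =
      ((z - a)⁻¹ * (z - b)⁻¹) • (h z - h a) := by
    filter_upwards [hne] with z hz
    by_cases hza : z = a
    · simp [hza]
    rw [← sub_smul]
    congr 1
    have h1 : z - a ≠ 0 := sub_ne_zero.2 hza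
    have h2 : z - b ≠ 0 := sub_ne_zero.2 hz
    field_simp
    ring
  constructor
  · exact (integrable_congr hid).1 (hQ.sub hKint)
  · have : QQ n R h a - PP n R h a b =
      ∫ z in ball (0:ℂ) R, ((a - b) * ((z - a)⁻¹ * (z - a)⁻¹ * (z - b)⁻¹)) • (h z - h a) := by
      rw [QQ, PP, ← integral_congr_ae hid, integral_sub hQ hKint]
      abel
    rw [this]
    refine (norm_integral_le_of_norm_le (i1.integrableOn.const_mul _) hb).trans ?_
    rw [integral_const_mul]
    have i3 : ∫ z in ball (0:ℂ) R, ‖z - a‖ ^ (lam - 2) * ‖z - b‖⁻¹ ≤ C * ‖a - b‖ ^ (lam - 1) :=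
      (setIntegral_le_integral i1 (ae_of_all _ fun z => by positivity)).trans i2
    calc _ ≤ H * ‖a - b‖ * (C * ‖a - b‖ ^ (lam - 1)) := by gcongr
      _ = _ := by rw [Real.rpow_sub_one hd.ne']; field_simp

lemma T_int (n : ℕ) (R S : ℝ) (hR : 0 < R) (h : ℂ → Cn n)
    (hm : AEStronglyMeasurable h (volume.restrict (ball (0:ℂ) R)))
    (hS : ∀ ζ ∈ ball (0:ℂ) R, ‖h ζ‖ ≤ S) (b : ℂ) (hb : b ∈ ball (0:ℂ) R) :
    IntegrableOn (fun z => (z - b)⁻¹ • h z) (ball (0:ℂ) R) := by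
  refine Integrable.mono' ((inv_integrable' R hR b (by simpa using hb)).norm.const_mul S)
    (AEStronglyMeasurable.smul (show Measurable (fun z : ℂ => (z - b)⁻¹) by fun_prop).aestronglyMeasurable hm)
    (ae_restrict_of_forall_mem measurableSet_ball fun z hz => ?_)
  rw [norm_smul, mul_comm]
  gcongr
  exact hS z hz

lemma T_split (n : ℕ) (R S : ℝ) (hR : 0 < R) (h : ℂ → Cn n)
    (hm : AEStronglyMeasurable h (volume.restrict (ball (0:ℂ) R)))
    (hS : ∀ ζ ∈ ball (0:ℂ) R, ‖h ζ‖ ≤ S) (b : ℂ) (hb : b ∈ ball (0:ℂ) R) (c : Cn n) :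
    IntegrableOn (fun z => (z - b)⁻¹ • (h z - c)) (ball (0:ℂ) R) ∧
    ∫ z in ball (0:ℂ) R, (z - b)⁻¹ • h z =
      (-Real.pi * (starRingEnd ℂ) b) • c + ∫ z in ball (0:ℂ) R, (z - b)⁻¹ • (h z - c) := by
  have i1 := T_int n R S hR h hm hS b hb
  have i2 : IntegrableOn (fun z => (z - b)⁻¹ • c) (ball (0:ℂ) R) :=
    (inv_integrable' R hR b (by simpa using hb)).smul_const c
  have i3 := i1.sub i2
  simp only [Pi.sub_def, ← smul_sub] at i3
  refine ⟨i3, ?_⟩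
  simp only [smul_sub]
  rw [integral_sub i1 i2, integral_smul_const, cauchy_one R b (by simpa using hb)]
  abel

lemma P_eq (n : ℕ) (R S : ℝ) (hR : 0 < R) (h : ℂ → Cn n)
    (hm : AEStronglyMeasurable h (volume.restrict (ball (0:ℂ) R)))
    (hS : ∀ ζ ∈ ball (0:ℂ) R, ‖h ζ‖ ≤ S) (a b : ℂ) (ha : a ∈ ball (0:ℂ) R)
    (hb : b ∈ ball (0:ℂ) R) :
    (∫ z in ball (0:ℂ) R, (z - b)⁻¹ • (h z - h a)) - (∫ z in ball (0:ℂ) R, (z - a)⁻¹ • (h z - h a))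
      = (b - a) • PP n R h a b := by
  rw [PP, ← integral_smul, ← integral_sub (T_split n R S hR h hm hS b hb (h a)).1
    (T_split n R S hR h hm hS a ha (h a)).1]
  have hne : ∀ᵐ z ∂(volume.restrict (ball (0:ℂ) R)), z ≠ b :=
    ae_restrict_of_ae (Measure.ae_ne volume b)
  apply integral_congr_ae
  filter_upwards [hne] with z hz
  by_cases hza : z = a
  · simp [hza]
  rw [← sub_smul, smul_smul]
  congr 1
  have h1 : z - a ≠ 0 := sub_ne_zero.2 hza
  have h2 : z - b ≠ 0 := sub_ne_zero.2 hz
  field_simp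
  ring

lemma PP_diff (n : ℕ) (R : ℝ) (hR : 0 < R) (h : ℂ → Cn n) (a b : ℂ)
    (ha : a ∈ ball (0:ℂ) R) (hb : b ∈ ball (0:ℂ) R) (hab : a ≠ b)
    (i1 : IntegrableOn (fun z => ((z - a)⁻¹ * (z - b)⁻¹) • (h z - h a)) (ball (0:ℂ) R))
    (i2 : IntegrableOn (fun z => ((z - b)⁻¹ * (z - a)⁻¹) • (h z - h b)) (ball (0:ℂ) R)) :
    ‖PP n R h a b - PP n R h b a‖ ≤ Real.pi * ‖h a - h b‖ := by
  have hd : a - b ≠ 0 := sub_ne_zero.2 hab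
  have hne : ∀ᵐ z ∂(volume.restrict (ball (0:ℂ) R)), z ≠ b :=
    ae_restrict_of_ae (Measure.ae_ne volume b)
  have hne' : ∀ᵐ z ∂(volume.restrict (ball (0:ℂ) R)), z ≠ a :=
    ae_restrict_of_ae (Measure.ae_ne volume a)
  have e : PP n R h a b - PP n R h b a =
      ∫ z in ball (0:ℂ) R, ((a - b)⁻¹ * ((z - a)⁻¹ - (z - b)⁻¹)) • (h b - h a) := by
    rw [PP, PP, ← integral_sub i1 i2]
    apply integral_congr_ae
    filter_upwards [hne, hne'] with z hz hza
    rw [mul_comm (z - b)⁻¹, ← smul_sub, sub_sub_sub_cancel_left]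
    congr 1
    have h1 : z - a ≠ 0 := sub_ne_zero.2 hza
    have h2 : z - b ≠ 0 := sub_ne_zero.2 hz
    field_simp
    ring
  rw [e, integral_smul_const, integral_const_mul,
    integral_sub (inv_integrable' R hR a (by simpa using ha)) (inv_integrable' R hR b (by simpa using hb)),
    cauchy_one R a (by simpa using ha), cauchy_one R b (by simpa using hb), ← mul_sub, ← map_sub,
    norm_smul, norm_mul, norm_mul, norm_inv, Complex.norm_conj, norm_neg, Complex.norm_real,
    Real.norm_of_nonneg Real.pi_pos.le, norm_sub_rev (h b)]
  have : ‖a - b‖ ≠ 0 := norm_ne_zero_iff.2 hd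
  field_simp
  rfl

lemma QQ_holder (n : ℕ) (R lam H C : ℝ) (hR : 0 < R) (hl : lam ∈ Ioo (0:ℝ) 1) (h : ℂ → Cn n)
    (hm : AEStronglyMeasurable h (volume.restrict (ball (0:ℂ) R))) (hH : 0 ≤ H)
    (hh : ∀ ζ ∈ ball (0:ℂ) R, ∀ ζ' ∈ ball (0:ℂ) R, ‖h ζ - h ζ'‖ ≤ H * ‖ζ - ζ'‖ ^ lam)
    (hC : ∀ a b : ℂ, a ≠ b →
      Integrable (fun z : ℂ => ‖z - a‖ ^ (lam - 2) * ‖z - b‖⁻¹) ∧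
      ∫ z : ℂ, ‖z - a‖ ^ (lam - 2) * ‖z - b‖⁻¹ ≤ C * ‖a - b‖ ^ (lam - 1))
    (a b : ℂ) (ha : a ∈ ball (0:ℂ) R) (hb : b ∈ ball (0:ℂ) R) :
    ‖QQ n R h a - QQ n R h b‖ ≤ H * (2 * C + Real.pi) * ‖a - b‖ ^ lam := by
  by_cases hab : a = b
  · subst hab
    simp [Real.zero_rpow hl.1.ne']
  obtain ⟨i1, b1⟩ := PQ n R lam H C hR hl h hm hH hh hC a b ha hab
  obtain ⟨i2, b2⟩ := PQ n R lam H C hR hl h hm hH hh hC b a hb (Ne.symm hab)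
  have b3 := PP_diff n R hR h a b ha hb hab i1 i2
  have b4 := hh a ha b hb
  rw [norm_sub_rev b a] at b2
  have b5 : Real.pi * ‖h a - h b‖ ≤ Real.pi * (H * ‖a - b‖ ^ lam) := by gcongr
  calc ‖QQ n R h a - QQ n R h b‖ = ‖(QQ n R h a - PP n R h a b) - (QQ n R h b - PP n R h b a)
        + (PP n R h a b - PP n R h b a)‖ := by congr 1; abel
    _ ≤ ‖QQ n R h a - PP n R h a b‖ + ‖QQ n R h b - PP n R h b a‖
        + ‖PP n R h a b - PP n R h b a‖ := (norm_add_le _ _).trans (by gcongr; exact norm_sub_le _ _)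
    _ ≤ _ := by linarith

lemma T_deriv (n : ℕ) (R lam H C S : ℝ) (hR : 0 < R) (hl : lam ∈ Ioo (0:ℝ) 1) (h : ℂ → Cn n)
    (hm : AEStronglyMeasurable h (volume.restrict (ball (0:ℂ) R))) (hH : 0 ≤ H)
    (hh : ∀ ζ ∈ ball (0:ℂ) R, ∀ ζ' ∈ ball (0:ℂ) R, ‖h ζ - h ζ'‖ ≤ H * ‖ζ - ζ'‖ ^ lam)
    (hS : ∀ ζ ∈ ball (0:ℂ) R, ‖h ζ‖ ≤ S)
    (hC : ∀ a b : ℂ, a ≠ b →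
      Integrable (fun z : ℂ => ‖z - a‖ ^ (lam - 2) * ‖z - b‖⁻¹) ∧
      ∫ z : ℂ, ‖z - a‖ ^ (lam - 2) * ‖z - b‖⁻¹ ≤ C * ‖a - b‖ ^ (lam - 1))
    (a : ℂ) (ha : a ∈ ball (0:ℂ) R) :
    HasDerivAt (fun b => ∫ z in ball (0:ℂ) R, (z - b)⁻¹ • (h z - h a)) (QQ n R h a) a := by
  rw [hasDerivAt_iff_isLittleO]
  have hO : (fun b => ((∫ z in ball (0:ℂ) R, (z - b)⁻¹ • (h z - h a)) -
      (∫ z in ball (0:ℂ) R, (z - a)⁻¹ • (h z - h a))) - (b - a) • QQ n R h a)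
      =O[𝓝 a] (fun b => ‖b - a‖ ^ lam * ‖b - a‖) := by
    refine Asymptotics.IsBigO.of_bound (H * C) ?_
    filter_upwards [isOpen_ball.mem_nhds ha] with b hb
    by_cases hab : a = b
    · subst hab; simp
    rw [P_eq n R S hR h hm hS a b ha hb, ← smul_sub, norm_smul, norm_sub_rev (PP n R h a b),
      Real.norm_of_nonneg (by positivity)]
    have := (PQ n R lam H C hR hl h hm hH hh hC a b ha hab).2
    rw [norm_sub_rev a b] at this
    calc _ ≤ ‖b - a‖ * (H * C * ‖b - a‖ ^ lam) := by gcongr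
      _ = _ := by ring
  refine hO.trans_isLittleO ?_
  have h1 : (fun b : ℂ => ‖b - a‖ ^ lam) =o[𝓝 a] (fun _ => (1:ℝ)) := by
    rw [Asymptotics.isLittleO_one_iff]
    have : ContinuousAt (fun b : ℂ => ‖b - a‖ ^ lam) a := by
      apply ContinuousAt.rpow_const
      · fun_prop
      · right; exact hl.1.le
    have := this.tendsto
    simpa [Real.zero_rpow hl.1.ne'] using this
  have h2 := h1.mul_isBigO (Asymptotics.isBigO_refl (fun b : ℂ => ‖b - a‖) (𝓝 a))
  simp only [one_mul] at h2
  exact h2.norm_right.of_norm_right.congr_right (fun _ => rfl) |>.trans_isBigO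
    (Asymptotics.isBigO_norm_left.2 (Asymptotics.isBigO_refl _ _))

lemma T_fderiv (n : ℕ) (R lam H C S : ℝ) (hR : 0 < R) (hl : lam ∈ Ioo (0:ℝ) 1) (h : ℂ → Cn n)
    (hm : AEStronglyMeasurable h (volume.restrict (ball (0:ℂ) R))) (hH : 0 ≤ H)
    (hh : ∀ ζ ∈ ball (0:ℂ) R, ∀ ζ' ∈ ball (0:ℂ) R, ‖h ζ - h ζ'‖ ≤ H * ‖ζ - ζ'‖ ^ lam)
    (hS : ∀ ζ ∈ ball (0:ℂ) R, ‖h ζ‖ ≤ S)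
    (hC : ∀ a b : ℂ, a ≠ b →
      Integrable (fun z : ℂ => ‖z - a‖ ^ (lam - 2) * ‖z - b‖⁻¹) ∧
      ∫ z : ℂ, ‖z - a‖ ^ (lam - 2) * ‖z - b‖⁻¹ ≤ C * ‖a - b‖ ^ (lam - 1))
    (a : ℂ) (ha : a ∈ ball (0:ℂ) R) :
    ∃ L : ℂ →L[ℝ] Cn n, HasFDerivAt
      (fun w : ℂ => (-(1 / Real.pi) : ℝ) • ∫ ζ in ball (0:ℂ) R, (ζ - w)⁻¹ • h ζ) L a ∧
      ∀ ξ : ℂ, L ξ = (starRingEnd ℂ) ξ • h a + (-(1 / Real.pi) : ℝ) • (ξ • QQ n R h a) := by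
  have d1 := (T_deriv n R lam H C S hR hl h hm hH hh hS hC a ha).hasFDerivAt.restrictScalars ℝ
  have d2 := d1.const_smul (-(1 / Real.pi) : ℝ)
  have d3 : HasFDerivAt (fun w : ℂ => (starRingEnd ℂ) w) (Complex.conjCLE : ℂ →L[ℝ] ℂ) a :=
    (Complex.conjCLE : ℂ →L[ℝ] ℂ).hasFDerivAt
  have d4 := (d3.smul_const (h a)).add d2
  refine ⟨_, d4.congr_of_eventuallyEq ?_, ?_⟩
  · filter_upwards [isOpen_ball.mem_nhds ha] with b hb
    simp only [Pi.add_apply, Pi.smul_apply]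
    rw [(T_split n R S hR h hm hS b hb (h a)).2, smul_add]
    congr 1
    rw [← Complex.coe_smul, smul_smul]
    congr 1
    have : (Real.pi : ℂ) ≠ 0 := by exact_mod_cast Real.pi_ne_zero
    push_cast
    field_simp
  · intro ξ
    simp

end aux

/-- Hölder estimates for the Cauchy transform
`(Th)(w) = -(1/π) ∫_{𝔻_R} (ζ - w)⁻¹ • h(ζ) dA(ζ)`: it solves `∂̄(Th) = h` on `𝔻_R`, and
its Wirtinger derivatives `∂(Th)`, `∂̄(Th)` are `λ`-Hölder with sup-norm plus Hölder
constant bounded by `c₁ (sup‖h‖ + H)`. -/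
theorem cauchy_transform_holder_estimates
    (n : ℕ) (hn : 1 ≤ n) (R lam : ℝ) (hR : 0 < R) (hlam : lam ∈ Set.Ioo (0:ℝ) 1) :
    ∃ c₁ : ℝ, 0 < c₁ ∧
      ∀ (h : ℂ → Cn n) (B H S : ℝ),
        (∀ z : ℂ, ‖h z‖ ≤ B) →
        (∀ ζ ∈ closedBall (0:ℂ) R, ∀ ζ' ∈ closedBall (0:ℂ) R,
          ‖h ζ - h ζ'‖ ≤ H * ‖ζ - ζ'‖ ^ lam) →
        (∀ ζ ∈ ball (0:ℂ) R, ‖h ζ‖ ≤ S) →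
        ∃ Th dTh dbarTh : ℂ → Cn n,
          (∀ w : ℂ, Th w = (-(1 / Real.pi) : ℝ) • ∫ ζ in ball (0:ℂ) R, (ζ - w)⁻¹ • h ζ) ∧
          (∀ w ∈ ball (0:ℂ) R, DifferentiableAt ℝ Th w) ∧
          (∀ w : ℂ, dTh w =
            (1 / 2 : ℂ) • (fderiv ℝ Th w 1 - Complex.I • fderiv ℝ Th w Complex.I)) ∧
          (∀ w : ℂ, dbarTh w =
            (1 / 2 : ℂ) • (fderiv ℝ Th w 1 + Complex.I • fderiv ℝ Th w Complex.I)) ∧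
          (∀ w ∈ ball (0:ℂ) R, dbarTh w = h w) ∧
          ∃ M₁ H₁ M₂ H₂ : ℝ,
            (∀ w ∈ ball (0:ℂ) R, ‖dTh w‖ ≤ M₁) ∧
            (∀ w ∈ ball (0:ℂ) R, ∀ w' ∈ ball (0:ℂ) R,
              ‖dTh w - dTh w'‖ ≤ H₁ * ‖w - w'‖ ^ lam) ∧
            M₁ + H₁ ≤ c₁ * (S + H) ∧
            (∀ w ∈ ball (0:ℂ) R, ‖dbarTh w‖ ≤ M₂) ∧
            (∀ w ∈ ball (0:ℂ) R, ∀ w' ∈ ball (0:ℂ) R,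
              ‖dbarTh w - dbarTh w'‖ ≤ H₂ * ‖w - w'‖ ^ lam) ∧
            M₂ + H₂ ≤ c₁ * (S + H) := by
  obtain ⟨C, hC0, hC⟩ := two_pt lam hlam
  have hl0 := hlam.1
  refine ⟨2 * ((2 * R) ^ lam / lam) + (1 / Real.pi) * (2 * C + Real.pi) + 1, by positivity, ?_⟩
  intro h B H S hB hHol hS
  have hH : 0 ≤ H := by
    have h1 := (norm_nonneg _).trans (hHol (R : ℂ) (by simp [abs_of_pos hR]) 0 (by simp [hR.le]))
    rw [sub_zero, Complex.norm_real, Real.norm_of_nonneg hR.le] at h1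
    exact nonneg_of_mul_nonneg_left h1 (by positivity)
  have hS0 : 0 ≤ S := (norm_nonneg _).trans (hS 0 (by simpa using hR))
  have hh : ∀ ζ ∈ ball (0:ℂ) R, ∀ ζ' ∈ ball (0:ℂ) R, ‖h ζ - h ζ'‖ ≤ H * ‖ζ - ζ'‖ ^ lam :=
    fun ζ hζ ζ' hζ' => hHol ζ (ball_subset_closedBall hζ) ζ' (ball_subset_closedBall hζ')
  have hcont : ContinuousOn h (ball (0:ℂ) R) := by
    intro a ha
    rw [ContinuousWithinAt, tendsto_iff_norm_sub_tendsto_zero]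
    have hc : ContinuousAt (fun b : ℂ => H * ‖b - a‖ ^ lam) a := by
      apply ContinuousAt.mul continuousAt_const
      apply ContinuousAt.rpow_const
      · fun_prop
      · right; exact hlam.1.le
    have hc2 : Tendsto (fun b : ℂ => H * ‖b - a‖ ^ lam) (𝓝[ball (0:ℂ) R] a) (𝓝 0) := by
      have := hc.tendsto
      simp only [sub_self, norm_zero, Real.zero_rpow hlam.1.ne', mul_zero] at this
      exact this.mono_left nhdsWithin_le_nhds
    refine squeeze_zero' (Eventually.of_forall fun _ => norm_nonneg _) ?_ hc2
    filter_upwards [self_mem_nhdsWithin] with b hb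
    exact hh b hb a ha
  have hm : MeasureTheory.AEStronglyMeasurable h (MeasureTheory.volume.restrict (ball (0:ℂ) R)) :=
    hcont.aestronglyMeasurable measurableSet_ball
  let Th : ℂ → Cn n := fun w => (-(1 / Real.pi) : ℝ) • ∫ ζ in ball (0:ℂ) R, (ζ - w)⁻¹ • h ζ
  have hF := fun a ha => T_fderiv n R lam H C S hR hlam h hm hH hh hS hC a ha
  have hval : ∀ a ∈ ball (0:ℂ) R, DifferentiableAt ℝ Th a ∧
      ∀ ξ : ℂ, fderiv ℝ Th a ξ = (starRingEnd ℂ) ξ • h a + (-(1 / Real.pi) : ℝ) • (ξ • QQ n R h a) := by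
    intro a ha
    obtain ⟨L, hL, hLv⟩ := hF a ha
    refine ⟨hL.differentiableAt, fun ξ => ?_⟩
    rw [← hLv ξ, ← hL.fderiv]
  have hd : ∀ a ∈ ball (0:ℂ) R, (1 / 2 : ℂ) • (fderiv ℝ Th a 1 - Complex.I • fderiv ℝ Th a Complex.I)
      = (-(1 / Real.pi) : ℝ) • QQ n R h a := by
    intro a ha
    rw [(hval a ha).2, (hval a ha).2]
    ext i
    simp
    linear_combination (norm := ring_nf) (1/2 : ℂ) * (h a i + (Real.pi:ℂ)⁻¹ * (QQ n R h a) i) * Complex.I_sq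
  have hdb : ∀ a ∈ ball (0:ℂ) R, (1 / 2 : ℂ) • (fderiv ℝ Th a 1 + Complex.I • fderiv ℝ Th a Complex.I)
      = h a := by
    intro a ha
    rw [(hval a ha).2, (hval a ha).2]
    ext i
    simp
    linear_combination (norm := ring_nf) -(1/2 : ℂ) * (h a i + (Real.pi:ℂ)⁻¹ * (QQ n R h a) i) * Complex.I_sq
  have hpi := Real.pi_pos
  have hnp : ‖(-(1 / Real.pi) : ℝ)‖ = 1 / Real.pi := by
    rw [norm_neg, Real.norm_of_nonneg (by positivity)]
  have hK1 : 0 ≤ 2 * ((2 * R) ^ lam / lam) := by positivity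
  have hK2 : 0 ≤ (1 / Real.pi) * (2 * C + Real.pi) := by positivity
  refine ⟨Th, _, _, fun w => rfl, fun w hw => (hval w hw).1, fun w => rfl, fun w => rfl, hdb,
    2 * ((2 * R) ^ lam / lam) * H, (1 / Real.pi) * (2 * C + Real.pi) * H, S, H, ?_, ?_, ?_, ?_, ?_, ?_⟩
  · intro w hw
    beta_reduce
    rw [hd w hw, norm_smul, hnp]
    have := (QQ_int n R lam H hR hlam h hm hH hh w hw).2
    calc _ ≤ 1 / Real.pi * (H * (2 * Real.pi * ((2 * R) ^ lam / lam))) := by gcongr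
      _ = _ := by field_simp
  · intro w hw w' hw'
    beta_reduce
    rw [hd w hw, hd w' hw', ← smul_sub, norm_smul, hnp]
    have := QQ_holder n R lam H C hR hlam h hm hH hh hC w w' hw hw'
    calc _ ≤ 1 / Real.pi * (H * (2 * C + Real.pi) * ‖w - w'‖ ^ lam) := by gcongr
      _ = _ := by ring
  · nlinarith [mul_nonneg hK1 hS0, mul_nonneg hK2 hS0]
  · intro w hw
    beta_reduce
    rw [hdb w hw]
    exact hS w hw
  · intro w hw w' hw'
    beta_reduce
    rw [hdb w hw, hdb w' hw']
    exact hh w hw w' hw'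
  · nlinarith [mul_nonneg hK1 hS0, mul_nonneg hK2 hS0, mul_nonneg hK1 hH, mul_nonneg hK2 hH]
end
end

section
/- Assume Ω is connected. Then the function d̄_Ω : Ω × Ω → ℝ defined by d̄_Ω(p,q) = inf_γ ∫₀¹ F_Ω(γ(t), γ′(t)) dt, the infimum over all piecewise continuously differentiable paths γ : [0,1] → Ω with γ(0) = p and γ(1) = q, is a well-defined finite-valued pseudodistance: d̄_Ω(p,q) ≥ 0, d̄_Ω(p,p) = 0, d̄_Ω(p,q) = d̄_Ω(q,p), and d̄_Ω(p,q) ≤ d̄_Ω(p,s) + d̄_Ω(s,q) for all p, q, s ∈ Ω. -/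
open Metric Set Filter
open scoped ENNReal Topology

noncomputable section

section HP1
open MeasureTheory UnitAddTorus
local instance instMSUAC : MeasureSpace UnitAddCircle := ⟨AddCircle.haarAddCircle⟩
local instance instHaarUAC : Measure.IsAddHaarMeasure (volume : Measure UnitAddCircle) :=
  inferInstanceAs (Measure.IsAddHaarMeasure AddCircle.haarAddCircle)
local instance instProbUAC : IsProbabilityMeasure (volume : Measure UnitAddCircle) :=
  inferInstanceAs (IsProbabilityMeasure AddCircle.haarAddCircle)

abbrev TT := UnitAddTorus (Fin 2)
abbrev KK := Fin 2 → ℤ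

def muT : Measure TT := volume
instance : IsProbabilityMeasure muT := inferInstanceAs (IsProbabilityMeasure (volume : Measure TT))

section n2
variable {F : Type*} [NormedAddCommGroup F] [NormedSpace ℝ F]

def n2 (f : C(TT, F)) : ℝ := ‖ContinuousMap.toLp 2 muT ℝ f‖

lemma n2_nonneg (f : C(TT, F)) : 0 ≤ n2 f := norm_nonneg _
lemma n2_add (f g : C(TT, F)) : n2 (f + g) ≤ n2 f + n2 g := by
  unfold n2; rw [map_add]; exact norm_add_le _ _
lemma n2_smul (c : ℝ) (f : C(TT, F)) : n2 (c • f) = |c| * n2 f := by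
  unfold n2; rw [map_smul, norm_smul, Real.norm_eq_abs]
lemma n2_mono {G : Type*} [NormedAddCommGroup G] [NormedSpace ℝ G]
    (f : C(TT, F)) (g : C(TT, G)) (h : ∀ x, ‖f x‖ ≤ ‖g x‖) :
    n2 f ≤ n2 g := by
  unfold n2
  refine Lp.norm_le_norm_of_ae_le ?_
  filter_upwards [ContinuousMap.coeFn_toLp (p := 2) (𝕜 := ℝ) muT f, ContinuousMap.coeFn_toLp (p := 2) (𝕜 := ℝ) muT g] with x hx hy
  rw [hx, hy]; exact h x
def nrm (f : C(TT, F)) : C(TT, ℝ) := ⟨fun x => ‖f x‖, by fun_prop⟩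
lemma n2_nrm (f : C(TT, F)) : n2 (nrm f) = n2 f := by
  apply le_antisymm <;> apply n2_mono <;> intro x <;> simp [nrm]
lemma n2_sq (f : C(TT, F)) : n2 f ^ 2 = ∫ x, ‖f x‖ ^ 2 ∂muT := by
  have h1 : n2 f = n2 (nrm f) := by
    apply le_antisymm <;> apply n2_mono <;> intro x <;> simp [nrm]
  rw [h1]
  unfold n2
  rw [← real_inner_self_eq_norm_sq, ContinuousMap.inner_toLp]
  congr 1; ext x; simp [nrm, sq]
lemma n2_const (c : F) : n2 (ContinuousMap.const TT c) = ‖c‖ := by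
  have h := n2_sq (ContinuousMap.const TT c)
  simp at h
  exact (pow_left_inj₀ (n2_nonneg _) (norm_nonneg _) two_ne_zero).1 h
end n2

section fourier
variable {n : ℕ}

def cf (f : C(TT, Cn n)) (k : KK) : Cn n := mFourierCoeff f k

lemma cont_int {F : Type*} [NormedAddCommGroup F] (f : C(TT, F)) : Integrable f muT := by
  exact f.continuous.integrable_of_hasCompactSupport (HasCompactSupport.of_compactSpace _)

def coord (f : C(TT, Cn n)) (i : Fin n) : C(TT, ℂ) := ⟨fun x => f x i, by fun_prop⟩

lemma cf_apply (f : C(TT, Cn n)) (k : KK) (i : Fin n) :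
    cf f k i = mFourierCoeff (coord f i) k := by
  unfold cf mFourierCoeff
  have h := ContinuousLinearMap.integral_comp_comm (μ := muT) (EuclideanSpace.proj (𝕜 := ℂ) i : Cn n →L[ℂ] ℂ) (φ := fun t => mFourier (-k) t • f t) (cont_int ⟨fun t => mFourier (-k) t • f t, by fun_prop⟩)
  exact h.symm

lemma cf_sub (f g : C(TT, Cn n)) (k : KK) : cf (f - g) k = cf f k - cf g k := by
  unfold cf mFourierCoeff
  rw [← integral_sub]
  · congr 1; ext1 t; simp [smul_sub]
  · exact (cont_int ⟨fun t => mFourier (-k) t • f t, by fun_prop⟩)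
  · exact (cont_int ⟨fun t => mFourier (-k) t • g t, by fun_prop⟩)

lemma parseval (f : C(TT, Cn n)) : HasSum (fun k => ‖cf f k‖ ^ 2) (n2 f ^ 2) := by
  have h1 : ∀ i, HasSum (fun k => ‖mFourierCoeff (coord f i) k‖ ^ 2) (∫ x, ‖coord f i x‖ ^ 2 ∂muT) := by
    intro i
    have h := hasSum_sq_mFourierCoeff (ContinuousMap.toLp 2 volume ℂ (coord f i))
    simp only [mFourierCoeff_toLp] at h
    convert h using 1
    apply integral_congr_ae
    filter_upwards [ContinuousMap.coeFn_toLp (p := 2) (𝕜 := ℂ) muT (coord f i)] with x hx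
    exact congrArg (fun y => ‖y‖ ^ 2) hx.symm
  have h2 := hasSum_sum (s := Finset.univ) (fun i _ => h1 i)
  have h3 : n2 f ^ 2 = ∑ i, ∫ x, ‖coord f i x‖ ^ 2 ∂muT := by
    rw [n2_sq, ← integral_finsetSum]
    · congr 1; ext x; rw [EuclideanSpace.norm_sq_eq]; rfl
    · intro i _
      exact cont_int ⟨fun x => ‖coord f i x‖ ^ 2, by fun_prop⟩
  rw [h3]
  convert h2 using 1
  ext k
  rw [EuclideanSpace.norm_sq_eq]
  simp only [cf_apply]

lemma fourier_inv (f : C(TT, Cn n)) (h : Summable (fun k => ‖cf f k‖)) (x : TT) :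
    HasSum (fun k => mFourier k x • cf f k) (f x) := by
  have h1 : ∀ i, HasSum (fun k => (mFourier k x • cf f k) i) (f x i) := by
    intro i
    have hs : Summable (mFourierCoeff (coord f i)) := by
      refine Summable.of_norm_bounded h (fun k => ?_)
      rw [← cf_apply]; exact PiLp.norm_apply_le _ _
    have := hasSum_mFourier_series_apply_of_summable hs x
    convert this using 1
    · ext k
      simp [cf_apply, mul_comm]
    · rfl
  have h2 : Summable (fun k => mFourier k x • cf f k) := by
    refine Summable.of_norm_bounded h (fun k => ?_)
    rw [norm_smul]
    have : ‖mFourier k x‖ ≤ 1 := by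
      have := (mFourier k).norm_coe_le_norm x
      rwa [mFourier_norm] at this
    nlinarith [norm_nonneg (cf f k)]
  have h3 := h2.hasSum
  convert h3 using 1
  ext i
  have := (EuclideanSpace.proj (𝕜 := ℂ) i : Cn n →L[ℂ] ℂ).hasSum h3
  exact (h1 i).unique this

lemma mF_norm (k : KK) (x : TT) : ‖mFourier k x‖ = 1 := by
  simp [mFourier, fourier_apply, Circle.norm_coe]

lemma int_mF (k : KK) : ∫ x, mFourier k x ∂muT = if k = 0 then 1 else 0 := by
  have h := orthonormal_iff_ite.1 (orthonormal_mFourier (d := Fin 2)) 0 k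
  rw [ContinuousMap.inner_toLp] at h
  simp only [mFourier_zero] at h
  simp at h
  simpa [eq_comm, muT] using! h

def VV (d : KK → Cn n) (hd : Summable (fun k => ‖d k‖)) : C(TT, Cn n) where
  toFun x := ∑' k, mFourier k x • d k
  continuous_toFun := by
    refine continuous_tsum (fun k => by fun_prop) hd (fun k x => ?_)
    rw [norm_smul, mF_norm, one_mul]

lemma VV_hasSum (d : KK → Cn n) (hd : Summable (fun k => ‖d k‖)) (x : TT) :
    HasSum (fun k => mFourier k x • d k) (VV d hd x) := by
  refine Summable.hasSum (Summable.of_norm_bounded hd (fun k => ?_))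
  rw [norm_smul, mF_norm, one_mul]

lemma VV_norm_le (d : KK → Cn n) (hd : Summable (fun k => ‖d k‖)) (x : TT) :
    ‖VV d hd x‖ ≤ ∑' k, ‖d k‖ := by
  refine tsum_of_norm_bounded hd.hasSum (fun k => ?_)
  rw [norm_smul, mF_norm, one_mul]

lemma cf_VV (d : KK → Cn n) (hd : Summable (fun k => ‖d k‖)) (k : KK) : cf (VV d hd) k = d k := by
  have h1 : ∀ j, ∫ x, mFourier (-k) x • mFourier j x • d j ∂muT = if j = k then d j else 0 := by
    intro j
    have : ∀ x, mFourier (-k) x • mFourier j x • d j = mFourier (-k + j) x • d j := by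
      intro x; rw [mFourier_add, smul_smul]
    simp only [this]
    rw [integral_smul_const, int_mF]
    have : (-k + j = 0) ↔ j = k := by rw [neg_add_eq_zero]; exact eq_comm
    simp only [this]; split_ifs <;> simp
  have h2 := hasSum_integral_of_summable_integral_norm (μ := muT) (F := fun (j : KK) x => mFourier (-k) x • mFourier j x • d j)
    (fun j => cont_int ⟨fun x => mFourier (-k) x • mFourier j x • d j, by fun_prop⟩) (by
      simp only [norm_smul, mF_norm, one_mul]
      simpa using hd)
  simp only [h1] at h2
  have h3 := h2.unique (hasSum_ite_eq k (d k) |>.congr_fun (fun j => by split_ifs with h <;> simp [h]))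
  rw [← h3]
  unfold cf mFourierCoeff
  change ∫ x, _ ∂muT = _
  congr 1; ext1 x
  rw [tsum_const_smul'']
  rfl

lemma n2_VV (d : KK → Cn n) (hd : Summable (fun k => ‖d k‖)) : HasSum (fun k => ‖d k‖ ^ 2) (n2 (VV d hd) ^ 2) := by
  simpa only [cf_VV] using parseval (VV d hd)

end fourier
end HP1

section HP2
open MeasureTheory UnitAddTorus
local instance instMSUAC2 : MeasureSpace UnitAddCircle := ⟨AddCircle.haarAddCircle⟩
local instance instHaarUAC2 : Measure.IsAddHaarMeasure (volume : Measure UnitAddCircle) :=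
  inferInstanceAs (Measure.IsAddHaarMeasure AddCircle.haarAddCircle)
instance instInvMuT : Measure.IsAddLeftInvariant muT :=
  inferInstanceAs (Measure.IsAddLeftInvariant (volume : Measure TT))

def sh (j : Fin 2) (t : ℝ) : TT := Pi.single j (t : UnitAddCircle)

lemma sh_neg (j : Fin 2) (t : ℝ) : sh j (-t) = - sh j t := by
  unfold sh; rw [← Pi.single_neg]; rfl

def ek (k : KK) (j : Fin 2) (t : ℝ) : ℂ := Complex.exp (2 * Real.pi * Complex.I * (k j) * t)

lemma mF_add (k : KK) (x y : TT) : mFourier k (x + y) = mFourier k x * mFourier k y := by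
  simp [mFourier, fourier_apply, smul_add, AddCircle.toCircle_add]; ring

lemma mF_sh (k : KK) (j : Fin 2) (t : ℝ) : mFourier k (sh j t) = ek k j t := by
  unfold sh ek
  fin_cases j <;> simp [mFourier]

lemma mF_neg (k : KK) (x : TT) : mFourier k x * mFourier (-k) x = 1 := by
  rw [← mFourier_add]; simp [mFourier_zero]

section
variable {F : Type*} [NormedAddCommGroup F]

def tr (h : TT) (f : C(TT, F)) : C(TT, F) := ⟨fun x => f (x + h), by fun_prop⟩
def D1 (j : Fin 2) (t : ℝ) (f : C(TT, F)) : C(TT, F) := tr (sh j t) f - f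
def D2 (j : Fin 2) (t : ℝ) (f : C(TT, F)) : C(TT, F) := D1 j t f + D1 j (-t) f

lemma D1_apply (j : Fin 2) (t : ℝ) (f : C(TT, F)) (x : TT) : D1 j t f x = f (x + sh j t) - f x := rfl
lemma D2_apply (j : Fin 2) (t : ℝ) (f : C(TT, F)) (x : TT) :
    D2 j t f x = (f (x + sh j t) - f x) + (f (x + sh j (-t)) - f x) := rfl
lemma D1_add (j : Fin 2) (t : ℝ) (f g : C(TT, F)) : D1 j t (f + g) = D1 j t f + D1 j t g := by
  ext x; simp only [D1_apply, ContinuousMap.add_apply]; abel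
lemma D2_add (j : Fin 2) (t : ℝ) (f g : C(TT, F)) : D2 j t (f + g) = D2 j t f + D2 j t g := by
  simp only [D2, D1_add]; abel
end

section
variable {n : ℕ}

lemma cf_tr (h : TT) (f : C(TT, Cn n)) (k : KK) : cf (tr h f) k = mFourier k h • cf f k := by
  unfold cf mFourierCoeff
  rw [← integral_smul]
  change ∫ t, mFourier (-k) t • f (t + h) ∂muT = ∫ t, mFourier k h • mFourier (-k) t • f t ∂muT
  rw [← integral_add_right_eq_self (μ := muT) (fun t => mFourier k h • mFourier (-k) t • f t) h]
  congr 1; ext1 t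
  rw [mF_add, smul_smul]
  congr 1
  rw [mul_left_comm, mF_neg, mul_one]

lemma cf_D1 (j : Fin 2) (t : ℝ) (f : C(TT, Cn n)) (k : KK) :
    cf (D1 j t f) k = (ek k j t - 1) • cf f k := by
  unfold D1; rw [cf_sub, cf_tr, mF_sh, sub_smul, one_smul]

lemma cf_add (f g : C(TT, Cn n)) (k : KK) : cf (f + g) k = cf f k + cf g k := by
  have := cf_sub (f + g) g k
  rw [add_sub_cancel_right] at this
  rw [this]; abel

lemma cf_D2 (j : Fin 2) (t : ℝ) (f : C(TT, Cn n)) (k : KK) :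
    cf (D2 j t f) k = ((ek k j t - 1) + (ek k j (-t) - 1)) • cf f k := by
  unfold D2; rw [cf_add, cf_D1, cf_D1, add_smul]

lemma ek_sub (k : KK) (j : Fin 2) (t : ℝ) : ‖ek k j t - 1‖ ≤ 2 * Real.pi * |(k j : ℝ)| * |t| := by
  have h := Real.norm_exp_I_mul_ofReal_sub_one_le (x := 2 * Real.pi * (k j) * t)
  have e : ek k j t = Complex.exp (Complex.I * ((2 * Real.pi * (k j) * t : ℝ) : ℂ)) := by
    unfold ek; congr 1; push_cast; ring
  rw [e]
  refine h.trans ?_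
  rw [Real.norm_eq_abs, abs_mul, abs_mul, abs_of_pos Real.two_pi_pos]

lemma ek_sub2 (k : KK) (j : Fin 2) (t : ℝ) :
    (ek k j t - 1) + (ek k j (-t) - 1) = ((2 * Real.cos (2 * Real.pi * (k j) * t) - 2 : ℝ) : ℂ) := by
  have e1 : ek k j t = Complex.exp (((2 * Real.pi * (k j) * t : ℝ) : ℂ) * Complex.I) := by
    unfold ek; congr 1; push_cast; ring
  have e2 : ek k j (-t) = Complex.exp (-((2 * Real.pi * (k j) * t : ℝ) : ℂ) * Complex.I) := by
    unfold ek; congr 1; push_cast; ring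
  have := Complex.two_cos (((2 * Real.pi * (k j) * t : ℝ) : ℂ))
  rw [e1, e2]
  push_cast at this ⊢
  rw [this]; ring

lemma cos_up (θ : ℝ) : |2 * Real.cos θ - 2| ≤ θ ^ 2 := by
  have h1 := Real.one_sub_sq_div_two_le_cos (x := θ)
  have h2 := Real.cos_le_one θ
  rw [abs_le]; constructor <;> linarith

lemma cos_low (θ : ℝ) (h : |θ| ≤ Real.pi) : 4 / Real.pi ^ 2 * θ ^ 2 ≤ |2 * Real.cos θ - 2| := by
  have h1 := Real.cos_le_one_sub_mul_cos_sq h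
  have h2 := Real.cos_le_one θ
  rw [abs_of_nonpos (by linarith)]
  have : 4 / Real.pi ^ 2 * θ ^ 2 = 2 * (2 / Real.pi ^ 2 * θ ^ 2) := by ring
  linarith
  
def ww (k : KK) : ℝ := 1 + (k 0 : ℝ) ^ 2 + (k 1 : ℝ) ^ 2
lemma ww_one (k : KK) : 1 ≤ ww k := by unfold ww; nlinarith [sq_nonneg (k 0 : ℝ), sq_nonneg (k 1 : ℝ)]
lemma ww_pos (k : KK) : 0 < ww k := lt_of_lt_of_le one_pos (ww_one k)
lemma kj_ww (k : KK) (j : Fin 2) : (k j : ℝ) ^ 2 ≤ ww k := by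
  unfold ww; fin_cases j <;> simp <;> nlinarith [sq_nonneg (k 0 : ℝ), sq_nonneg (k 1 : ℝ)]
lemma kj_ww1 (k : KK) (j : Fin 2) : |(k j : ℝ)| ≤ ww k := by
  unfold ww; fin_cases j <;> simp <;> nlinarith [sq_nonneg (|(k 0 : ℝ)|-1), sq_nonneg (|(k 1 : ℝ)|-1), sq_abs (k 0 : ℝ), sq_abs (k 1 : ℝ), abs_nonneg (k 0 : ℝ), abs_nonneg (k 1 : ℝ)]

lemma sum_kj4 (f : C(TT, Cn n)) (K : ℝ) (j : Fin 2)
    (h : ∀ t, n2 (D2 j t f) ≤ K * t ^ 2) (s : Finset KK) :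
    ∑ k ∈ s, (k j : ℝ) ^ 4 * ‖cf f k‖ ^ 2 ≤ K ^ 2 := by
  obtain ⟨M, hM⟩ : ∃ M : ℝ, 1 ≤ M ∧ ∀ k ∈ s, |(k j : ℝ)| ≤ M := by
    refine ⟨1 + ∑ k ∈ s, |(k j : ℝ)|, by linarith [Finset.sum_nonneg (s := s) (f := fun k : KK => |(k j : ℝ)|) (fun _ _ => abs_nonneg _)], fun k hk => ?_⟩
    have := Finset.single_le_sum (f := fun k : KK => |(k j : ℝ)|) (fun _ _ => abs_nonneg _) hk
    linarith
  obtain ⟨hM1, hM⟩ := hM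
  set t : ℝ := 1 / (2 * M) with ht
  have htpos : 0 < t := by positivity
  have h1 := parseval (D2 j t f)
  have h2 : ∑ k ∈ s, ‖cf (D2 j t f) k‖ ^ 2 ≤ n2 (D2 j t f) ^ 2 := sum_le_hasSum s (fun _ _ => by positivity) h1
  have h3 : n2 (D2 j t f) ^ 2 ≤ (K * t ^ 2) ^ 2 := pow_le_pow_left₀ (n2_nonneg _) (h t) 2
  have h4 : ∀ k ∈ s, t ^ 4 * ((k j : ℝ) ^ 4 * ‖cf f k‖ ^ 2) ≤ ‖cf (D2 j t f) k‖ ^ 2 := by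
    intro k hk
    rw [cf_D2, norm_smul, ek_sub2, mul_pow, ← mul_assoc, Complex.norm_real, Real.norm_eq_abs]
    gcongr
    have h5 : |2 * Real.pi * (k j) * t| ≤ Real.pi := by
      rw [abs_mul, abs_mul, abs_of_pos Real.two_pi_pos, abs_of_pos htpos, ht]
      have := hM k hk
      rw [mul_one_div, div_le_iff₀ (by positivity)]
      nlinarith [Real.pi_pos]
    have h6 := cos_low _ h5
    have h7 : 4 / Real.pi ^ 2 * (2 * Real.pi * (k j) * t) ^ 2 = 16 * ((k j : ℝ) ^ 2 * t ^ 2) := by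
      field_simp; ring
    have h8 : t ^ 4 * (k j : ℝ) ^ 4 = ((k j : ℝ) ^ 2 * t ^ 2) ^ 2 := by ring
    rw [h8]
    have : 0 ≤ (k j : ℝ) ^ 2 * t ^ 2 := by positivity
    refine pow_le_pow_left₀ this ?_ 2
    linarith
  have h5 := Finset.sum_le_sum h4
  rw [← Finset.mul_sum] at h5
  have h6 : t ^ 4 * ∑ k ∈ s, (k j : ℝ) ^ 4 * ‖cf f k‖ ^ 2 ≤ t ^ 4 * K ^ 2 := by
    calc _ ≤ _ := h5.trans (h2.trans h3)
      _ = _ := by ring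
  exact le_of_mul_le_mul_left h6 (by positivity)

abbrev HH (n : ℕ) := lp (fun _ : KK => Cn n) 2

lemma sum_ww (f : C(TT, Cn n)) (K : ℝ) (h0 : n2 f ≤ K)
    (h : ∀ j t, n2 (D2 j t f) ≤ K * t ^ 2) (s : Finset KK) :
    ∑ k ∈ s, ‖(ww k : ℂ) • cf f k‖ ^ 2 ≤ (3 * K) ^ 2 := by
  have a0 := sum_kj4 f K 0 (h 0) s
  have a1 := sum_kj4 f K 1 (h 1) s
  have a2 : ∑ k ∈ s, ‖cf f k‖ ^ 2 ≤ K ^ 2 := (sum_le_hasSum s (fun _ _ => by positivity) (parseval f)).trans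
    (pow_le_pow_left₀ (n2_nonneg _) h0 2)
  calc ∑ k ∈ s, ‖(ww k : ℂ) • cf f k‖ ^ 2 ≤ ∑ k ∈ s, 3 * (‖cf f k‖ ^ 2 + (k 0 : ℝ) ^ 4 * ‖cf f k‖ ^ 2 + (k 1 : ℝ) ^ 4 * ‖cf f k‖ ^ 2) := by
        refine Finset.sum_le_sum (fun k _ => ?_)
        rw [norm_smul, Complex.norm_real, Real.norm_eq_abs, abs_of_pos (ww_pos k), mul_pow]
        have : ww k ^ 2 ≤ 3 * (1 + (k 0 : ℝ) ^ 4 + (k 1 : ℝ) ^ 4) := by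
          unfold ww
          nlinarith [sq_nonneg ((k 0 : ℝ) ^ 2 - (k 1 : ℝ) ^ 2), sq_nonneg ((k 0 : ℝ) ^ 2 - 1), sq_nonneg ((k 1 : ℝ) ^ 2 - 1)]
        nlinarith [sq_nonneg ‖cf f k‖]
    _ ≤ _ := by
        rw [← Finset.mul_sum, Finset.sum_add_distrib, Finset.sum_add_distrib]
        nlinarith

lemma memH (f : C(TT, Cn n)) (K : ℝ) (h0 : n2 f ≤ K)
    (h : ∀ j t, n2 (D2 j t f) ≤ K * t ^ 2) : Memℓp (fun k => (ww k : ℂ) • cf f k) 2 := by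
  refine memℓp_gen' (C := (3 * K) ^ 2) (fun s => ?_)
  simpa using sum_ww f K h0 h s

lemma normH (f : C(TT, Cn n)) (K : ℝ) (h0 : n2 f ≤ K)
    (h : ∀ j t, n2 (D2 j t f) ≤ K * t ^ 2) (c : HH n) (hc : ∀ k, c k = (ww k : ℂ) • cf f k) :
    ‖c‖ ≤ 3 * K := by
  have hK : 0 ≤ K := (n2_nonneg _).trans h0
  refine lp.norm_le_of_forall_sum_le (by norm_num) (by positivity) (fun s => ?_)
  simpa [hc] using sum_ww f K h0 h s
end
end HP2

section HP3
open MeasureTheory UnitAddTorus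
lemma summable_ww : Summable (fun k : KK => (1 / ww k) ^ 2) := by
  have h1 : Summable (fun m : ℤ => 1 / (1 + (m : ℝ) ^ 2)) := by
    have h := (Real.summable_one_div_int_pow (p := 2)).2 (by norm_num)
    refine Summable.of_norm_bounded_eventually (g := fun m : ℤ => 1 / (m : ℝ) ^ 2) h ?_
    rw [Filter.eventually_cofinite]
    refine (Set.finite_singleton (0 : ℤ)).subset (fun m hm => ?_)
    by_contra hne
    apply hm
    have : (m : ℝ) ≠ 0 := by exact_mod_cast hne
    rw [Real.norm_eq_abs, abs_of_nonneg (by positivity)]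
    gcongr; linarith
  have h2 := h1.mul_of_nonneg h1 (fun m => by positivity) (fun m => by positivity)
  have h3 : Summable (fun k : KK => (1 / (1 + ((k 0 : ℤ) : ℝ) ^ 2)) * (1 / (1 + ((k 1 : ℤ) : ℝ) ^ 2))) := by
    have := (finTwoArrowEquiv ℤ).summable_iff.2 h2
    exact this
  refine Summable.of_nonneg_of_le (fun k => by positivity) (fun k => ?_) h3
  rw [div_mul_div_comm, div_pow]
  have : (1 + ((k 0 : ℤ) : ℝ) ^ 2) * (1 + ((k 1 : ℤ) : ℝ) ^ 2) ≤ ww k ^ 2 := by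
    unfold ww; nlinarith [sq_nonneg (k 0 : ℝ), sq_nonneg (k 1 : ℝ), mul_nonneg (sq_nonneg (k 0 : ℝ)) (sq_nonneg (k 1 : ℝ))]
  rw [one_pow, one_mul]
  gcongr

def C0 : ℝ := Real.sqrt (∑' k : KK, (1 / ww k) ^ 2)
lemma C0_nonneg : 0 ≤ C0 := Real.sqrt_nonneg _

section
variable {n : ℕ}

lemma H_hasSum (c : HH n) : HasSum (fun k => ‖c k‖ ^ 2) (‖c‖ ^ 2) := by
  have := lp.hasSum_norm (p := 2) (by norm_num) c
  simpa using this

lemma mul_sum (c : HH n) : Summable (fun k => 1 / ww k * ‖c k‖) ∧ ∑' k, 1 / ww k * ‖c k‖ ≤ C0 * ‖c‖ := by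
  have h := Real.inner_le_Lp_mul_Lq_tsum_of_nonneg (f := fun k => 1 / ww k) (g := fun k => ‖c k‖) (p := 2) (q := 2)
    (by constructor <;> norm_num) (fun k => by have := ww_pos k; positivity) (fun k => norm_nonneg _)
    (by simpa using summable_ww) (by simpa using (H_hasSum c).summable)
  have hs := Real.summable_mul_of_Lp_Lq_of_nonneg (f := fun k => 1 / ww k) (g := fun k => ‖c k‖) (p := 2) (q := 2)
    (by constructor <;> norm_num) (fun k => by have := ww_pos k; positivity) (fun k => norm_nonneg _)
    (by simpa using summable_ww) (by simpa using (H_hasSum c).summable)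
  refine ⟨hs, h.trans ?_⟩
  have e : ∑' k, ‖c k‖ ^ 2 = ‖c‖ ^ 2 := (H_hasSum c).tsum_eq
  simp only [Real.rpow_ofNat, e]
  rw [← Real.sqrt_eq_rpow, ← Real.sqrt_eq_rpow, Real.sqrt_sq (norm_nonneg _)]
  exact le_rfl

/-- multiplier bounded by `M / ww` -/
def MulB (m : KK → ℂ) : Prop := ∀ k, ‖m k‖ ≤ 1 / ww k

lemma mul_norm {m : KK → ℂ} {M : ℝ} (hm : ∀ k, ‖m k‖ ≤ M * (1 / ww k)) (c : HH n) :
    Summable (fun k => ‖m k • c k‖) ∧ ∑' k, ‖m k • c k‖ ≤ M * (C0 * ‖c‖) := by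
  obtain ⟨h1, h2⟩ := mul_sum c
  have hle : ∀ k, ‖m k • c k‖ ≤ M * (1 / ww k * ‖c k‖) := by
    intro k; rw [norm_smul, ← mul_assoc]; gcongr; exact hm k
  have h3 : Summable (fun k => ‖m k • c k‖) :=
    Summable.of_nonneg_of_le (fun _ => norm_nonneg _) hle (h1.mul_left M)
  refine ⟨h3, (h3.tsum_le_tsum hle (h1.mul_left M)).trans ?_⟩
  rw [tsum_mul_left]
  have hM : 0 ≤ M := by
    have := (norm_nonneg _).trans (hm 0)
    have h1 : 0 < 1 / ww 0 := by have := ww_pos 0; positivity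
    exact nonneg_of_mul_nonneg_left this h1
  gcongr

lemma mulB_sum {m : KK → ℂ} (hm : MulB m) (c : HH n) : Summable (fun k => ‖m k • c k‖) :=
  (mul_norm (M := 1) (fun k => by rw [one_mul]; exact hm k) c).1

def MV (m : KK → ℂ) (hm : MulB m) : HH n →ₗ[ℂ] C(TT, Cn n) where
  toFun c := VV (fun k => m k • c k) (mulB_sum hm c)
  map_add' c c' := by
    ext1 x
    have h := (VV_hasSum _ (mulB_sum hm c) x).add (VV_hasSum _ (mulB_sum hm c') x)
    refine (VV_hasSum _ (mulB_sum hm (c + c')) x).unique ?_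
    convert! h using 2 with k
    rw [lp.coeFn_add, Pi.add_apply, smul_add, smul_add]
  map_smul' a c := by
    ext1 x
    have h := (VV_hasSum _ (mulB_sum hm c) x).const_smul a
    refine (VV_hasSum _ (mulB_sum hm (a • c)) x).unique ?_
    convert! h using 2 with k
    rw [lp.coeFn_smul, Pi.smul_apply, smul_comm (m k), smul_comm _ a]

lemma MV_hasSum (m : KK → ℂ) (hm : MulB m) (c : HH n) (x : TT) :
    HasSum (fun k => mFourier k x • m k • c k) (MV m hm c x) := VV_hasSum _ (mulB_sum hm c) x

lemma cf_MV (m : KK → ℂ) (hm : MulB m) (c : HH n) (k : KK) : cf (MV m hm c) k = m k • c k := cf_VV _ (mulB_sum hm c) k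

lemma MV_sup (m : KK → ℂ) (hm : MulB m) (c : HH n) (x : TT) : ‖MV m hm c x‖ ≤ C0 * ‖c‖ := by
  refine (VV_norm_le _ (mulB_sum hm c) x).trans ?_
  simpa using (mul_norm (M := 1) (fun k => by rw [one_mul]; exact hm k) c).2

lemma n2_le_of_cf (f : C(TT, Cn n)) (c : HH n) (M : ℝ) (hM : 0 ≤ M) (h : ∀ k, ‖cf f k‖ ≤ M * ‖c k‖) :
    n2 f ≤ M * ‖c‖ := by
  have h1 := parseval f
  have h2 := (H_hasSum c).mul_left (M ^ 2)
  have h3 : n2 f ^ 2 ≤ M ^ 2 * ‖c‖ ^ 2 := hasSum_le (fun k => by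
    rw [← mul_pow]; exact pow_le_pow_left₀ (norm_nonneg _) (h k) 2) h1 h2
  rw [← mul_pow] at h3
  exact (pow_le_pow_iff_left₀ (n2_nonneg _) (by positivity) two_ne_zero).1 h3

lemma MV_D1 (m : KK → ℂ) (hm : MulB m) (c : HH n) (j : Fin 2) (t : ℝ) :
    n2 (D1 j t (MV m hm c)) ≤ (2 * Real.pi * |t|) * ‖c‖ := by
  refine n2_le_of_cf _ _ _ (by positivity) (fun k => ?_)
  rw [cf_D1, cf_MV, smul_smul, norm_smul, norm_mul]
  refine mul_le_mul_of_nonneg_right ?_ (norm_nonneg _)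
  calc _ ≤ (2 * Real.pi * |(k j : ℝ)| * |t|) * (1 / ww k) := by
        gcongr; exacts [ek_sub k j t, hm k]
    _ = (2 * Real.pi * |t|) * (|(k j : ℝ)| / ww k) := by ring
    _ ≤ (2 * Real.pi * |t|) * 1 := by
        gcongr; rw [div_le_one (ww_pos k)]; exact kj_ww1 k j
    _ = _ := mul_one _

lemma MV_D2 (m : KK → ℂ) (hm : MulB m) (c : HH n) (j : Fin 2) (t : ℝ) :
    n2 (D2 j t (MV m hm c)) ≤ (4 * Real.pi ^ 2 * t ^ 2) * ‖c‖ := by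
  refine n2_le_of_cf _ _ _ (by positivity) (fun k => ?_)
  rw [cf_D2, cf_MV, smul_smul, norm_smul, norm_mul, ek_sub2, Complex.norm_real, Real.norm_eq_abs]
  refine mul_le_mul_of_nonneg_right ?_ (norm_nonneg _)
  calc _ ≤ (2 * Real.pi * (k j) * t) ^ 2 * (1 / ww k) := by
        gcongr; exacts [cos_up _, hm k]
    _ = (4 * Real.pi ^ 2 * t ^ 2) * ((k j : ℝ) ^ 2 / ww k) := by ring
    _ ≤ (4 * Real.pi ^ 2 * t ^ 2) * 1 := by
        gcongr; rw [div_le_one (ww_pos k)]; exact kj_ww k j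
    _ = _ := mul_one _

lemma MV_lip (m : KK → ℂ) (hm : MulB m) (hm' : ∀ k j, ‖m k‖ * |(k j : ℝ)| ≤ 1 / ww k)
    (c : HH n) (j : Fin 2) (t : ℝ) (x : TT) :
    ‖D1 j t (MV m hm c) x‖ ≤ (2 * Real.pi * |t|) * (C0 * ‖c‖) := by
  have hm2 : ∀ k, ‖m k * (ek k j t - 1)‖ ≤ (2 * Real.pi * |t|) * (1 / ww k) := by
    intro k
    rw [norm_mul]
    calc _ ≤ ‖m k‖ * (2 * Real.pi * |(k j : ℝ)| * |t|) := by gcongr; exact ek_sub k j t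
      _ = (2 * Real.pi * |t|) * (‖m k‖ * |(k j : ℝ)|) := by ring
      _ ≤ _ := by gcongr; exact hm' k j
  obtain ⟨h1, h2⟩ := mul_norm hm2 c
  have h3 : HasSum (fun k => mFourier k x • (m k * (ek k j t - 1)) • c k) (D1 j t (MV m hm c) x) := by
    rw [D1_apply]
    have := (MV_hasSum m hm c (x + sh j t)).sub (MV_hasSum m hm c x)
    convert! this using 2 with k
    rw [mF_add, mF_sh]
    simp only [smul_smul, ← sub_smul]
    congr 1; ring
  rw [← h3.tsum_eq]
  refine (tsum_of_norm_bounded h1.hasSum (fun k => ?_)).trans h2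
  rw [norm_smul, mF_norm, one_mul]

/-! multipliers -/
def lam (k : KK) : ℂ := Real.pi * Complex.I * ((k 0 : ℂ) + Complex.I * (k 1 : ℂ))
def lam' (k : KK) : ℂ := Real.pi * Complex.I * ((k 0 : ℂ) - Complex.I * (k 1 : ℂ))

lemma norm_kk (a b : ℝ) : ‖(a : ℂ) + Complex.I * b‖ = Real.sqrt (a ^ 2 + b ^ 2) := by
  rw [mul_comm, Complex.norm_add_mul_I]
lemma norm_lam (k : KK) : ‖lam k‖ = Real.pi * Real.sqrt ((k 0 : ℝ) ^ 2 + (k 1 : ℝ) ^ 2) := by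
  have := norm_kk (k 0) (k 1)
  unfold lam
  simp only [Complex.ofReal_intCast] at this
  rw [norm_mul, norm_mul, Complex.norm_real, Complex.norm_I, this]; simp [abs_of_pos Real.pi_pos]
lemma norm_lam' (k : KK) : ‖lam' k‖ = ‖lam k‖ := by
  have := norm_kk (k 0) (-(k 1 : ℝ))
  rw [norm_lam]
  unfold lam'
  push_cast at this
  rw [norm_mul, norm_mul, Complex.norm_real, Complex.norm_I, sub_eq_add_neg, ← mul_neg, this]; simp [abs_of_pos Real.pi_pos]

lemma lam_low (k : KK) (j : Fin 2) : |(k j : ℝ)| ≤ ‖lam k‖ := by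
  rw [norm_lam]
  have h1 : |(k j : ℝ)| ≤ Real.sqrt ((k 0 : ℝ) ^ 2 + (k 1 : ℝ) ^ 2) := by
    apply Real.abs_le_sqrt
    fin_cases j <;> simp <;> positivity
  have h2 : 0 ≤ Real.sqrt ((k 0 : ℝ) ^ 2 + (k 1 : ℝ) ^ 2) := Real.sqrt_nonneg _
  nlinarith [Real.pi_gt_three]

lemma lam_zero : lam 0 = 0 := by simp [lam]
lemma lam_ge (k : KK) (hk : k ≠ 0) : 1 ≤ ‖lam k‖ := by
  obtain ⟨j, hj⟩ := Function.ne_iff.1 hk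
  refine le_trans ?_ (lam_low k j)
  have : 1 ≤ |k j| := Int.one_le_abs hj
  exact_mod_cast this
lemma lam_ne (k : KK) (hk : k ≠ 0) : lam k ≠ 0 := by
  intro h; have := lam_ge k hk; rw [h, norm_zero] at this; linarith

def m0 (k : KK) : ℂ := ((1 / ww k : ℝ) : ℂ)
def mT (k : KK) : ℂ := (lam k)⁻¹ * m0 k
def mS (k : KK) : ℂ := lam' k * (lam k)⁻¹ * m0 k

lemma norm_m0 (k : KK) : ‖m0 k‖ = 1 / ww k := by
  unfold m0; rw [Complex.norm_real, Real.norm_eq_abs, abs_of_pos]; have := ww_pos k; positivity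
lemma m0B : MulB m0 := fun k => (norm_m0 k).le
lemma mTB : MulB mT := fun k => by
  unfold mT
  rw [norm_mul, norm_m0, norm_inv]
  have h : ‖lam k‖⁻¹ ≤ 1 := by
    by_cases hk : k = 0
    · subst hk; rw [lam_zero]; simp
    · exact inv_le_one_of_one_le₀ (lam_ge k hk)
  have := ww_pos k
  exact mul_le_of_le_one_left (by positivity) h
lemma mTB' (k : KK) (j : Fin 2) : ‖mT k‖ * |(k j : ℝ)| ≤ 1 / ww k := by
  unfold mT
  rw [norm_mul, norm_m0, norm_inv]
  have h : ‖lam k‖⁻¹ * |(k j : ℝ)| ≤ 1 := by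
    rw [inv_mul_eq_div]
    exact div_le_one_of_le₀ (lam_low k j) (norm_nonneg _)
  have := ww_pos k
  calc _ = (‖lam k‖⁻¹ * |(k j : ℝ)|) * (1 / ww k) := by ring
    _ ≤ _ := mul_le_of_le_one_left (by positivity) h
lemma mSB : MulB mS := fun k => by
  unfold mS
  rw [norm_mul, norm_mul, norm_m0, norm_inv, norm_lam']
  have h : ‖lam k‖ * ‖lam k‖⁻¹ ≤ 1 := mul_inv_le_one
  have := ww_pos k
  exact mul_le_of_le_one_left (by positivity) h
end
end HP3

section HP4
open MeasureTheory UnitAddTorus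
lemma exists_sfun : ∃ s : ℝ → ℝ, ContDiff ℝ (⊤ : ℕ∞) s ∧ Function.Periodic s 1 ∧ ∀ x, |x| < 1 / 12 → s x = x := by
  let b : ContDiffBump (0 : ℝ) := ⟨1 / 2, 3 / 4, by norm_num, by norm_num⟩
  let g : ℝ → ℝ := fun y => Real.arcsin y / (2 * Real.pi) * b y
  have hg : ContDiff ℝ (⊤ : ℕ∞) g := by
    rw [contDiff_iff_contDiffAt]
    intro y
    by_cases hy : |y| < 1
    · have h1 : ContDiffAt ℝ (⊤ : ℕ∞) Real.arcsin y :=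
        Real.contDiffAt_arcsin (by rintro rfl; norm_num at hy) (by rintro rfl; norm_num at hy)
      exact (h1.div_const _).mul b.contDiffAt
    · have : g =ᶠ[𝓝 y] fun _ => 0 := by
        have ho : IsOpen {z : ℝ | 3 / 4 < |z|} := isOpen_lt continuous_const continuous_abs
        filter_upwards [ho.mem_nhds (show 3 / 4 < |y| by linarith [not_lt.1 hy])] with z hz
        have : b z = 0 := b.zero_of_le_dist (by simpa [Real.dist_eq] using (le_of_lt hz))
        simp [g, this]
      exact contDiffAt_const.congr_of_eventuallyEq this
  refine ⟨fun x => g (Real.sin (2 * Real.pi * x)), ?_, ?_, ?_⟩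
  · exact hg.comp (Real.contDiff_sin.comp (contDiff_const.mul contDiff_id))
  · intro x
    simp only [mul_add, mul_one, Real.sin_add_two_pi]
  · intro x hx
    have hpi := Real.pi_pos
    rw [abs_lt] at hx
    have h1 : Real.arcsin (Real.sin (2 * Real.pi * x)) = 2 * Real.pi * x :=
      Real.arcsin_sin (by nlinarith) (by nlinarith)
    have h6 : Real.sin (2 * Real.pi * (1 / 12)) = 1 / 2 := by
      rw [← Real.sin_pi_div_six]; congr 1; ring
    have h2 : |Real.sin (2 * Real.pi * x)| ≤ 1 / 2 := by
      rw [abs_le]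
      constructor
      · rw [← h6, ← Real.sin_neg]
        apply Real.sin_le_sin_of_le_of_le_pi_div_two <;> nlinarith
      · rw [← h6]
        apply Real.sin_le_sin_of_le_of_le_pi_div_two <;> nlinarith
    have h3 : b (Real.sin (2 * Real.pi * x)) = 1 := b.one_of_mem_closedBall (by rw [mem_closedBall, Real.dist_eq, sub_zero]; exact h2)
    simp only [g, h1, h3]
    field_simp

structure PB (f : C(UnitAddCircle, ℝ)) (B : ℝ) : Prop where
  sup : ∀ x, |f x| ≤ B
  lip : ∀ x (t : ℝ), |f (x + t) - f x| ≤ B * |t|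
  sec : ∀ x (t : ℝ), |(f (x + t) - f x) + (f (x + ((-t : ℝ) : UnitAddCircle)) - f x)| ≤ B * t ^ 2

lemma per_bdd (f : ℝ → ℝ) (hf : Continuous f) (hp : Function.Periodic f 1) : ∃ B, ∀ x, |f x| ≤ B := by
  obtain ⟨B, hB⟩ := (isCompact_Icc (a := (0 : ℝ)) (b := 1)).exists_bound_of_continuousOn hf.continuousOn
  refine ⟨B, fun x => ?_⟩
  obtain ⟨y, hy, h⟩ := hp.exists_mem_Ico₀ one_pos x
  rw [h]; exact hB y ⟨hy.1, hy.2.le⟩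

lemma per_deriv (f : ℝ → ℝ) (hp : Function.Periodic f 1) : Function.Periodic (deriv f) 1 := by
  intro x
  have : f = fun y => f (y + 1) := by ext y; exact (hp y).symm
  conv_rhs => rw [this]
  rw [deriv_comp_add_const]

lemma cd_deriv (f : ℝ → ℝ) (hf : ContDiff ℝ (⊤ : ℕ∞) f) : ContDiff ℝ (⊤ : ℕ∞) (deriv f) :=
  (contDiff_infty_iff_deriv.1 hf).2

lemma exists_PB (f : ℝ → ℝ) (hf : ContDiff ℝ (⊤ : ℕ∞) f) (hp : Function.Periodic f 1) :
    ∃ (F : C(UnitAddCircle, ℝ)) (B : ℝ), (∀ a : ℝ, F a = f a) ∧ PB F B := by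
  obtain ⟨B0, h0⟩ := per_bdd f hf.continuous hp
  have hf1 := cd_deriv f hf
  have hp1 := per_deriv f hp
  obtain ⟨B1, h1⟩ := per_bdd _ hf1.continuous hp1
  have hf2 := cd_deriv _ hf1
  obtain ⟨B2, h2⟩ := per_bdd _ hf2.continuous (per_deriv _ hp1)
  have hd : ∀ x, HasDerivAt f (deriv f x) x := fun x => (hf.differentiable (by simp) x).hasDerivAt
  have hd1 : ∀ x, HasDerivAt (deriv f) (deriv (deriv f) x) x := fun x => (hf1.differentiable (by simp) x).hasDerivAt
  have B0n : 0 ≤ B0 := (abs_nonneg _).trans (h0 0)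
  have B1n : 0 ≤ B1 := (abs_nonneg _).trans (h1 0)
  have B2n : 0 ≤ B2 := (abs_nonneg _).trans (h2 0)
  have l0 : ∀ x y, |f y - f x| ≤ B1 * |y - x| := fun x y => by
    simpa using convex_univ.norm_image_sub_le_of_norm_hasDerivWithin_le (fun z _ => (hd z).hasDerivWithinAt) (fun z _ => h1 z) (mem_univ x) (mem_univ y)
  have l1 : ∀ x y, |deriv f y - deriv f x| ≤ B2 * |y - x| := fun x y => by
    simpa using convex_univ.norm_image_sub_le_of_norm_hasDerivWithin_le (fun z _ => (hd1 z).hasDerivWithinAt) (fun z _ => h2 z) (mem_univ x) (mem_univ y)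
  have l2 : ∀ x y, |f y - f x - deriv f x * (y - x)| ≤ B2 * |y - x| * |y - x| := fun x y => by
    have := (convex_uIcc x y).norm_image_sub_le_of_norm_hasDerivWithin_le (f := fun z => f z - deriv f x * z) (f' := fun z => deriv f z - deriv f x * 1) (C := B2 * |y - x|)
      (fun z _ => ((hd z).sub ((hasDerivAt_id z).const_mul _)).hasDerivWithinAt) (fun z hz => by
        rw [mul_one, Real.norm_eq_abs]
        refine (l1 x z).trans ?_
        exact mul_le_mul_of_nonneg_left (abs_sub_left_of_mem_uIcc hz) B2n) left_mem_uIcc right_mem_uIcc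
    rw [Real.norm_eq_abs, Real.norm_eq_abs] at this
    convert this using 2; ring
  refine ⟨⟨hp.lift, continuous_coinduced_dom.mpr hf.continuous⟩, B0 + B1 + 2 * B2, fun a => rfl, ?_, ?_, ?_⟩
  · intro x
    induction x using QuotientAddGroup.induction_on with | H a => ?_
    exact (h0 a).trans (by linarith)
  · intro x t
    induction x using QuotientAddGroup.induction_on with | H a => ?_
    change |f (a + t) - f a| ≤ _
    refine (l0 a (a + t)).trans ?_
    rw [add_sub_cancel_left]; gcongr; linarith
  · intro x t
    induction x using QuotientAddGroup.induction_on with | H a => ?_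
    change |(f (a + t) - f a) + (f (a + -t) - f a)| ≤ _
    have e1 := l2 a (a + t)
    have e2 := l2 a (a + -t)
    rw [add_sub_cancel_left, mul_assoc, abs_mul_abs_self] at e1 e2
    have e3 : (f (a + t) - f a) + (f (a + -t) - f a) = (f (a + t) - f a - deriv f a * t) + (f (a + -t) - f a - deriv f a * -t) := by ring
    rw [e3]
    refine (abs_add_le _ _).trans ?_
    nlinarith [sq_nonneg t]

lemma exists_SS : ∃ (S S' : C(UnitAddCircle, ℝ)) (B : ℝ), PB S B ∧ PB S' B ∧
    (∀ a : ℝ, HasDerivAt (fun x : ℝ => S (x : UnitAddCircle)) (S' (a : UnitAddCircle)) a) ∧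
    (∀ a : ℝ, |a| < 1 / 12 → S (a : UnitAddCircle) = a ∧ S' (a : UnitAddCircle) = 1) := by
  obtain ⟨s, hs, hp, h⟩ := exists_sfun
  obtain ⟨S, B, hS, hB⟩ := exists_PB s hs hp
  obtain ⟨S', B', hS', hB'⟩ := exists_PB _ (cd_deriv s hs) (per_deriv s hp)
  refine ⟨S, S', max B B', ⟨fun x => (hB.sup x).trans (le_max_left _ _), fun x t => (hB.lip x t).trans (by gcongr; exact le_max_left _ _), fun x t => (hB.sec x t).trans (by gcongr; exact le_max_left _ _)⟩, ⟨fun x => (hB'.sup x).trans (le_max_right _ _), fun x t => (hB'.lip x t).trans (by gcongr; exact le_max_right _ _), fun x t => (hB'.sec x t).trans (by gcongr; exact le_max_right _ _)⟩, ?_, ?_⟩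
  · intro a
    simp only [hS, hS']
    exact (hs.differentiable (by simp) a).hasDerivAt
  · intro a ha
    rw [hS, hS']
    refine ⟨h a ha, ?_⟩
    have ho : IsOpen {z : ℝ | |z| < 1 / 12} := isOpen_lt continuous_abs continuous_const
    have : s =ᶠ[𝓝 a] id := by
      filter_upwards [ho.mem_nhds ha] with z hz using h z hz
    rw [this.deriv_eq, deriv_id]

def SF : C(UnitAddCircle, ℝ) := exists_SS.choose
def SF' : C(UnitAddCircle, ℝ) := exists_SS.choose_spec.choose
def SB : ℝ := exists_SS.choose_spec.choose_spec.choose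
lemma SF_PB : PB SF SB := exists_SS.choose_spec.choose_spec.choose_spec.1
lemma SF'_PB : PB SF' SB := exists_SS.choose_spec.choose_spec.choose_spec.2.1
lemma SF_deriv (a : ℝ) : HasDerivAt (fun x : ℝ => SF (x : UnitAddCircle)) (SF' (a : UnitAddCircle)) a :=
  exists_SS.choose_spec.choose_spec.choose_spec.2.2.1 a
lemma SF_loc (a : ℝ) (h : |a| < 1 / 12) : SF (a : UnitAddCircle) = a ∧ SF' (a : UnitAddCircle) = 1 :=
  exists_SS.choose_spec.choose_spec.choose_spec.2.2.2 a h
lemma SB_nonneg : 0 ≤ SB := (abs_nonneg _).trans (SF_PB.sup 0)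

def mk2 (f : C(UnitAddCircle, ℝ)) (c1 c2 : ℂ) : C(TT, ℂ) :=
  ⟨fun x => c1 * (f (x 0) : ℂ) + c2 * (f (x 1) : ℂ), by fun_prop⟩

structure AB (f : C(TT, ℂ)) (B : ℝ) : Prop where
  sup : ∀ x, ‖f x‖ ≤ B
  lip : ∀ j (t : ℝ) x, ‖D1 j t f x‖ ≤ B * |t|
  sec : ∀ j (t : ℝ) x, ‖D2 j t f x‖ ≤ B * t ^ 2

lemma mk2_AB (f : C(UnitAddCircle, ℝ)) (B : ℝ) (hf : PB f B) (c1 c2 : ℂ) (h1 : ‖c1‖ ≤ 1) (h2 : ‖c2‖ ≤ 1) :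
    AB (mk2 f c1 c2) (2 * B) := by
  have hB : 0 ≤ B := (abs_nonneg _).trans (hf.sup 0)
  have key : ∀ (c : ℂ) (r b : ℝ), ‖c‖ ≤ 1 → |r| ≤ b → ‖c * (r : ℂ)‖ ≤ b := by
    intro c r b hc hr
    rw [norm_mul, Complex.norm_real, Real.norm_eq_abs]
    nlinarith [abs_nonneg r, norm_nonneg c]
  refine ⟨fun x => ?_, fun j t x => ?_, fun j t x => ?_⟩
  · refine (norm_add_le _ _).trans ?_
    linarith [key c1 _ _ h1 (hf.sup (x 0)), key c2 _ _ h2 (hf.sup (x 1))]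
  · rw [D1_apply]
    have : B * |t| ≤ 2 * B * |t| := by nlinarith [abs_nonneg t, mul_nonneg hB (abs_nonneg t)]
    fin_cases j
    · have e : mk2 f c1 c2 (x + sh 0 t) - mk2 f c1 c2 x = c1 * ((f (x 0 + t) - f (x 0) : ℝ) : ℂ) := by
        simp [mk2, sh]; ring
      simp only [Fin.zero_eta]
      rw [e]; exact (key c1 _ _ h1 (hf.lip (x 0) t)).trans this
    · have e : mk2 f c1 c2 (x + sh 1 t) - mk2 f c1 c2 x = c2 * ((f (x 1 + t) - f (x 1) : ℝ) : ℂ) := by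
        simp [mk2, sh]; ring
      simp only [Fin.mk_one]
      rw [e]; exact (key c2 _ _ h2 (hf.lip (x 1) t)).trans this
  · rw [D2_apply]
    have : B * t ^ 2 ≤ 2 * B * t ^ 2 := by nlinarith [mul_nonneg hB (sq_nonneg t)]
    fin_cases j
    · have e : ∀ t, mk2 f c1 c2 (x + sh 0 t) - mk2 f c1 c2 x = c1 * ((f (x 0 + t) - f (x 0) : ℝ) : ℂ) := by
        intro t; simp [mk2, sh]; ring
      simp only [Fin.zero_eta]
      rw [e, e, ← mul_add, ← Complex.ofReal_add]; exact (key c1 _ _ h1 (hf.sec (x 0) t)).trans this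
    · have e : ∀ t, mk2 f c1 c2 (x + sh 1 t) - mk2 f c1 c2 x = c2 * ((f (x 1 + t) - f (x 1) : ℝ) : ℂ) := by
        intro t; simp [mk2, sh]; ring
      simp only [Fin.mk_one]
      rw [e, e, ← mul_add, ← Complex.ofReal_add]; exact (key c2 _ _ h2 (hf.sec (x 1) t)).trans this
end HP4

section HP5
open MeasureTheory UnitAddTorus
section
variable {n : ℕ}

lemma n2_le_sup {F : Type*} [NormedAddCommGroup F] [NormedSpace ℝ F] (f : C(TT, F)) (B : ℝ) (h : ∀ x, ‖f x‖ ≤ B) : n2 f ≤ B := by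
  have hB : 0 ≤ B := (norm_nonneg _).trans (h 0)
  have h1 := n2_mono f (ContinuousMap.const TT B) (fun x => by
    rw [ContinuousMap.const_apply, Real.norm_eq_abs, abs_of_nonneg hB]; exact h x)
  rwa [n2_const, Real.norm_eq_abs, abs_of_nonneg hB] at h1

structure Zb {F : Type*} [NormedAddCommGroup F] [NormedSpace ℝ F] (f : C(TT, F)) (B : ℝ) : Prop where
  sup : ∀ x, ‖f x‖ ≤ B
  lip : ∀ j (t : ℝ) x, ‖D1 j t f x‖ ≤ B * |t|
  sec : ∀ j (t : ℝ), n2 (D2 j t f) ≤ B * t ^ 2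

structure Xb (f : C(TT, Cn n)) (B : ℝ) : Prop where
  sup : ∀ x, ‖f x‖ ≤ B
  lip : ∀ j (t : ℝ), n2 (D1 j t f) ≤ B * |t|
  sec : ∀ j (t : ℝ), n2 (D2 j t f) ≤ B * t ^ 2

lemma Zb.toXb {f : C(TT, Cn n)} {B : ℝ} (h : Zb f B) : Xb f B :=
  ⟨h.sup, fun j t => n2_le_sup _ _ (h.lip j t), h.sec⟩

lemma Zb.add {f g : C(TT, Cn n)} {B C : ℝ} (hf : Zb f B) (hg : Zb g C) : Zb (f + g) (B + C) := by
  refine ⟨fun x => ?_, fun j t x => ?_, fun j t => ?_⟩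
  · exact (norm_add_le _ _).trans (add_le_add (hf.sup x) (hg.sup x))
  · rw [D1_add, add_mul]; exact (norm_add_le _ _).trans (add_le_add (hf.lip j t x) (hg.lip j t x))
  · rw [D2_add, add_mul]; exact (n2_add _ _).trans (add_le_add (hf.sec j t) (hg.sec j t))

lemma Xb.add {f g : C(TT, Cn n)} {B C : ℝ} (hf : Xb f B) (hg : Xb g C) : Xb (f + g) (B + C) := by
  refine ⟨fun x => ?_, fun j t => ?_, fun j t => ?_⟩
  · exact (norm_add_le _ _).trans (add_le_add (hf.sup x) (hg.sup x))
  · rw [D1_add, add_mul]; exact (n2_add _ _).trans (add_le_add (hf.lip j t) (hg.lip j t))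
  · rw [D2_add, add_mul]; exact (n2_add _ _).trans (add_le_add (hf.sec j t) (hg.sec j t))

lemma Zb.mono {f : C(TT, Cn n)} {B C : ℝ} (hf : Zb f B) (h : B ≤ C) : Zb f C :=
  ⟨fun x => (hf.sup x).trans h, fun j t x => (hf.lip j t x).trans (by gcongr), fun j t => (hf.sec j t).trans (by gcongr)⟩

lemma Xb.mono {f : C(TT, Cn n)} {B C : ℝ} (hf : Xb f B) (h : B ≤ C) : Xb f C :=
  ⟨fun x => (hf.sup x).trans h, fun j t => (hf.lip j t).trans (by gcongr), fun j t => (hf.sec j t).trans (by gcongr)⟩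

def asm (f : C(TT, ℂ)) (v : Cn n) : C(TT, Cn n) := ⟨fun x => f x • v, by fun_prop⟩
lemma asm_apply (f : C(TT, ℂ)) (v : Cn n) (x : TT) : asm f v x = f x • v := rfl

lemma asm_Zb {f : C(TT, ℂ)} {B : ℝ} (h : AB f B) (v : Cn n) : Zb (asm f v) (B * ‖v‖) := by
  refine ⟨fun x => ?_, fun j t x => ?_, fun j t => n2_le_sup _ _ (fun x => ?_)⟩
  · rw [asm_apply, norm_smul]; gcongr; exact h.sup x
  · have : D1 j t (asm f v) x = D1 j t f x • v := by simp only [D1_apply, asm_apply, sub_smul]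
    rw [this, norm_smul]
    have := mul_le_mul_of_nonneg_right (h.lip j t x) (norm_nonneg v)
    linarith
  · have : D2 j t (asm f v) x = D2 j t f x • v := by simp only [D2_apply, asm_apply, sub_smul, add_smul]
    rw [this, norm_smul]
    have := mul_le_mul_of_nonneg_right (h.sec j t x) (norm_nonneg v)
    linarith

lemma const_Zb (v : Cn n) : Zb (ContinuousMap.const TT v) ‖v‖ := by
  refine ⟨fun x => le_rfl, fun j t x => ?_, fun j t => n2_le_sup _ _ (fun x => ?_)⟩
  · simp only [D1_apply, ContinuousMap.const_apply, sub_self, norm_zero]; positivity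
  · simp only [D2_apply, ContinuousMap.const_apply, sub_self, add_zero, norm_zero]; positivity

def CK : ℝ := C0 + 2 * Real.pi * C0 + 2 * Real.pi + 4 * Real.pi ^ 2
lemma CK_nonneg : 0 ≤ CK := by unfold CK; have := C0_nonneg; positivity

lemma MV_Xb (m : KK → ℂ) (hm : MulB m) (c : HH n) : Xb (MV m hm c) (CK * ‖c‖) := by
  have h0 := C0_nonneg
  have hp := Real.pi_pos
  refine ⟨fun x => (MV_sup m hm c x).trans ?_, fun j t => (MV_D1 m hm c j t).trans ?_, fun j t => (MV_D2 m hm c j t).trans ?_⟩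
  · gcongr; unfold CK; have : 0 ≤ 2 * Real.pi * C0 := by positivity
    nlinarith
  · rw [mul_assoc, mul_comm |t|, ← mul_assoc]; gcongr; unfold CK; have : 0 ≤ 2 * Real.pi * C0 := by positivity
    nlinarith
  · rw [mul_assoc, mul_comm (t^2), ← mul_assoc]; gcongr; unfold CK; have : 0 ≤ 2 * Real.pi * C0 := by positivity
    nlinarith

lemma MV_Zb (c : HH n) : Zb (MV mT mTB c) (CK * ‖c‖) := by
  have h0 := C0_nonneg
  have hp := Real.pi_pos
  have hX := MV_Xb mT mTB c
  refine ⟨hX.sup, fun j t x => (MV_lip mT mTB mTB' c j t x).trans ?_, hX.sec⟩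
  have : 2 * Real.pi * |t| * (C0 * ‖c‖) = (2 * Real.pi * C0) * ‖c‖ * |t| := by ring
  rw [this]; gcongr; unfold CK
  nlinarith

abbrev YY (n : ℕ) := Cn n × Cn n × HH n

def al : C(TT, ℂ) := mk2 SF 1 Complex.I
def al' : C(TT, ℂ) := mk2 SF 1 (-Complex.I)
def alz : C(TT, ℂ) := mk2 SF' (1/2) (1/2)
def alz' : C(TT, ℂ) := mk2 SF' (1/2) (-(1/2))
lemma al_AB : AB al (2 * SB) := mk2_AB _ _ SF_PB _ _ (by simp) (by simp)
lemma al'_AB : AB al' (2 * SB) := mk2_AB _ _ SF_PB _ _ (by simp) (by simp)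
lemma alz_AB : AB alz (2 * SB) := mk2_AB _ _ SF'_PB _ _ (by norm_num) (by norm_num)
lemma alz'_AB : AB alz' (2 * SB) := mk2_AB _ _ SF'_PB _ _ (by norm_num) (by norm_num)

def Uop (y : YY n) : C(TT, Cn n) :=
  ContinuousMap.const TT (y.1 - MV mT mTB y.2.2 0) + asm al (y.2.1 - MV mS mSB y.2.2 0) +
    MV mT mTB y.2.2 + asm al' (y.2.2 0)
def Sop (y : YY n) : C(TT, Cn n) :=
  asm alz (y.2.1 - MV mS mSB y.2.2 0) + MV mS mSB y.2.2 + asm alz' (y.2.2 0)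

lemma Uop_sub (y y' : YY n) : Uop (y - y') = Uop y - Uop y' := by
  ext1 x
  simp only [Uop, ContinuousMap.add_apply, ContinuousMap.sub_apply, asm_apply, ContinuousMap.const_apply, Prod.fst_sub, Prod.snd_sub, map_sub, lp.coeFn_sub, Pi.sub_apply, smul_sub]
  abel
lemma Sop_sub (y y' : YY n) : Sop (y - y') = Sop y - Sop y' := by
  ext1 x
  simp only [Sop, ContinuousMap.add_apply, ContinuousMap.sub_apply, asm_apply, Prod.fst_sub, Prod.snd_sub, map_sub, lp.coeFn_sub, Pi.sub_apply, smul_sub]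
  abel

def CU : ℝ := (1 + C0) + 2 * SB * (1 + C0) + CK + 2 * SB

lemma y_bds (y : YY n) : ‖y.1‖ ≤ ‖y‖ ∧ ‖y.2.1‖ ≤ ‖y‖ ∧ ‖y.2.2‖ ≤ ‖y‖ ∧ ‖y.2.2 0‖ ≤ ‖y‖ := by
  have h2 := norm_snd_le y
  have h3 := (norm_snd_le y.2).trans h2
  exact ⟨norm_fst_le y, (norm_fst_le y.2).trans h2, h3, (lp.norm_apply_le_norm (by norm_num) _ _).trans h3⟩

lemma CU_nonneg : 0 ≤ CU := by
  have := C0_nonneg; have := SB_nonneg; have := CK_nonneg; unfold CU; positivity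

lemma yMV (y : YY n) (m : KK → ℂ) (hm : MulB m) (w : Cn n) (hw : ‖w‖ ≤ ‖y‖) : ‖w - MV m hm y.2.2 0‖ ≤ (1 + C0) * ‖y‖ := by
  have := MV_sup m hm y.2.2 0
  have h1 := (y_bds y).2.2.1
  have := C0_nonneg
  refine (norm_sub_le _ _).trans ?_
  nlinarith

lemma Uop_Zb (y : YY n) : Zb (Uop y) (CU * ‖y‖) := by
  obtain ⟨h1, h2, h3, h4⟩ := y_bds y
  have e1 := yMV y mT mTB y.1 h1
  have e2 := yMV y mS mSB y.2.1 h2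
  have hSB := SB_nonneg
  have hCK := CK_nonneg
  refine ((((const_Zb _).add (asm_Zb al_AB _)).add (MV_Zb y.2.2)).add (asm_Zb al'_AB _)).mono ?_
  have : CU * ‖y‖ = (1 + C0) * ‖y‖ + 2 * SB * ((1 + C0) * ‖y‖) + CK * ‖y‖ + 2 * SB * ‖y‖ := by unfold CU; ring
  rw [this]
  gcongr

lemma Sop_Xb (y : YY n) : Xb (Sop y) (CU * ‖y‖) := by
  obtain ⟨h1, h2, h3, h4⟩ := y_bds y
  have e1 := yMV y mT mTB y.1 h1
  have e2 := yMV y mS mSB y.2.1 h2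
  have hSB := SB_nonneg
  have hCK := CK_nonneg
  refine ((((asm_Zb alz_AB _).toXb).add (MV_Xb mS mSB y.2.2)).add (asm_Zb alz'_AB _).toXb).mono ?_
  have : CU * ‖y‖ = (1 + C0) * ‖y‖ + 2 * SB * ((1 + C0) * ‖y‖) + CK * ‖y‖ + 2 * SB * ‖y‖ := by unfold CU; ring
  rw [this]
  have : 0 ≤ (1 + C0) * ‖y‖ := by have := C0_nonneg; positivity
  have : 2 * SB * ‖y.2.1 - MV mS mSB y.2.2 0‖ + CK * ‖y.2.2‖ + 2 * SB * ‖y.2.2 0‖ ≤ 2 * SB * ((1 + C0) * ‖y‖) + CK * ‖y‖ + 2 * SB * ‖y‖ := by gcongr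
  linarith
end
end HP5

section HP6
open MeasureTheory UnitAddTorus
section
variable {n : ℕ}

def tp (z : ℂ) : TT := ![(z.re : UnitAddCircle), (z.im : UnitAddCircle)]
lemma tp_zero : tp 0 = 0 := by ext j; fin_cases j <;> simp [tp]

def Aop {E : Type*} [NormedAddCommGroup E] [NormedSpace ℂ E] (s w : E) : ℂ →L[ℝ] E :=
  (ContinuousLinearMap.id ℝ ℂ).smulRight s + (Complex.conjCLE : ℂ →L[ℝ] ℂ).smulRight w
lemma Aop_apply {E : Type*} [NormedAddCommGroup E] [NormedSpace ℂ E] (s w : E) (ξ : ℂ) :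
    Aop s w ξ = ξ • s + (starRingEnd ℂ) ξ • w := by simp [Aop]
lemma Aop_norm {E : Type*} [NormedAddCommGroup E] [NormedSpace ℂ E] (s w : E) : ‖Aop s w‖ ≤ ‖s‖ + ‖w‖ := by
  refine ContinuousLinearMap.opNorm_le_bound _ (by positivity) (fun ξ => ?_)
  rw [Aop_apply]
  refine (norm_add_le _ _).trans ?_
  rw [norm_smul, norm_smul, RCLike.norm_conj]
  linarith

lemma mF_tp (k : KK) (z : ℂ) : mFourier k (tp z) = Complex.exp (Aop (lam' k) (lam k) z) := by
  have e : Aop (lam' k) (lam k) z = 2 * Real.pi * Complex.I * (k 0) * z.re + 2 * Real.pi * Complex.I * (k 1) * z.im := by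
    rw [Aop_apply, smul_eq_mul, smul_eq_mul]
    unfold lam lam'
    apply Complex.ext <;> simp <;> ring
  rw [e, Complex.exp_add]
  simp [mFourier, tp]

lemma lam_mT (k : KK) (hk : k ≠ 0) : lam k * mT k = m0 k := by
  unfold mT; rw [← mul_assoc, mul_inv_cancel₀ (lam_ne k hk), one_mul]
lemma lam'_mT (k : KK) : lam' k * mT k = mS k := by
  unfold mT mS; ring

lemma term_deriv (k : KK) (d : Cn n) (z : ℂ) :
    HasFDerivAt (fun z => mFourier k (tp z) • d) (Aop (mFourier k (tp z) • lam' k • d) (mFourier k (tp z) • lam k • d)) z := by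
  simp only [mF_tp]
  have h := ((Aop (lam' k) (lam k)).hasFDerivAt (x := z)).cexp.smul_const d
  refine h.congr_fderiv ?_
  ext1 ξ
  rw [Aop_apply]
  simp only [ContinuousLinearMap.smulRight_apply, smul_apply, Aop_apply, smul_smul, ← add_smul, smul_eq_mul]
  congr 1; ring

lemma m0_zero : m0 0 = 1 := by simp [m0, ww]

lemma MVT_deriv (c : HH n) (z : ℂ) :
    HasFDerivAt (fun z => MV mT mTB c (tp z)) (Aop (MV mS mSB c (tp z)) (MV m0 m0B c (tp z) - c 0)) z := by
  have e : (fun z => MV mT mTB c (tp z)) = fun z => ∑' k, mFourier k (tp z) • mT k • c k := by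
    ext1 z; exact (MV_hasSum mT mTB c (tp z)).tsum_eq.symm
  have hb : ∀ k (z : ℂ), ‖Aop (mFourier k (tp z) • lam' k • mT k • c k) (mFourier k (tp z) • lam k • mT k • c k)‖ ≤ 2 * (1 / ww k * ‖c k‖) := by
    intro k z
    refine (Aop_norm _ _).trans ?_
    have key : ∀ a : ℂ, ‖mFourier k (tp z) • a • mT k • c k‖ = ‖a‖ * ‖mT k‖ * ‖c k‖ := by
      intro a
      rw [norm_smul, mF_norm, one_mul, norm_smul, norm_smul, mul_assoc]
    rw [key, key, norm_lam', ← norm_mul]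
    have : ‖lam k * mT k‖ ≤ 1 / ww k := by
      by_cases hk : k = 0
      · subst hk; rw [lam_zero, zero_mul, norm_zero]; have := ww_pos 0; positivity
      · rw [lam_mT k hk]; exact m0B k
    have := mul_le_mul_of_nonneg_right this (norm_nonneg (c k))
    linarith
  have hu : Summable (fun k => 2 * (1 / ww k * ‖c k‖)) := (mul_sum c).1.mul_left 2
  have h := hasFDerivAt_tsum hu (f := fun k z => mFourier k (tp z) • mT k • c k) (fun k z => term_deriv k (mT k • c k) z) hb
    (MV_hasSum mT mTB c (tp 0)).summable z
  rw [e]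
  refine h.congr_fderiv ?_
  have hs : Summable (fun k => Aop (mFourier k (tp z) • lam' k • mT k • c k) (mFourier k (tp z) • lam k • mT k • c k)) :=
    Summable.of_norm_bounded hu (fun k => hb k z)
  ext1 ξ
  have h1 := (ContinuousLinearMap.apply ℝ (Cn n) ξ).hasSum hs.hasSum
  refine HasSum.unique h1 ?_
  simp only [ContinuousLinearMap.apply_apply, Aop_apply]
  refine HasSum.add (HasSum.const_smul ξ ?_) (HasSum.const_smul _ ?_)
  · have hh := MV_hasSum mS mSB c (tp z)
    refine Eq.subst (motive := fun f => HasSum f _) (funext fun k => ?_) hh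
    rw [smul_smul (lam' k), lam'_mT]
  · have h3 := (MV_hasSum m0 m0B c (tp z)).sub (hasSum_ite_eq (0 : KK) (c 0))
    refine Eq.subst (motive := fun f => HasSum f _) (funext fun k => ?_) h3
    by_cases hk : k = 0
    · subst hk; simp [lam_zero, m0_zero, mFourier_zero]
    · rw [smul_smul (lam k), lam_mT k hk]; simp [hk]

def Nb : Set ℂ := {z | |z.re| < 1 / 12 ∧ |z.im| < 1 / 12}
lemma Nb_open : IsOpen Nb := by
  apply IsOpen.inter
  · exact isOpen_lt (continuous_abs.comp Complex.continuous_re) continuous_const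
  · exact isOpen_lt (continuous_abs.comp Complex.continuous_im) continuous_const

lemma al_tp {z : ℂ} (hz : z ∈ Nb) : al (tp z) = z := by
  simp [al, mk2, tp, (SF_loc _ hz.1).1, (SF_loc _ hz.2).1]
  rw [mul_comm, Complex.re_add_im]
lemma al'_tp {z : ℂ} (hz : z ∈ Nb) : al' (tp z) = (starRingEnd ℂ) z := by
  simp [al', mk2, tp, (SF_loc _ hz.1).1, (SF_loc _ hz.2).1]
  apply Complex.ext <;> simp
lemma alz_tp {z : ℂ} (hz : z ∈ Nb) : alz (tp z) = 1 := by
  simp [alz, mk2, tp, (SF_loc _ hz.1).2, (SF_loc _ hz.2).2]; norm_num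
lemma alz'_tp {z : ℂ} (hz : z ∈ Nb) : alz' (tp z) = 0 := by
  simp [alz', mk2, tp, (SF_loc _ hz.1).2, (SF_loc _ hz.2).2]

lemma Nb_zero : (0 : ℂ) ∈ Nb := by simp [Nb]

lemma Uop_zero_pt (y : YY n) : Uop y (tp 0) = y.1 := by
  have h1 := al_tp Nb_zero
  have h2 := al'_tp Nb_zero
  simp only [Uop, ContinuousMap.add_apply, asm_apply, ContinuousMap.const_apply, h1, h2]
  rw [tp_zero]; simp
lemma Sop_zero_pt (y : YY n) : Sop y (tp 0) = y.2.1 := by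
  have h1 := alz_tp Nb_zero
  have h2 := alz'_tp Nb_zero
  simp only [Sop, ContinuousMap.add_apply, asm_apply, h1, h2]
  rw [tp_zero]; simp

lemma Uop_deriv (y : YY n) (z : ℂ) (hz : z ∈ Nb) :
    HasFDerivAt (fun z => Uop y (tp z)) (Aop (Sop y (tp z)) (MV m0 m0B y.2.2 (tp z))) z := by
  have h1 := MVT_deriv y.2.2 z
  have h2 : HasFDerivAt (fun z : ℂ => z • (y.2.1 - MV mS mSB y.2.2 0)) _ z := (hasFDerivAt_id (𝕜 := ℝ) z).smul_const _
  have h3 : HasFDerivAt (fun z : ℂ => (starRingEnd ℂ) z • (y.2.2 0)) _ z := ((Complex.conjCLE : ℂ →L[ℝ] ℂ).hasFDerivAt (x := z)).smul_const (y.2.2 0)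
  have h4 := (((hasFDerivAt_const (𝕜 := ℝ) (y.1 - MV mT mTB y.2.2 0) z).add h2).add h1).add h3
  have h5 := h4.congr_of_eventuallyEq (f₁ := fun z => Uop y (tp z)) (by
    filter_upwards [Nb_open.mem_nhds hz] with w hw
    simp only [Uop, ContinuousMap.add_apply, asm_apply, ContinuousMap.const_apply, al_tp hw, al'_tp hw, Pi.add_apply])
  refine h5.congr_fderiv ?_
  ext1 ξ
  simp only [Aop_apply, Sop, ContinuousMap.add_apply, asm_apply, alz_tp hz, alz'_tp hz, one_smul, zero_smul, add_zero, zero_add, add_apply, ContinuousLinearMap.smulRight_apply, smul_add, smul_sub]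
  simp
  abel
end
end HP6

section HP7
open MeasureTheory UnitAddTorus
lemma n2_lin4 {F : Type*} [NormedAddCommGroup F] [NormedSpace ℝ F] (f : C(TT, F)) (g1 g2 g3 g4 : C(TT, ℝ))
    (c1 c2 c3 c4 c5 : ℝ) (h1 : 0 ≤ c1) (h2 : 0 ≤ c2) (h3 : 0 ≤ c3) (h4 : 0 ≤ c4) (h5 : 0 ≤ c5)
    (h : ∀ x, ‖f x‖ ≤ c1 * g1 x + c2 * g2 x + c3 * g3 x + c4 * g4 x + c5) :
    n2 f ≤ c1 * n2 g1 + c2 * n2 g2 + c3 * n2 g3 + c4 * n2 g4 + c5 := by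
  have e := n2_mono f (c1 • g1 + c2 • g2 + c3 • g3 + c4 • g4 + ContinuousMap.const TT c5) (fun x => (h x).trans (le_abs_self _))
  refine e.trans ?_
  refine (n2_add _ _).trans ?_
  rw [n2_const, Real.norm_eq_abs, abs_of_nonneg h5]
  gcongr
  refine (n2_add _ _).trans ?_
  rw [n2_smul c4, abs_of_nonneg h4]
  gcongr
  refine (n2_add _ _).trans ?_
  rw [n2_smul c3, abs_of_nonneg h3]
  gcongr
  refine (n2_add _ _).trans ?_
  rw [n2_smul c2, abs_of_nonneg h2, n2_smul c1, abs_of_nonneg h1]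

section
variable {E G : Type*} [NormedAddCommGroup E] [NormedSpace ℝ E] [NormedAddCommGroup G] [NormedSpace ℝ G]

structure QB (Q : E → G) (Q' : E → E →L[ℝ] G) (Q'' : E → E →L[ℝ] E →L[ℝ] G) (η : ℝ) : Prop where
  hd : ∀ x, HasFDerivAt Q (Q' x) x
  b0 : ∀ x, ‖x‖ ≤ CU → ‖Q x‖ ≤ η
  b1 : ∀ x, ‖Q' x‖ ≤ η
  b2 : ∀ x, ‖Q'' x‖ ≤ η
  l0 : ∀ a b, ‖Q b - Q a‖ ≤ η * ‖b - a‖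
  l1 : ∀ a b, ‖Q' b - Q' a‖ ≤ η * ‖b - a‖
  t1 : ∀ a b, ‖Q b - Q a - Q' a (b - a)‖ ≤ η * ‖b - a‖ ^ 2
  t2 : ∀ a b, ‖Q' b - Q' a - Q'' a (b - a)‖ ≤ η * ‖b - a‖ ^ 2

lemma comp_sec (Q : E → G) (Q' : E → E →L[ℝ] G) (η : ℝ) (b1 : ∀ x, ‖Q' x‖ ≤ η)
    (t1 : ∀ a b, ‖Q b - Q a - Q' a (b - a)‖ ≤ η * ‖b - a‖ ^ 2) (a p m : E) :
    ‖(Q p - Q a) + (Q m - Q a)‖ ≤ η * ‖(p - a) + (m - a)‖ + η * ‖p - a‖ ^ 2 + η * ‖m - a‖ ^ 2 := by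
  have e : (Q p - Q a) + (Q m - Q a) = Q' a ((p - a) + (m - a)) + (Q p - Q a - Q' a (p - a)) + (Q m - Q a - Q' a (m - a)) := by
    rw [map_add]; abel
  rw [e]
  refine (norm_add_le _ _).trans (add_le_add ((norm_add_le _ _).trans (add_le_add ?_ (t1 a p))) (t1 a m))
  exact (Q' a).le_of_opNorm_le (b1 a) _

lemma mv01 {f : ℝ → G} {f' : ℝ → G} {C : ℝ} (hf : ∀ t, HasDerivAt f (f' t) t) (hb : ∀ t, 0 ≤ t → t ≤ 1 → ‖f' t‖ ≤ C) :
    ‖f 1 - f 0‖ ≤ C :=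
  norm_image_sub_le_of_norm_deriv_le_segment_01' (fun t _ => (hf t).hasDerivWithinAt) (fun t ht => hb t ht.1 ht.2.le)

lemma QB.path {Q : E → G} {Q' : E → E →L[ℝ] G} {Q'' : E → E →L[ℝ] E →L[ℝ] G} {η : ℝ} (h : QB Q Q' Q'' η) (p s : E) (t : ℝ) :
    HasDerivAt (fun t : ℝ => Q (p + t • s)) (Q' (p + t • s) s) t := by
  have h1 : HasDerivAt (fun t : ℝ => p + t • s) s t := by
    simpa using ((hasDerivAt_id t).smul_const s).const_add p
  exact (h.hd _).comp_hasDerivAt t h1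

lemma seg_bd (dp ds : E) (t : ℝ) (h0 : 0 ≤ t) (h1 : t ≤ 1) : ‖dp + t • ds‖ ≤ ‖dp‖ + ‖ds‖ := by
  refine (norm_add_le _ _).trans ?_
  rw [norm_smul, Real.norm_eq_abs, abs_of_nonneg h0]
  gcongr
  exact mul_le_of_le_one_left (norm_nonneg _) h1

lemma QB.diff0 {Q : E → G} {Q' : E → E →L[ℝ] G} {Q'' : E → E →L[ℝ] E →L[ℝ] G} {η : ℝ} (h : QB Q Q' Q'' η)
    (p₀ p₁ s₀ s₁ : E) :
    ‖(Q (p₁ + s₁) - Q p₁) - (Q (p₀ + s₀) - Q p₀)‖ ≤ η * ‖s₁ - s₀‖ + η * (‖p₁ - p₀‖ + ‖s₁ - s₀‖) * ‖s₀‖ := by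
  have hη : 0 ≤ η := (norm_nonneg _).trans (h.b1 0)
  have := mv01 (f := fun t => Q (p₁ + t • s₁) - Q (p₀ + t • s₀)) (fun t => (h.path p₁ s₁ t).sub (h.path p₀ s₀ t))
    (C := η * ‖s₁ - s₀‖ + η * (‖p₁ - p₀‖ + ‖s₁ - s₀‖) * ‖s₀‖) (fun t h0 h1 => ?_)
  · simp only [one_smul, zero_smul, add_zero] at this
    convert this using 2; abel
  · have e : Q' (p₁ + t • s₁) s₁ - Q' (p₀ + t • s₀) s₀ = Q' (p₁ + t • s₁) (s₁ - s₀) + (Q' (p₁ + t • s₁) - Q' (p₀ + t • s₀)) s₀ := by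
      simp only [map_sub, sub_apply]; abel
    rw [e]
    refine (norm_add_le _ _).trans (add_le_add ((Q' _).le_of_opNorm_le (h.b1 _) _) ?_)
    refine ContinuousLinearMap.le_of_opNorm_le _ ((h.l1 _ _).trans ?_) _
    gcongr
    have d1 : (p₁ + t • s₁) - (p₀ + t • s₀) = (p₁ - p₀) + t • (s₁ - s₀) := by rw [smul_sub]; abel
    rw [d1]; exact seg_bd _ _ t h0 h1

lemma QB.diff2 {Q : E → G} {Q' : E → E →L[ℝ] G} {Q'' : E → E →L[ℝ] E →L[ℝ] G} {η : ℝ} (h : QB Q Q' Q'' η)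
    (p₀ p₁ p₂ s₀ s₁ s₂ : E) :
    ‖((Q (p₁ + s₁) - Q p₁) - (Q (p₀ + s₀) - Q p₀)) + ((Q (p₂ + s₂) - Q p₂) - (Q (p₀ + s₀) - Q p₀))‖ ≤
      η * ‖(s₁ - s₀) + (s₂ - s₀)‖ + η * (‖p₁ - p₀‖ + ‖s₁ - s₀‖) * ‖s₁ - s₀‖ + η * (‖p₂ - p₀‖ + ‖s₂ - s₀‖) * ‖s₂ - s₀‖
      + (η * (‖(p₁ - p₀) + (p₂ - p₀)‖ + ‖(s₁ - s₀) + (s₂ - s₀)‖) + η * (‖p₁ - p₀‖ + ‖s₁ - s₀‖) ^ 2 + η * (‖p₂ - p₀‖ + ‖s₂ - s₀‖) ^ 2) * ‖s₀‖ := by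
  have hη : 0 ≤ η := (norm_nonneg _).trans (h.b1 0)
  have := mv01 (f := fun t => (Q (p₁ + t • s₁) - Q (p₀ + t • s₀)) + (Q (p₂ + t • s₂) - Q (p₀ + t • s₀)))
    (fun t => ((h.path p₁ s₁ t).sub (h.path p₀ s₀ t)).add ((h.path p₂ s₂ t).sub (h.path p₀ s₀ t)))
    (C := η * ‖(s₁ - s₀) + (s₂ - s₀)‖ + η * (‖p₁ - p₀‖ + ‖s₁ - s₀‖) * ‖s₁ - s₀‖ + η * (‖p₂ - p₀‖ + ‖s₂ - s₀‖) * ‖s₂ - s₀‖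
      + (η * (‖(p₁ - p₀) + (p₂ - p₀)‖ + ‖(s₁ - s₀) + (s₂ - s₀)‖) + η * (‖p₁ - p₀‖ + ‖s₁ - s₀‖) ^ 2 + η * (‖p₂ - p₀‖ + ‖s₂ - s₀‖) ^ 2) * ‖s₀‖) (fun t h0 h1 => ?_)
  · simp only [one_smul, zero_smul, add_zero] at this
    convert this using 2; abel
  · have d1 : (p₁ + t • s₁) - (p₀ + t • s₀) = (p₁ - p₀) + t • (s₁ - s₀) := by rw [smul_sub]; abel
    have d2 : (p₂ + t • s₂) - (p₀ + t • s₀) = (p₂ - p₀) + t • (s₂ - s₀) := by rw [smul_sub]; abel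
    have n1 : ‖(p₁ + t • s₁) - (p₀ + t • s₀)‖ ≤ ‖p₁ - p₀‖ + ‖s₁ - s₀‖ := by rw [d1]; exact seg_bd _ _ t h0 h1
    have n2 : ‖(p₂ + t • s₂) - (p₀ + t • s₀)‖ ≤ ‖p₂ - p₀‖ + ‖s₂ - s₀‖ := by rw [d2]; exact seg_bd _ _ t h0 h1
    have n3 : ‖((p₁ + t • s₁) - (p₀ + t • s₀)) + ((p₂ + t • s₂) - (p₀ + t • s₀))‖ ≤ ‖(p₁ - p₀) + (p₂ - p₀)‖ + ‖(s₁ - s₀) + (s₂ - s₀)‖ := by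
      rw [d1, d2]
      convert seg_bd ((p₁ - p₀) + (p₂ - p₀)) ((s₁ - s₀) + (s₂ - s₀)) t h0 h1 using 2
      rw [smul_add]; abel
    have hc := comp_sec Q' Q'' η h.b2 h.t2 (p₀ + t • s₀) (p₁ + t • s₁) (p₂ + t • s₂)
    have e1 := h.l1 (p₀ + t • s₀) (p₁ + t • s₁)
    have e2 := h.l1 (p₀ + t • s₀) (p₂ + t • s₂)
    generalize p₀ + t • s₀ = w₀ at *
    generalize p₁ + t • s₁ = w₁ at *
    generalize p₂ + t • s₂ = w₂ at *
    have e : (Q' w₁ s₁ - Q' w₀ s₀) + (Q' w₂ s₂ - Q' w₀ s₀) = Q' w₀ ((s₁ - s₀) + (s₂ - s₀)) + (Q' w₁ - Q' w₀) (s₁ - s₀) + (Q' w₂ - Q' w₀) (s₂ - s₀) + ((Q' w₁ - Q' w₀) + (Q' w₂ - Q' w₀)) s₀ := by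
      simp only [map_sub, map_add, sub_apply, add_apply]; abel
    rw [e]
    refine (norm_add_le _ _).trans (add_le_add ((norm_add_le _ _).trans (add_le_add ((norm_add_le _ _).trans (add_le_add ?_ ?_)) ?_)) ?_)
    · exact (Q' _).le_of_opNorm_le (h.b1 _) _
    · refine ContinuousLinearMap.le_of_opNorm_le _ (e1.trans ?_) _
      gcongr
    · refine ContinuousLinearMap.le_of_opNorm_le _ (e2.trans ?_) _
      gcongr
    · refine ContinuousLinearMap.le_of_opNorm_le _ (hc.trans ?_) _
      gcongr
end
end HP7

section HP8
open MeasureTheory UnitAddTorus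
section
variable {n : ℕ}

def app (f : C(TT, Cn n →L[ℝ] Cn n)) (S : C(TT, Cn n)) : C(TT, Cn n) :=
  ⟨fun x => f x (S x), f.continuous.clm_apply S.continuous⟩
lemma app_apply (f : C(TT, Cn n →L[ℝ] Cn n)) (S : C(TT, Cn n)) (x : TT) : app f S x = f x (S x) := rfl

lemma app_n2 {f : C(TT, Cn n →L[ℝ] Cn n)} {S : C(TT, Cn n)} {B C : ℝ} (hf : Zb f B) (hS : Xb S C) :
    n2 (app f S) ≤ B * C := by
  refine n2_le_sup _ _ (fun x => ?_)
  rw [app_apply]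
  exact (f x).le_of_opNorm_le_of_le (hf.sup x) (hS.sup x)

lemma app_sec {f : C(TT, Cn n →L[ℝ] Cn n)} {S : C(TT, Cn n)} {B C : ℝ} (hf : Zb f B) (hS : Xb S C) (j : Fin 2) (t : ℝ) :
    n2 (D2 j t (app f S)) ≤ (4 * (B * C)) * t ^ 2 := by
  have hB : 0 ≤ B := (norm_nonneg _).trans (hf.sup 0)
  have hC : 0 ≤ C := (norm_nonneg _).trans (hS.sup 0)
  have := n2_lin4 (D2 j t (app f S)) (nrm (D2 j t S)) (nrm (D2 j t f)) (nrm (D1 j t S)) (nrm (D1 j (-t) S)) B C (B * |t|) (B * |t|) 0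
    hB hC (by positivity) (by positivity) le_rfl (fun x => by
      have hp := hf.lip j t x
      have hm := hf.lip j (-t) x
      have h0 := hf.sup x
      have hs := hS.sup x
      rw [abs_neg] at hm
      change _ ≤ B * ‖D2 j t S x‖ + C * ‖D2 j t f x‖ + B * |t| * ‖D1 j t S x‖ + B * |t| * ‖D1 j (-t) S x‖ + 0
      rw [add_zero]
      have e : D2 j t (app f S) x = f x (D2 j t S x) + D2 j t f x (S x) + D1 j t f x (D1 j t S x) + D1 j (-t) f x (D1 j (-t) S x) := by
        simp only [D2_apply, D1_apply, app_apply, map_sub, map_add, sub_apply, add_apply]; abel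
      rw [e]
      refine (norm_add_le _ _).trans (add_le_add ((norm_add_le _ _).trans (add_le_add ((norm_add_le _ _).trans (add_le_add ?_ ?_)) ?_)) ?_)
      · exact ContinuousLinearMap.le_of_opNorm_le _ h0 _
      · rw [mul_comm]; exact ContinuousLinearMap.le_opNorm_of_le _ hs
      · exact ContinuousLinearMap.le_of_opNorm_le _ hp _
      · exact ContinuousLinearMap.le_of_opNorm_le _ hm _)
  simp only [n2_nrm] at this
  refine this.trans ?_
  have a1 := hS.sec j t
  have a2 := hf.sec j t
  have a3 := hS.lip j t
  have a4 := hS.lip j (-t)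
  rw [abs_neg] at a4
  calc _ ≤ B * (C * t ^ 2) + C * (B * t ^ 2) + B * |t| * (C * |t|) + B * |t| * (C * |t|) + 0 := by gcongr
    _ = _ := by rw [← sq_abs t]; ring

variable {G : Type*} [NormedAddCommGroup G] [NormedSpace ℝ G]
variable {Q : Cn n → G} {Q' : Cn n → Cn n →L[ℝ] G} {Q'' : Cn n → Cn n →L[ℝ] Cn n →L[ℝ] G} {η : ℝ}

lemma QB.cont (h : QB Q Q' Q'' η) : Continuous Q :=
  continuous_iff_continuousAt.2 (fun x => (h.hd x).continuousAt)

def qcmp (h : QB Q Q' Q'' η) (u : C(TT, Cn n)) : C(TT, G) := ⟨fun x => Q (u x), h.cont.comp u.continuous⟩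
lemma cmp_apply (h : QB Q Q' Q'' η) (u : C(TT, Cn n)) (x : TT) : qcmp h u x = Q (u x) := rfl

lemma cmp_Zb (h : QB Q Q' Q'' η) (u : C(TT, Cn n)) (K : ℝ) (hKC : K ≤ CU) (hu : Zb u K) : Zb (qcmp h u) (η * (1 + K + 2 * K ^ 2)) := by
  have hη : 0 ≤ η := (norm_nonneg _).trans (h.b1 0)
  have hK : 0 ≤ K := (norm_nonneg _).trans (hu.sup 0)
  refine ⟨fun x => (h.b0 _ ((hu.sup x).trans hKC)).trans (le_mul_of_one_le_right hη (by nlinarith [sq_nonneg K])), fun j t x => ?_, fun j t => ?_⟩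
  · rw [D1_apply, cmp_apply, cmp_apply]
    refine (h.l0 _ _).trans ?_
    rw [mul_assoc]
    gcongr
    refine (hu.lip j t x).trans ?_
    gcongr
    nlinarith [sq_nonneg K]
  · have := n2_lin4 (D2 j t (qcmp h u)) (nrm (D2 j t u)) 0 0 0 η 0 0 0 (2 * η * (K * |t|) ^ 2) hη le_rfl le_rfl le_rfl (by positivity) (fun x => by
      have hp := hu.lip j t x
      have hm := hu.lip j (-t) x
      rw [abs_neg] at hm
      change _ ≤ η * ‖D2 j t u x‖ + 0 * 0 + 0 * 0 + 0 * 0 + _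
      refine (comp_sec Q Q' η h.b1 h.t1 _ _ _).trans ?_
      have e1 : η * ‖u (x + sh j t) - u x‖ ^ 2 ≤ η * (K * |t|) ^ 2 := by gcongr; exact hp
      have e2 : η * ‖u (x + sh j (-t)) - u x‖ ^ 2 ≤ η * (K * |t|) ^ 2 := by gcongr; exact hm
      rw [D2_apply]
      linarith)
    rw [n2_nrm] at this
    refine this.trans ?_
    have := mul_le_mul_of_nonneg_left (hu.sec j t) hη
    rw [mul_pow, sq_abs]
    have : 0 ≤ η * t ^ 2 := by positivity
    nlinarith

lemma cmp_diff_Zb (h : QB Q Q' Q'' η) (p s : C(TT, Cn n)) (K D : ℝ) (hD : 0 ≤ D) (hD2 : D ≤ 2) (hp : Zb p K) (hs : Zb s (K * D)) :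
    Zb (qcmp h (p + s) - qcmp h p) (η * (K * D) * (1 + 9 * K + 18 * K ^ 2)) := by
  have hη : 0 ≤ η := (norm_nonneg _).trans (h.b1 0)
  have hK : 0 ≤ K := (norm_nonneg _).trans (hp.sup 0)
  have hKD : K * D ≤ 2 * K := by nlinarith
  have hKDn : 0 ≤ K * D := by positivity
  have hηKD : 0 ≤ η * (K * D) := by positivity
  refine ⟨fun x => ?_, fun j t x => ?_, fun j t => ?_⟩
  · change ‖Q (p x + s x) - Q (p x)‖ ≤ _
    refine (h.l0 _ _).trans ?_
    rw [add_sub_cancel_left]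
    have := mul_le_mul_of_nonneg_left (hs.sup x) hη
    nlinarith [mul_nonneg hηKD hK, mul_nonneg hηKD (sq_nonneg K)]
  · change ‖(Q (p (x + sh j t) + s (x + sh j t)) - Q (p (x + sh j t))) - (Q (p x + s x) - Q (p x))‖ ≤ _
    refine (h.diff0 _ _ _ _).trans ?_
    have a1 := hp.lip j t x
    have a2 := hs.lip j t x
    have a3 := hs.sup x
    rw [D1_apply] at a1 a2
    have a4 : ‖s (x + sh j t) - s x‖ ≤ (2 * K) * |t| := a2.trans (by gcongr)
    calc _ ≤ η * (K * D * |t|) + η * (K * |t| + (2 * K) * |t|) * (K * D) := by gcongr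
      _ = η * (K * D) * (1 + 3 * K + 0) * |t| := by ring
      _ ≤ _ := by gcongr <;> nlinarith [sq_nonneg K]
  · have hN := n2_lin4 (D2 j t (qcmp h (p + s) - qcmp h p)) (nrm (D2 j t s)) (nrm (D2 j t p)) 0 0 (η + η * (K * D)) (η * (K * D)) 0 0
      (2 * (η * (3 * K * |t|) * (K * D * |t|)) + 2 * (η * (3 * K * |t|) ^ 2) * (K * D)) (by positivity) (by positivity) le_rfl le_rfl (by positivity) (fun x => by
      have a1 := hp.lip j t x
      have a2 := hs.lip j t x
      have a3 := hs.sup x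
      have b1 := hp.lip j (-t) x
      have b2 := hs.lip j (-t) x
      rw [abs_neg] at b1 b2
      rw [D1_apply] at a1 a2 b1 b2
      have a4 : ‖p (x + sh j t) - p x‖ + ‖s (x + sh j t) - s x‖ ≤ 3 * K * |t| := by
        have := mul_le_mul_of_nonneg_right hKD (abs_nonneg t); linarith
      have b4 : ‖p (x + sh j (-t)) - p x‖ + ‖s (x + sh j (-t)) - s x‖ ≤ 3 * K * |t| := by
        have := mul_le_mul_of_nonneg_right hKD (abs_nonneg t); linarith
      change ‖((Q (p (x + sh j t) + s (x + sh j t)) - Q (p (x + sh j t))) - (Q (p x + s x) - Q (p x))) + ((Q (p (x + sh j (-t)) + s (x + sh j (-t))) - Q (p (x + sh j (-t)))) - (Q (p x + s x) - Q (p x)))‖ ≤ (η + η * (K * D)) * ‖D2 j t s x‖ + η * (K * D) * ‖D2 j t p x‖ + 0 * 0 + 0 * 0 + _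
      refine (h.diff2 _ _ _ _ _ _).trans ?_
      rw [← D2_apply, ← D2_apply]
      calc _ ≤ η * ‖D2 j t s x‖ + η * (3 * K * |t|) * (K * D * |t|) + η * (3 * K * |t|) * (K * D * |t|) + (η * (‖D2 j t p x‖ + ‖D2 j t s x‖) + η * (3 * K * |t|) ^ 2 + η * (3 * K * |t|) ^ 2) * (K * D) := by gcongr
        _ = _ := by ring)
    rw [n2_nrm, n2_nrm] at hN
    refine hN.trans ?_
    have c1 := hp.sec j t
    have c2 := hs.sec j t
    have c3 : n2 (D2 j t s) ≤ 2 * K * t ^ 2 := c2.trans (by gcongr)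
    calc _ ≤ η * (K * D * t ^ 2) + η * (K * D) * (2 * K * t ^ 2) + η * (K * D) * (K * t ^ 2) + 0 * n2 (0 : C(TT, ℝ)) + 0 * n2 (0 : C(TT, ℝ)) + (2 * (η * (3 * K * |t|) * (K * D * |t|)) + 2 * (η * (3 * K * |t|) ^ 2) * (K * D)) := by
          rw [add_mul η]; gcongr
      _ = _ := by rw [← sq_abs t]; ring
end
end HP8

section HP9
open MeasureTheory UnitAddTorus
section
variable {n : ℕ}
variable {Q : Cn n → Cn n →L[ℝ] Cn n} {Q' : Cn n → Cn n →L[ℝ] Cn n →L[ℝ] Cn n} {Q'' : Cn n → Cn n →L[ℝ] Cn n →L[ℝ] Cn n →L[ℝ] Cn n} {η : ℝ}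

def gop (h : QB Q Q' Q'' η) (y : YY n) : C(TT, Cn n) := app (qcmp h (Uop y)) (Sop y)

def CN : ℝ := 4 * (CU * (1 + 9 * CU + 18 * CU ^ 2) * CU + (1 + CU + 2 * CU ^ 2) * CU)
lemma CN_nonneg : 0 ≤ CN := by unfold CN; have := CU_nonneg; positivity

lemma gop_diff (h : QB Q Q' Q'' η) (y y' : YY n) (hy : ‖y‖ ≤ 1) (hy' : ‖y'‖ ≤ 1) :
    n2 (gop h y - gop h y') ≤ CN * η * ‖y - y'‖ ∧ ∀ j t, n2 (D2 j t (gop h y - gop h y')) ≤ CN * η * ‖y - y'‖ * t ^ 2 := by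
  have hη : 0 ≤ η := (norm_nonneg _).trans (h.b1 0)
  have hCU := CU_nonneg
  set D := ‖y - y'‖ with hDdef
  have hD : 0 ≤ D := norm_nonneg _
  have hD2 : D ≤ 2 := (norm_sub_le _ _).trans (by linarith)
  have e1 : Uop y = Uop y' + Uop (y - y') := by rw [Uop_sub]; abel
  have hp : Zb (Uop y') CU := (Uop_Zb y').mono (by nlinarith)
  have hs : Zb (Uop (y - y')) (CU * D) := Uop_Zb _
  have z1 := cmp_diff_Zb h (Uop y') (Uop (y - y')) CU D hD hD2 hp hs
  rw [← e1] at z1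
  have z2 := cmp_Zb h (Uop y') CU le_rfl hp
  have x1 : Xb (Sop y) CU := (Sop_Xb y).mono (by nlinarith)
  have x2 : Xb (Sop (y - y')) (CU * D) := Sop_Xb _
  have e2 : gop h y - gop h y' = app (qcmp h (Uop y) - qcmp h (Uop y')) (Sop y) + app (qcmp h (Uop y')) (Sop (y - y')) := by
    ext1 x
    simp only [gop, app_apply, ContinuousMap.sub_apply, ContinuousMap.add_apply, Sop_sub, map_sub, sub_apply]; abel
  have eN : CN * η * D = 4 * (η * (CU * D) * (1 + 9 * CU + 18 * CU ^ 2) * CU) + 4 * (η * (1 + CU + 2 * CU ^ 2) * (CU * D)) := by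
    unfold CN; ring
  rw [e2, eN]
  constructor
  · refine (n2_add _ _).trans (add_le_add ((app_n2 z1 x1).trans ?_) ((app_n2 z2 x2).trans ?_))
    · exact le_mul_of_one_le_left (by positivity) (by norm_num)
    · exact le_mul_of_one_le_left (by positivity) (by norm_num)
  · intro j t
    rw [D2_add, add_mul]
    exact (n2_add _ _).trans (add_le_add (app_sec z1 x1 j t) (app_sec z2 x2 j t))

lemma gop_zero (h : QB Q Q' Q'' η) : gop h 0 = 0 := by
  have : Sop (0 : YY n) = 0 := by have := Sop_sub (0 : YY n) 0; rwa [sub_self, sub_self] at this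
  ext1 x; simp only [gop, app_apply, this]; simp

lemma gop_bd (h : QB Q Q' Q'' η) (y : YY n) (hy : ‖y‖ ≤ 1) :
    n2 (gop h y) ≤ CN * η ∧ ∀ j t, n2 (D2 j t (gop h y)) ≤ CN * η * t ^ 2 := by
  have hη : 0 ≤ η := (norm_nonneg _).trans (h.b1 0)
  have := CN_nonneg
  have h1 := gop_diff h y 0 hy (by simp)
  rw [gop_zero, sub_zero, sub_zero] at h1
  exact ⟨h1.1.trans (mul_le_of_le_one_right (by positivity) hy), fun j t => (h1.2 j t).trans (mul_le_mul_of_nonneg_right (mul_le_of_le_one_right (by positivity) hy) (sq_nonneg t))⟩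

open Classical in
def Psi (h : QB Q Q' Q'' η) (a v : Cn n) (c : HH n) : HH n :=
  if hm : Memℓp (fun k => (ww k : ℂ) • cf (gop h (a, v, c)) k) 2 then ⟨_, hm⟩ else 0

lemma Psi_apply (h : QB Q Q' Q'' η) (a v : Cn n) (c : HH n) (ha : ‖a‖ ≤ 1) (hv : ‖v‖ ≤ 1) (hc : ‖c‖ ≤ 1) (k : KK) :
    Psi h a v c k = (ww k : ℂ) • cf (gop h (a, v, c)) k := by
  have hb := gop_bd h (a, v, c) (by simp [Prod.norm_def, ha, hv, hc])
  have hm := memH _ _ hb.1 hb.2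
  unfold Psi
  rw [dif_pos hm]

lemma Psi_norm (h : QB Q Q' Q'' η) (a v : Cn n) (c : HH n) (ha : ‖a‖ ≤ 1) (hv : ‖v‖ ≤ 1) (hc : ‖c‖ ≤ 1) :
    ‖Psi h a v c‖ ≤ 3 * (CN * η) := by
  have hb := gop_bd h (a, v, c) (by simp [Prod.norm_def, ha, hv, hc])
  exact normH _ _ hb.1 hb.2 _ (Psi_apply h a v c ha hv hc)

lemma Psi_lip (h : QB Q Q' Q'' η) (a v : Cn n) (c c' : HH n) (ha : ‖a‖ ≤ 1) (hv : ‖v‖ ≤ 1) (hc : ‖c‖ ≤ 1) (hc' : ‖c'‖ ≤ 1) :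
    ‖Psi h a v c - Psi h a v c'‖ ≤ 3 * (CN * η * ‖c - c'‖) := by
  have hb := gop_diff h (a, v, c) (a, v, c') (by simp [Prod.norm_def, ha, hv, hc]) (by simp [Prod.norm_def, ha, hv, hc'])
  have e : ‖((a, v, c) : YY n) - (a, v, c')‖ = ‖c - c'‖ := by simp [Prod.norm_def]
  rw [e] at hb
  refine normH _ _ hb.1 hb.2 _ (fun k => ?_)
  rw [cf_sub, smul_sub, ← Psi_apply h a v c ha hv hc, ← Psi_apply h a v c' ha hv hc']
  rfl

lemma fixpt (h : QB Q Q' Q'' η) (hη : 3 * (CN * η) ≤ 1 / 2) (a v : Cn n) (ha : ‖a‖ ≤ 1) (hv : ‖v‖ ≤ 1) :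
    ∃ c : HH n, ‖c‖ ≤ 1 ∧ Psi h a v c = c := by
  have hmt : MapsTo (Psi h a v) (closedBall 0 1) (closedBall 0 1) := by
    intro c hc
    rw [mem_closedBall_zero_iff] at hc ⊢
    exact (Psi_norm h a v c ha hv hc).trans (hη.trans (by norm_num))
  have hcon : ContractingWith (1 / 2) (hmt.restrict (Psi h a v) _ _) := by
    refine ⟨by norm_num [← NNReal.coe_lt_coe], LipschitzWith.of_dist_le_mul (fun c c' => ?_)⟩
    rw [Subtype.dist_eq, Subtype.dist_eq, dist_eq_norm, dist_eq_norm]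
    have hc := c.2; have hc' := c'.2
    rw [mem_closedBall_zero_iff] at hc hc'
    refine (Psi_lip h a v c c' ha hv hc hc').trans ?_
    have := mul_le_mul_of_nonneg_right hη (norm_nonneg ((c : HH n) - c'))
    push_cast
    linarith
  obtain ⟨c, hc, hfix, -⟩ := ContractingWith.exists_fixedPoint' (isClosed_closedBall.isComplete) hmt hcon (x := 0) (by simp) (edist_ne_top _ _)
  exact ⟨c, by rwa [mem_closedBall_zero_iff] at hc, hfix⟩

lemma sol (h : QB Q Q' Q'' η) (hη : 3 * (CN * η) ≤ 1 / 2) (a v : Cn n) (ha : ‖a‖ ≤ 1) (hv : ‖v‖ ≤ 1) :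
    ∃ u s : ℂ → Cn n, u 0 = a ∧ s 0 = v ∧ (∀ z, ‖u z‖ ≤ CU) ∧ ∀ z ∈ Nb, HasFDerivAt u (Aop (s z) (Q (u z) (s z))) z := by
  obtain ⟨c, hc, hfix⟩ := fixpt h hη a v ha hv
  have hy : ‖((a, v, c) : YY n)‖ ≤ 1 := by simp [Prod.norm_def, ha, hv, hc]
  have hcf : ∀ k, cf (gop h (a, v, c)) k = m0 k • c k := by
    intro k
    conv_rhs => rw [← hfix]
    rw [Psi_apply h a v c ha hv hc, smul_smul]
    have : m0 k * (ww k : ℂ) = 1 := by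
      unfold m0; rw [← Complex.ofReal_mul, one_div, inv_mul_cancel₀ (ww_pos k).ne', Complex.ofReal_one]
    rw [this, one_smul]
  have hg : ∀ x, MV m0 m0B c x = gop h (a, v, c) x := by
    intro x
    have h1 := fourier_inv (gop h (a, v, c)) (by simpa only [hcf] using mulB_sum m0B c) x
    simp only [hcf] at h1
    exact (MV_hasSum m0 m0B c x).unique h1
  refine ⟨fun z => Uop (a, v, c) (tp z), fun z => Sop (a, v, c) (tp z), Uop_zero_pt _, Sop_zero_pt _, fun z => ?_, fun z hz => ?_⟩
  · have := CU_nonneg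
    exact ((Uop_Zb (a, v, c)).sup _).trans (mul_le_of_le_one_right this hy)
  · have := Uop_deriv (a, v, c) z hz
    rw [hg] at this
    exact this
end
end HP9

section HP10
open MeasureTheory UnitAddTorus
section
variable {E G : Type*} [NormedAddCommGroup E] [NormedSpace ℝ E] [NormedAddCommGroup G] [NormedSpace ℝ G]

lemma lip_of {Q : E → G} {Q' : E → E →L[ℝ] G} {η : ℝ} (hd : ∀ x, HasFDerivAt Q (Q' x) x) (hb : ∀ x, ‖Q' x‖ ≤ η) (a b : E) :
    ‖Q b - Q a‖ ≤ η * ‖b - a‖ :=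
  convex_univ.norm_image_sub_le_of_norm_hasFDerivWithin_le (fun x _ => (hd x).hasFDerivWithinAt) (fun x _ => hb x) (mem_univ a) (mem_univ b)

lemma taylor_of {Q : E → G} {Q' : E → E →L[ℝ] G} {η : ℝ} (hη : 0 ≤ η) (hd : ∀ x, HasFDerivAt Q (Q' x) x)
    (hl : ∀ a b, ‖Q' b - Q' a‖ ≤ η * ‖b - a‖) (a b : E) :
    ‖Q b - Q a - Q' a (b - a)‖ ≤ η * ‖b - a‖ ^ 2 := by
  have := (convex_closedBall a ‖b - a‖).norm_image_sub_le_of_norm_hasFDerivWithin_le' (f := Q) (f' := Q') (φ := Q' a) (C := η * ‖b - a‖) (x := a) (y := b)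
    (fun x _ => (hd x).hasFDerivWithinAt) (fun x hx => (hl a x).trans (by
      rw [mem_closedBall, dist_eq_norm] at hx; gcongr)) (by simp) (by simp [dist_eq_norm])
  rw [sq, ← mul_assoc]; exact this

lemma smul2_le {W : Type*} [NormedAddCommGroup W] [NormedSpace ℝ W] (ε : ℝ) (h0 : 0 < ε) (h1 : ε ≤ 1) (X : W) : ‖ε • ε • X‖ ≤ ε * ‖X‖ := by
  rw [norm_smul, norm_smul, Real.norm_eq_abs, abs_of_pos h0]
  gcongr
  exact mul_le_of_le_one_left (norm_nonneg _) h1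

lemma QB_of {Q : E → G} {Q' : E → E →L[ℝ] G} {Q'' : E → E →L[ℝ] E →L[ℝ] G} {η : ℝ}
    (hd0 : ∀ x, HasFDerivAt Q (Q' x) x) (hd1 : ∀ x, HasFDerivAt Q' (Q'' x) x)
    (b0 : ∀ x, ‖x‖ ≤ CU → ‖Q x‖ ≤ η) (b1 : ∀ x, ‖Q' x‖ ≤ η) (b2 : ∀ x, ‖Q'' x‖ ≤ η) (b3 : ∀ a b, ‖Q'' b - Q'' a‖ ≤ η * ‖b - a‖) :
    QB Q Q' Q'' η := by
  have hη : 0 ≤ η := (norm_nonneg _).trans (b1 0)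
  exact ⟨hd0, b0, b1, b2, lip_of hd0 b1, lip_of hd1 b2, taylor_of hη hd0 (lip_of hd1 b2), taylor_of hη hd1 b3⟩

lemma scale_deriv {P : E → G} {P' : E → E →L[ℝ] G} (hd : ∀ x, HasFDerivAt P (P' x) x) (c : ℝ) (x : E) :
    HasFDerivAt (fun x => P (c • x)) (c • P' (c • x)) x := by
  have h1 : HasFDerivAt (fun x : E => c • x) (c • ContinuousLinearMap.id ℝ E) x := (hasFDerivAt_id x).const_smul c
  have := (hd (c • x)).comp x h1
  refine this.congr_fderiv ?_
  ext y; simp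

lemma smooth_next {P : E → G} (hP : ContDiff ℝ (⊤ : ℕ∞) P) (hc : HasCompactSupport P) :
    ContDiff ℝ (⊤ : ℕ∞) (fderiv ℝ P) ∧ HasCompactSupport (fderiv ℝ P) ∧ (∀ x, HasFDerivAt P (fderiv ℝ P x) x) ∧ ∃ B, ∀ x, ‖fderiv ℝ P x‖ ≤ B := by
  have h1 : ContDiff ℝ (⊤ : ℕ∞) (fderiv ℝ P) := (contDiff_infty_iff_fderiv.1 hP).2
  have h2 := hc.fderiv (𝕜 := ℝ)
  exact ⟨h1, h2, fun x => (hP.differentiable (by simp) x).hasFDerivAt, h2.exists_bound_of_continuous h1.continuous⟩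

set_option maxSynthPendingDepth 3 in
lemma exists_QB [FiniteDimensional ℝ E] (Q : E → G) (r : ℝ) (hr : 0 < r) (hQ : ∀ x ∈ ball (0 : E) r, ContDiffAt ℝ (⊤ : ℕ∞) Q x) (hQ0 : Q 0 = 0)
    (η : ℝ) (hη : 0 < η) : ∃ ε : ℝ, 0 < ε ∧ ε * (CU + 1) < r ∧ ∃ Qe Q' Q'', QB Qe Q' Q'' η ∧ ∀ w, ‖w‖ ≤ CU → Qe w = Q (ε • w) := by
  let b : ContDiffBump (0 : E) := ⟨r / 3, r / 2, by linarith, by linarith⟩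
  let P : E → G := fun x => b x • Q x
  have hP : ContDiff ℝ (⊤ : ℕ∞) P := by
    rw [contDiff_iff_contDiffAt]
    intro x
    by_cases hx : x ∈ ball (0 : E) r
    · exact b.contDiffAt.smul (hQ x hx)
    · have : P =ᶠ[𝓝 x] fun _ => 0 := by
        have ho : IsOpen {z : E | r / 2 < ‖z‖} := isOpen_lt continuous_const continuous_norm
        rw [mem_ball_zero_iff, not_lt] at hx
        filter_upwards [ho.mem_nhds (show r / 2 < ‖x‖ by linarith)] with z hz
        have : b z = 0 := b.zero_of_le_dist (by rw [dist_zero_right]; exact le_of_lt hz)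
        simp [P, this]
      exact contDiffAt_const.congr_of_eventuallyEq this
  have hcP : HasCompactSupport P := b.hasCompactSupport.smul_right
  obtain ⟨s1, k1, d0, B1, hB1⟩ := smooth_next hP hcP
  obtain ⟨s2, k2, d1, B2, hB2⟩ := smooth_next s1 k1
  obtain ⟨s3, k3, d2, B3, hB3⟩ := smooth_next s2 k2
  have n1 : 0 ≤ B1 := (norm_nonneg _).trans (hB1 0)
  have n2 : 0 ≤ B2 := (norm_nonneg _).trans (hB2 0)
  have n3 : 0 ≤ B3 := (norm_nonneg _).trans (hB3 0)
  have hCU := CU_nonneg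
  set B := B1 + B2 + B3 + 1 with hB
  obtain ⟨ε, he0, he1, he2, he3⟩ : ∃ ε : ℝ, 0 < ε ∧ ε ≤ 1 ∧ ε * (CU + 1) < r / 3 ∧ ε * ((CU + 1) * B) ≤ η := by
    have hBp : 0 < (CU + 1) * B := by positivity
    refine ⟨min 1 (min (r / 3 / (CU + 1) / 2) (η / ((CU + 1) * B))), by positivity, min_le_left _ _, ?_, ?_⟩
    · have : min 1 (min (r / 3 / (CU + 1) / 2) (η / ((CU + 1) * B))) < r / 3 / (CU + 1) :=
        ((min_le_right _ _).trans (min_le_left _ _)).trans_lt (half_lt_self (by positivity))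
      rwa [lt_div_iff₀ (by positivity)] at this
    · rw [← le_div_iff₀ hBp]
      exact (min_le_right _ _).trans (min_le_right _ _)
  have hεB : ε * B ≤ η := le_trans (by gcongr; nlinarith) he3
  have hb : ∀ (B' : ℝ), 0 ≤ B' → B' ≤ B → ε * B' ≤ η := fun B' _ h => le_trans (by gcongr) hεB
  have l0 := lip_of d0 hB1
  refine ⟨ε, he0, by linarith, fun x => P (ε • x), fun x => ε • fderiv ℝ P (ε • x), fun x => ε • ε • fderiv ℝ (fderiv ℝ P) (ε • x),
    QB_of (fun x => scale_deriv d0 ε x) (fun x => (scale_deriv d1 ε x).const_smul ε)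
      ?_ ?_ ?_ ?_, ?_⟩
  · intro x hx
    have h1 := l0 0 (ε • x)
    have hP0 : P 0 = 0 := by simp [P, hQ0]
    have hnx : ‖ε • x‖ = ε * ‖x‖ := by rw [norm_smul, Real.norm_eq_abs, abs_of_pos he0]
    rw [hP0, sub_zero, sub_zero, hnx] at h1
    refine h1.trans (le_trans ?_ he3)
    have : B1 * (ε * ‖x‖) = ε * (‖x‖ * B1) := by ring
    rw [this]
    gcongr <;> linarith
  · intro x
    rw [norm_smul, Real.norm_eq_abs, abs_of_pos he0]
    refine le_trans ?_ (hb B1 n1 (by linarith))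
    gcongr; exact hB1 _
  · intro x
    refine (smul2_le ε he0 he1 _).trans (le_trans ?_ (hb B2 n2 (by linarith)))
    gcongr
    exact hB2 _
  · intro x y
    have hl := lip_of d2 hB3 (ε • x) (ε • y)
    rw [← smul_sub, ← smul_sub]
    have hnx : ‖ε • y - ε • x‖ = ε * ‖y - x‖ := by rw [← smul_sub, norm_smul, Real.norm_eq_abs, abs_of_pos he0]
    rw [hnx] at hl
    refine (smul2_le ε he0 he1 _).trans ?_
    have h3 := hb B3 n3 (by linarith)
    calc _ ≤ ε * (B3 * (ε * ‖y - x‖)) := by gcongr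
      _ = ε * ((ε * B3) * ‖y - x‖) := by ring
      _ ≤ 1 * (η * ‖y - x‖) := by gcongr
      _ = _ := one_mul _
  · intro w hw
    have : b (ε • w) = 1 := b.one_of_mem_closedBall (by
      rw [mem_closedBall, dist_zero_right, norm_smul, Real.norm_eq_abs, abs_of_pos he0]
      change _ ≤ r / 3
      nlinarith)
    simp [P, this]
end
end HP10

section HP11
open MeasureTheory UnitAddTorus
section
set_option maxSynthPendingDepth 3
variable {n : ℕ}
def Im (n : ℕ) : Cn n →L[ℝ] Cn n := (Complex.I • ContinuousLinearMap.id ℂ (Cn n)).restrictScalars ℝ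
lemma Im_apply (x : Cn n) : Im n x = Complex.I • x := rfl
lemma Im_sq : Im n * Im n = -1 := by
  ext x : 1
  change Complex.I • Complex.I • x = -x
  rw [smul_smul, Complex.I_mul_I, neg_one_smul]

lemma I_I (x : Cn n) : Complex.I • Complex.I • x = -x := by
  rw [smul_smul, Complex.I_mul_I, neg_one_smul]

lemma T_form (ξ : ℂ) (s q : Cn n) : ξ • s + (starRingEnd ℂ) ξ • q = ξ.re • (s + q) + ξ.im • (Complex.I • s - Complex.I • q) := by
  ext i
  simp only [PiLp.add_apply, PiLp.smul_apply, PiLp.sub_apply, smul_eq_mul, Complex.real_smul]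
  apply Complex.ext <;> simp <;> ring

lemma hol_alg (Jx : Cn n →L[ℝ] Cn n) (hJ : ∀ y, Jx (Jx y) = -y) (s q : Cn n) (h : Jx (s + q) = Complex.I • s - Complex.I • q) (ξ : ℂ) :
    (Complex.I * ξ) • s + (starRingEnd ℂ) (Complex.I * ξ) • q = Jx (ξ • s + (starRingEnd ℂ) ξ • q) := by
  rw [T_form, T_form ξ, map_add, map_smul, map_smul, h, ← h, hJ, h]
  simp
  abel

lemma q_alg (Jx M Mi : Cn n →L[ℝ] Cn n) (hM : M = 1 - Jx * Im n) (hJ : ∀ y, Jx (Jx y) = -y) (h1 : M * Mi = 1) (s q : Cn n)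
    (hq : q = (-(Mi * (1 + Jx * Im n))) s) : Jx (s + q) = Complex.I • s - Complex.I • q := by
  have e : M q = - (s + Jx (Im n s)) := by
    have : M * (-(Mi * (1 + Jx * Im n))) = - (1 + Jx * Im n) := by rw [mul_neg, ← mul_assoc, h1, one_mul]
    rw [hq]
    change (M * (-(Mi * (1 + Jx * Im n)))) s = _
    rw [this]; rfl
  rw [hM] at e
  change q - Jx (Im n q) = _ at e
  have e2 : s + q = Jx (Im n q - Im n s) := by
    rw [map_sub, ← sub_eq_zero]
    have := sub_eq_zero.2 e
    rw [← this]; abel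
  rw [e2, hJ, Im_apply, Im_apply]; abel

lemma v_alg (Jx M Mi : Cn n →L[ℝ] Cn n) (hM : M = 1 - Jx * Im n) (hJ : ∀ y, Jx (Jx y) = -y) (h1 : Mi * M = 1) (w v : Cn n)
    (hv : v = (2⁻¹ : ℝ) • (w - Im n (Jx w))) : v + (-(Mi * (1 + Jx * Im n))) v = w := by
  have e : M (w - v) = - ((1 + Jx * Im n) v) := by
    have hh : w - v = (2⁻¹ : ℝ) • (w + Im n (Jx w)) := by
      rw [hv]; module
    rw [hh, hM, hv]
    change (2⁻¹ : ℝ) • (w + Im n (Jx w)) - Jx (Im n ((2⁻¹ : ℝ) • (w + Im n (Jx w)))) = - ((2⁻¹ : ℝ) • (w - Im n (Jx w)) + Jx (Im n ((2⁻¹ : ℝ) • (w - Im n (Jx w)))))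
    have hi : ∀ y, Im n (Im n y) = - y := fun y => by rw [Im_apply, Im_apply, I_I]
    simp only [map_smul, map_add, map_sub, hi, map_neg, hJ]
    module
  have : Mi (M (w - v)) = w - v := by
    change (Mi * M) (w - v) = _
    rw [h1]; rfl
  have h2 : (-(Mi * (1 + Jx * Im n))) v = w - v := by
    change - Mi ((1 + Jx * Im n) v) = _
    rw [← map_neg, ← e, this]
  rw [h2]; abel

lemma discA (Jh : Cn n → Cn n →L[ℝ] Cn n) (r0 : ℝ) (hr0 : 0 < r0) (hs : ∀ x ∈ ball (0 : Cn n) r0, ContDiffAt ℝ (⊤ : ℕ∞) Jh x)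
    (hJ : ∀ x ∈ ball (0 : Cn n) r0, ∀ y, Jh x (Jh x y) = -y) (h0 : Jh 0 = Im n) :
    ∃ ρ δ : ℝ, 0 < ρ ∧ 0 < δ ∧ ∀ a, ‖a‖ < ρ → ∀ V : Cn n, ‖V‖ ≤ 1 → ∃ f : ℂ → Cn n, f 0 = a ∧
      (∀ z ∈ ball (0 : ℂ) 1, f z ∈ ball (0 : Cn n) r0 ∧ DifferentiableAt ℝ f z ∧ ∀ ξ, fderiv ℝ f z (Complex.I * ξ) = Jh (f z) (fderiv ℝ f z ξ)) ∧
      fderiv ℝ f 0 1 = δ • V := by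
  let M : Cn n → (Cn n →L[ℝ] Cn n) := fun x => 1 - Jh x * Im n
  let Q : Cn n → (Cn n →L[ℝ] Cn n) := fun x => -(Ring.inverse (M x) * (1 + Jh x * Im n))
  have hz : (0 : Cn n) ∈ ball (0 : Cn n) r0 := mem_ball_self hr0
  have hJI : ∀ x ∈ ball (0 : Cn n) r0, ContDiffAt ℝ (⊤ : ℕ∞) (fun x => Jh x * Im n) x := fun x hx => (hs x hx).mul contDiffAt_const
  have hMs : ∀ x ∈ ball (0 : Cn n) r0, ContDiffAt ℝ (⊤ : ℕ∞) M x := fun x hx => contDiffAt_const.sub (hJI x hx)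
  have hM0 : IsUnit (M 0) := by
    have : M 0 = (2 : ℝ) • 1 := by
      simp only [M, h0, Im_sq]
      rw [two_smul]; abel
    rw [this]
    exact (isUnit_one.smul (Units.mk0 (2 : ℝ) two_ne_zero))
  obtain ⟨r1, hr1, hr10, hr1M, hr1B⟩ : ∃ r1 > 0, r1 ≤ r0 ∧ (∀ x ∈ ball (0 : Cn n) r1, IsUnit (M x)) ∧ (∀ x ∈ ball (0 : Cn n) r1, ‖Jh x‖ < ‖Jh 0‖ + 1) := by
    have e1 : ∀ᶠ x in 𝓝 (0 : Cn n), IsUnit (M x) := (hMs 0 hz).continuousAt.eventually (Units.isOpen.mem_nhds hM0)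
    have e2 : ∀ᶠ x in 𝓝 (0 : Cn n), ‖Jh x‖ < ‖Jh 0‖ + 1 := (hs 0 hz).continuousAt.norm.eventually_lt_const (by linarith)
    obtain ⟨r, hr, h⟩ := Metric.eventually_nhds_iff_ball.1 (e1.and e2)
    exact ⟨min r r0, by positivity, min_le_right _ _, fun x hx => (h x (ball_subset_ball (min_le_left _ _) hx)).1, fun x hx => (h x (ball_subset_ball (min_le_left _ _) hx)).2⟩
  have hsub := ball_subset_ball (x := (0 : Cn n)) hr10
  have hQs : ∀ x ∈ ball (0 : Cn n) r1, ContDiffAt ℝ (⊤ : ℕ∞) Q x := by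
    intro x hx
    obtain ⟨U, hU⟩ := hr1M x hx
    have hi : ContDiffAt ℝ (⊤ : ℕ∞) Ring.inverse (M x) := by rw [← hU]; exact contDiffAt_ringInverse ℝ U
    exact ((hi.comp x (hMs x (hsub hx))).mul (contDiffAt_const.add (hJI x (hsub hx)))).neg
  have hQ0 : Q 0 = 0 := by
    simp only [Q, h0, Im_sq]
    simp
  have hCN := CN_nonneg
  obtain ⟨ε, he0, he1, Qe, Q', Q'', hQB, hQe⟩ := exists_QB Q r1 hr1 hQs hQ0 (1 / (6 * (CN + 1))) (by positivity)
  have hη : 3 * (CN * (1 / (6 * (CN + 1)))) ≤ 1 / 2 := by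
    rw [mul_one_div, ← mul_div_assoc, div_le_div_iff₀ (by positivity) (by positivity)]; linarith
  have hCU := CU_nonneg
  set B := ‖Jh 0‖ + 1 with hB
  have hBp : 0 < B := by positivity
  refine ⟨ε, ε / 16 * (1 / (1 + B)), he0, by positivity, fun a ha V hV => ?_⟩
  have ha1 : a ∈ ball (0 : Cn n) r1 := by
    rw [mem_ball_zero_iff]; nlinarith
  set w : Cn n := (1 / (1 + B)) • V with hw
  have hwn : ‖w‖ ≤ 1 / (1 + B) := by
    rw [hw, norm_smul, Real.norm_eq_abs, abs_of_pos (by positivity)]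
    exact mul_le_of_le_one_right (by positivity) hV
  set v : Cn n := (2⁻¹ : ℝ) • (w - Im n (Jh a w)) with hv
  have hvn : ‖v‖ ≤ 1 := by
    rw [hv, norm_smul]
    have h2 : ‖Im n (Jh a w)‖ ≤ B * (1 / (1 + B)) := by
      rw [Im_apply, norm_smul, Complex.norm_I, one_mul]
      refine (Jh a).le_opNorm_of_le hwn |>.trans ?_
      gcongr
      exact (hr1B a ha1).le
    have h3 := norm_sub_le w (Im n (Jh a w))
    have h4 : 1 / (1 + B) + B * (1 / (1 + B)) = 1 := by field_simp
    norm_num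
    linarith
  have hea : ‖ε⁻¹ • a‖ ≤ 1 := by
    rw [norm_smul, Real.norm_eq_abs, abs_of_pos (by positivity), inv_mul_le_iff₀ he0]; linarith
  obtain ⟨u, s, hu0, hs0, hub, hud⟩ := sol hQB hη (ε⁻¹ • a) v hea hvn
  have hea2 : ε • ε⁻¹ • a = a := by rw [smul_smul, mul_inv_cancel₀ he0.ne', one_smul]
  have hin : ∀ z, ε • u z ∈ ball (0 : Cn n) r1 := fun z => by
    rw [mem_ball_zero_iff, norm_smul, Real.norm_eq_abs, abs_of_pos he0]
    have := hub z
    nlinarith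
  have hder : ∀ z ∈ ball (0 : ℂ) 1, HasFDerivAt (fun z : ℂ => ε • u ((16⁻¹ : ℝ) • z))
      (ε • (16⁻¹ : ℝ) • Aop (s ((16⁻¹ : ℝ) • z)) (Q (ε • u ((16⁻¹ : ℝ) • z)) (s ((16⁻¹ : ℝ) • z)))) z := by
    intro z hz
    have hN : (16⁻¹ : ℝ) • z ∈ Nb := by
      rw [mem_ball_zero_iff] at hz
      have h1 := (Complex.abs_re_le_norm z)
      have h2 := (Complex.abs_im_le_norm z)
      constructor
      · rw [Complex.smul_re, smul_eq_mul, abs_mul, abs_of_pos (by norm_num)]; linarith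
      · rw [Complex.smul_im, smul_eq_mul, abs_mul, abs_of_pos (by norm_num)]; linarith
    have h1 : HasFDerivAt (fun x : ℂ => (16⁻¹ : ℝ) • x) ((16⁻¹ : ℝ) • ContinuousLinearMap.id ℝ ℂ) z := (hasFDerivAt_id (𝕜 := ℝ) z).const_smul (16⁻¹ : ℝ)
    have h2 := ((hud _ hN).comp z h1).const_smul ε
    rw [hQe _ (hub _)] at h2
    refine h2.congr_fderiv ?_
    ext y
    simp
  refine ⟨fun z => ε • u ((16⁻¹ : ℝ) • z), by simp [hu0, hea2], fun z hz => ⟨hsub (hin _), (hder z hz).differentiableAt, fun ξ => ?_⟩, ?_⟩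
  · rw [(hder z hz).fderiv]
    set z' := (16⁻¹ : ℝ) • z
    change ε • (16⁻¹ : ℝ) • (Aop _ _) _ = Jh (ε • u z') (ε • (16⁻¹ : ℝ) • (Aop _ _) _)
    rw [map_smul, map_smul, Aop_apply, Aop_apply]
    congr 2
    have hm := hr1M _ (hin z')
    exact hol_alg _ (hJ _ (hsub (hin z'))) _ _ (q_alg _ (M _) _ rfl (hJ _ (hsub (hin z'))) (Ring.mul_inverse_cancel _ hm) _ _ rfl) ξ
  · rw [(hder 0 (by simp)).fderiv]
    rw [_root_.smul_apply, _root_.smul_apply, Aop_apply, smul_zero, hu0, hs0, hea2, map_one, one_smul, one_smul]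
    have := v_alg (Jh a) (M a) _ rfl (hJ a (hsub ha1)) (Ring.inverse_mul_cancel _ (hr1M a ha1)) w v rfl
    rw [show v + (Q a) v = w from this, hw, smul_smul, smul_smul]
    congr 1
end
end HP11

section HP12
open MeasureTheory UnitAddTorus
section
lemma exists_L {W V : Type*} [AddCommGroup W] [Module ℝ W] [FiniteDimensional ℝ W] [AddCommGroup V] [Module ℂ V] [Module ℝ V] [IsScalarTower ℝ ℂ V] [FiniteDimensional ℂ V]
    (hdim : Module.finrank ℝ W = Module.finrank ℝ V) (A : Module.End ℝ W) (hA : A * A = -1) : ∃ L : W ≃ₗ[ℝ] V, ∀ x, L (A x) = Complex.I • L x := by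
  let φ : ℂ →ₐ[ℝ] Module.End ℝ W := Complex.lift ⟨A, hA⟩
  letI : Module ℂ W := Module.compHom W (φ : ℂ →+* Module.End ℝ W)
  have hsm : ∀ (c : ℂ) (x : W), c • x = φ c x := fun _ _ => rfl
  have hI : ∀ x : W, Complex.I • x = A x := fun x => by rw [hsm]; simp [φ]
  haveI : IsScalarTower ℝ ℂ W := ⟨fun r c x => by rw [hsm, hsm, map_smul]; rfl⟩
  haveI : FiniteDimensional ℂ W := FiniteDimensional.right ℝ ℂ W
  have h1 := Module.finrank_mul_finrank ℝ ℂ W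
  have h2 := Module.finrank_mul_finrank ℝ ℂ V
  have h3 : Module.finrank ℂ W = Module.finrank ℂ V := by
    rw [← h1, ← h2, Complex.finrank_real_complex] at hdim
    omega
  let L := LinearEquiv.ofFinrankEq W V h3
  refine ⟨L.restrictScalars ℝ, fun x => ?_⟩
  rw [← hI]
  exact L.map_smul _ _

variable {n : ℕ}
lemma exists_L' (A : Cn n →L[ℝ] Cn n) (hA : A.comp A = -ContinuousLinearMap.id ℝ (Cn n)) : ∃ L : Cn n ≃L[ℝ] Cn n, ∀ x, L (A x) = Complex.I • L x := by
  obtain ⟨L, hL⟩ := exists_L (W := Cn n) (V := Cn n) rfl (A : Cn n →ₗ[ℝ] Cn n) (by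
    ext x : 1
    exact congrArg (fun f : Cn n →L[ℝ] Cn n => f x) hA)
  exact ⟨L.toContinuousLinearEquiv, hL⟩
end
end HP12

section HP13
open MeasureTheory UnitAddTorus
section
open MeasureTheory UnitAddTorus
set_option maxSynthPendingDepth 3
variable {n : ℕ}
lemma discs {Ω : Set (Cn n)} (hΩ : IsOpen Ω) {J : Cn n → (Cn n →L[ℝ] Cn n)} (hJ : IsAlmostComplexOn n Ω J) {p : Cn n} (hp : p ∈ Ω) :
    ∃ ρ δ : ℝ, 0 < ρ ∧ 0 < δ ∧ ∀ p' ∈ ball p ρ, ∀ V : Cn n, ‖V‖ ≤ 1 → ∃ f, IsJHolomorphicOn n Ω J 1 f ∧ f 0 = p' ∧ fderiv ℝ f 0 1 = δ • V := by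
  obtain ⟨L, hL⟩ := exists_L' (J p) (hJ.2 p hp)
  let g : Cn n → Cn n := fun w => p + L.symm w
  have hg : ContDiff ℝ (⊤ : ℕ∞) g := contDiff_const.add L.symm.contDiff
  have hg0 : g 0 = p := by simp [g]
  let Jh : Cn n → Cn n →L[ℝ] Cn n := fun w => (L : Cn n →L[ℝ] Cn n).comp ((J (g w)).comp (L.symm : Cn n →L[ℝ] Cn n))
  have hJhap : ∀ w x, Jh w x = L (J (g w) (L.symm x)) := fun _ _ => rfl
  obtain ⟨r0, hr0, hsub⟩ : ∃ r0 > 0, ∀ w ∈ ball (0 : Cn n) r0, g w ∈ Ω :=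
    Metric.eventually_nhds_iff_ball.1 (hg.continuous.continuousAt.eventually (hΩ.mem_nhds (by rw [hg0]; exact hp)))
  obtain ⟨ρ, δ, hρ, hδ, H⟩ := discA Jh r0 hr0 (fun x hx => by
      have h1 : ContDiffAt ℝ (⊤ : ℕ∞) J (g x) := hJ.1.contDiffAt (hΩ.mem_nhds (hsub x hx))
      have h2 : ContDiffAt ℝ (⊤ : ℕ∞) (fun w => J (g w)) x := h1.comp x hg.contDiffAt
      exact contDiffAt_const.clm_comp (h2.clm_comp contDiffAt_const))
    (fun x hx y => by
      have := congrArg (fun f : Cn n →L[ℝ] Cn n => f (L.symm y)) (hJ.2 _ (hsub x hx))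
      change J (g x) (J (g x) (L.symm y)) = - (L.symm y) at this
      rw [hJhap, hJhap, L.symm_apply_apply, this, map_neg, L.apply_symm_apply])
    (by
      ext x : 1
      rw [hJhap, hg0, hL, L.apply_symm_apply]; rfl)
  set N := ‖(L : Cn n →L[ℝ] Cn n)‖ + 1 with hN
  have hNp : 0 < N := by positivity
  have hLN : ∀ x, ‖L x‖ ≤ N * ‖x‖ := fun x => ((L : Cn n →L[ℝ] Cn n).le_opNorm x).trans (by gcongr; linarith)
  refine ⟨ρ / N, δ / N, by positivity, by positivity, fun p' hp' V hV => ?_⟩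
  obtain ⟨f, f0, hf, hfd⟩ := H (L (p' - p)) (by
    rw [mem_ball, dist_eq_norm, lt_div_iff₀ hNp] at hp'
    exact (hLN _).trans_lt (by linarith)) (N⁻¹ • L V) (by
    rw [norm_smul, Real.norm_eq_abs, abs_of_pos (by positivity), inv_mul_le_iff₀ hNp]
    exact (hLN _).trans (by gcongr))
  have hd : ∀ z ∈ ball (0 : ℂ) 1, HasFDerivAt (fun z => g (f z)) ((L.symm : Cn n →L[ℝ] Cn n).comp (fderiv ℝ f z)) z := fun z hz =>
    ((L.symm : Cn n →L[ℝ] Cn n).hasFDerivAt.comp z (hf z hz).2.1.hasFDerivAt).const_add p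
  refine ⟨fun z => g (f z), ⟨fun z hz => hsub _ (hf z hz).1, fun z hz => ⟨(hd z hz).differentiableAt, fun ξ => ?_⟩⟩, ?_, ?_⟩
  · rw [(hd z hz).fderiv]
    change L.symm (fderiv ℝ f z _) = J (g (f z)) (L.symm (fderiv ℝ f z ξ))
    rw [(hf z hz).2.2, hJhap, L.symm_apply_apply]
  · simp [g, f0]
  · rw [(hd 0 (by simp)).fderiv]
    change L.symm (fderiv ℝ f 0 1) = _
    rw [hfd, map_smul, map_smul, L.symm_apply_apply, smul_smul]; rfl

lemma F_bound {Ω : Set (Cn n)} (hΩ : IsOpen Ω) {J : Cn n → (Cn n →L[ℝ] Cn n)} (hJ : IsAlmostComplexOn n Ω J) {p : Cn n} (hp : p ∈ Ω) :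
    ∃ ρ : ℝ, ∃ C : ℝ≥0∞, 0 < ρ ∧ C < ⊤ ∧ ball p ρ ⊆ Ω ∧ ∀ p' ∈ ball p ρ, ∀ V : Cn n, ‖V‖ ≤ 1 → kobayashiRoyden n Ω J p' V ≤ C := by
  obtain ⟨ρ, δ, h1, h2, H⟩ := discs hΩ hJ hp
  refine ⟨ρ, ENNReal.ofReal (1 / δ), h1, ENNReal.ofReal_lt_top, fun p' hp' => ?_, fun p' hp' V hV => sInf_le ⟨δ, h2, H p' hp' V hV, rfl⟩⟩
  obtain ⟨f, hf, f0, _⟩ := H p' hp' 0 (by simp)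
  rw [← f0]; exact hf.1 (by simp)
end
end HP13

section HP14
open MeasureTheory UnitAddTorus
section
open MeasureTheory UnitAddTorus
variable {n : ℕ} {Ω : Set (Cn n)} {J : Cn n → (Cn n →L[ℝ] Cn n)}

lemma F_zero {p : Cn n} (hp : p ∈ Ω) : kobayashiRoyden n Ω J p 0 = 0 := by
  have h : ∀ r : ℝ, 0 < r → kobayashiRoyden n Ω J p 0 ≤ ENNReal.ofReal (1 / r) := fun r hr =>
    sInf_le ⟨r, hr, ⟨fun _ => p, ⟨fun _ _ => hp, fun z _ => ⟨differentiableAt_const p, fun ξ => by simp⟩⟩, rfl, by simp⟩, rfl⟩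
  refine le_antisymm (ENNReal.le_of_forall_pos_le_add fun ε hε _ => ?_) bot_le
  rw [zero_add]
  have := h (1 / ε) (by positivity)
  simpa using this

lemma F_smul (p v : Cn n) (c : ℝ) (hc : 0 < c) : kobayashiRoyden n Ω J p (c • v) ≤ ENNReal.ofReal c * kobayashiRoyden n Ω J p v := by
  have h0 : ENNReal.ofReal c ≠ 0 := by simpa using hc
  rw [mul_comm, ← ENNReal.div_le_iff h0 ENNReal.ofReal_ne_top]
  refine le_sInf ?_
  rintro _ ⟨r, hr, ⟨f, hf, f0, fd⟩, rfl⟩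
  rw [ENNReal.div_le_iff h0 ENNReal.ofReal_ne_top, ← ENNReal.ofReal_mul (by positivity)]
  refine sInf_le ⟨r / c, by positivity, ⟨f, hf, f0, ?_⟩, ?_⟩
  · rw [fd, smul_smul]; congr 1; field_simp
  · congr 1; field_simp

lemma F_neg (p v : Cn n) : kobayashiRoyden n Ω J p (-v) ≤ kobayashiRoyden n Ω J p v := by
  refine le_sInf ?_
  rintro _ ⟨r, hr, ⟨f, hf, f0, fd⟩, rfl⟩
  have hm : ∀ z : ℂ, z ∈ ball (0 : ℂ) 1 → -z ∈ ball (0 : ℂ) 1 := fun z hz => by simpa using hz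
  have hd : ∀ z ∈ ball (0 : ℂ) 1, HasFDerivAt (fun z => f (-z)) (-(fderiv ℝ f (-z))) z := fun z hz => by
    have := (hf.2 (-z) (hm z hz)).1.hasFDerivAt.comp z (hasFDerivAt_id (𝕜 := ℝ) z).neg
    refine this.congr_fderiv ?_
    ext y; simp
  refine sInf_le ⟨r, hr, ⟨fun z => f (-z), ⟨fun z hz => hf.1 (hm z hz), fun z hz => ⟨(hd z hz).differentiableAt, fun ξ => ?_⟩⟩, by simpa using f0, ?_⟩, rfl⟩
  · rw [(hd z hz).fderiv]
    change -(fderiv ℝ f (-z) _) = J (f (-z)) (-(fderiv ℝ f (-z) ξ))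
    rw [(hf.2 (-z) (hm z hz)).2, map_neg]
  · rw [(hd 0 (by simp)).fderiv]
    change -(fderiv ℝ f (-0) 1) = _
    rw [neg_zero, fd, smul_neg]

lemma F_smul' (p v : Cn n) (c : ℝ) (hc : c ≠ 0) : kobayashiRoyden n Ω J p (c • v) ≤ ENNReal.ofReal |c| * kobayashiRoyden n Ω J p v := by
  rcases lt_or_gt_of_ne hc with h | h
  · rw [abs_of_neg h]
    refine le_trans ?_ (F_smul p v (-c) (by linarith))
    have := F_neg (Ω := Ω) (J := J) p ((-c) • v)
    rw [neg_smul, neg_neg] at this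
    rwa [neg_smul]
  · rw [abs_of_pos h]; exact F_smul p v c h

lemma len_aff (η γ : ℝ → Cn n) (a b c d : ℝ) (hc : c ≠ 0) (S : Set ℝ) (h : ∀ t ∈ Ioo a b, η t = γ (c * t + d)) (hS : ∀ t ∈ Ioo a b, c * t + d ∈ S) :
    ∫⁻ t in Icc a b, kobayashiRoyden n Ω J (η t) (deriv η t) ≤ ∫⁻ t in S, kobayashiRoyden n Ω J (γ t) (deriv γ t) := by
  rw [← setLIntegral_congr (Ioo_ae_eq_Icc (μ := volume) (a := a) (b := b))]
  have hsub : (fun t => c * t + d) '' Ioo a b ⊆ S := by rintro _ ⟨t, ht, rfl⟩; exact hS t ht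
  refine le_trans ?_ (lintegral_mono_set hsub)
  rw [lintegral_image_eq_lintegral_abs_deriv_mul (f' := fun _ => c) measurableSet_Ioo]
  · refine setLIntegral_mono' measurableSet_Ioo fun t ht => ?_
    have he : η =ᶠ[𝓝 t] fun t => γ (c * t + d) := by
      filter_upwards [isOpen_Ioo.mem_nhds ht] with s hs using h s hs
    have hd : deriv η t = c • deriv γ (c * t + d) := by
      rw [he.deriv_eq, deriv_comp_mul_left c (fun s => γ (s + d)) t, deriv_comp_add_const]
    rw [hd, h t ht]
    exact F_smul' _ _ c hc
  · intro x _
    have := ((hasDerivAt_id x).const_mul c).add_const d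
    simp only [mul_one] at this
    exact this.hasDerivWithinAt
  · intro x _ y _ hxy
    have : c * x = c * y := by simpa using hxy
    exact mul_left_cancel₀ hc this

inductive PW (γ : ℝ → Cn n) : ℝ → ℝ → Prop
  | single (a b : ℝ) : a < b → ContDiffOn ℝ 1 γ (Icc a b) → PW γ a b
  | cons (a b c : ℝ) : a < b → ContDiffOn ℝ 1 γ (Icc a b) → PW γ b c → PW γ a c

lemma PW.lt {γ : ℝ → Cn n} {a b : ℝ} (h : PW γ a b) : a < b := by
  induction h with
  | single a b h _ => exact h
  | cons a b c h _ _ ih => exact h.trans ih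

lemma PW.trans {γ : ℝ → Cn n} {a b c : ℝ} (h : PW γ a b) (h2 : PW γ b c) : PW γ a c := by
  induction h with
  | single a b h hc => exact PW.cons a b c h hc h2
  | cons a b _ h hc _ ih => exact PW.cons a b c h hc (ih h2)

lemma PW.cont {γ : ℝ → Cn n} {a b : ℝ} (h : PW γ a b) : ContinuousOn γ (Icc a b) := by
  induction h with
  | single a b h hc => exact hc.continuousOn
  | cons a b c h hc h2 ih =>
    rw [← Icc_union_Icc_eq_Icc h.le h2.lt.le]
    exact hc.continuousOn.union_of_isClosed ih isClosed_Icc isClosed_Icc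

lemma PW.congr {γ η : ℝ → Cn n} {a b : ℝ} (h : PW γ a b) (he : ∀ t ∈ Icc a b, η t = γ t) : PW η a b := by
  induction h with
  | single a b h hc => exact PW.single a b h (hc.congr he)
  | cons a b c h hc h2 ih =>
    exact PW.cons a b c h (hc.congr fun t ht => he t ⟨ht.1, ht.2.trans h2.lt.le⟩) (ih fun t ht => he t ⟨h.le.trans ht.1, ht.2⟩)

lemma aff_cd (c d : ℝ) (s : Set ℝ) : ContDiffOn ℝ 1 (fun t : ℝ => c * t + d) s := by fun_prop

lemma PW.aff {γ : ℝ → Cn n} {a b : ℝ} (h : PW γ a b) (c d : ℝ) (hc : 0 < c) : PW (fun t => γ (c * t + d)) ((a - d) / c) ((b - d) / c) := by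
  have key : ∀ a b : ℝ, ContDiffOn ℝ 1 γ (Icc a b) → ContDiffOn ℝ 1 (fun t => γ (c * t + d)) (Icc ((a - d) / c) ((b - d) / c)) := by
    intro a b h
    refine h.comp (aff_cd c d _) fun t ht => ?_
    rw [mem_Icc, div_le_iff₀ hc, le_div_iff₀ hc] at ht
    constructor <;> linarith [ht.1, ht.2]
  induction h with
  | single a b h hd => exact PW.single _ _ (by gcongr) (key a b hd)
  | cons a b e h hd h2 ih => exact PW.cons _ _ _ (by gcongr) (key a b hd) ih

lemma PW.rev {γ : ℝ → Cn n} {a b : ℝ} (h : PW γ a b) : PW (fun t => γ (-1 * t + 1)) (1 - b) (1 - a) := by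
  have key : ∀ a b : ℝ, ContDiffOn ℝ 1 γ (Icc a b) → ContDiffOn ℝ 1 (fun t => γ (-1 * t + 1)) (Icc (1 - b) (1 - a)) := by
    intro a b h
    refine h.comp (aff_cd (-1) 1 _) fun t ht => ?_
    constructor <;> linarith [ht.1, ht.2]
  induction h with
  | single a b h hd => exact PW.single _ _ (by linarith) (key a b hd)
  | cons a b e h hd h2 ih => exact ih.trans (PW.single _ _ (by linarith) (key a b hd))

lemma PW.of_part {γ : ℝ → Cn n} : ∀ (k : ℕ) (t : Fin (k + 2) → ℝ), StrictMono t → (∀ i : Fin (k + 1), ContDiffOn ℝ 1 γ (Icc (t i.castSucc) (t i.succ))) → PW γ (t 0) (t (Fin.last _))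
  | 0, t, ht, h => PW.single _ _ (ht (by simp)) (h 0)
  | k + 1, t, ht, h => by
    have := PW.of_part k (fun i => t i.succ) (fun i j hij => ht (by simpa using hij)) (fun i => h i.succ)
    exact PW.cons _ (t 1) _ (ht (by simp)) (h 0) this

lemma PW.to_part {γ : ℝ → Cn n} {a b : ℝ} (h : PW γ a b) : ∃ (k : ℕ) (t : Fin (k + 1) → ℝ), StrictMono t ∧ t 0 = a ∧ t (Fin.last k) = b ∧
      ∀ i : Fin k, ContDiffOn ℝ 1 γ (Icc (t i.castSucc) (t i.succ)) := by
  induction h with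
  | single a b h hc =>
    refine ⟨1, ![a, b], ?_, rfl, rfl, ?_⟩
    · rw [Fin.strictMono_iff_lt_succ]; intro i; fin_cases i; simpa using h
    · intro i; fin_cases i; simpa using hc
  | cons a b c h hc h2 ih =>
    obtain ⟨k, t, ht, t0, tl, hh⟩ := ih
    refine ⟨k + 1, Fin.cons a t, ?_, rfl, ?_, ?_⟩
    · rw [Fin.strictMono_iff_lt_succ] at ht ⊢
      intro i
      refine Fin.cases ?_ (fun j => ?_) i
      · simpa [t0] using h
      · rw [← Fin.succ_castSucc, Fin.cons_succ, Fin.cons_succ]; exact ht j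
    · rw [← Fin.succ_last, Fin.cons_succ, tl]
    · intro i
      refine Fin.cases ?_ (fun j => ?_) i
      · simpa [t0] using hc
      · rw [← Fin.succ_castSucc, Fin.cons_succ, Fin.cons_succ]; exact hh j

lemma path_iff {γ : ℝ → Cn n} : IsPiecewiseC1PathIn n Ω γ ↔ PW γ 0 1 ∧ MapsTo γ (Icc 0 1) Ω := by
  constructor
  · rintro ⟨_, h2, k, t, ht, t0, t1, h⟩
    refine ⟨?_, h2⟩
    rcases k with _ | k
    · have : t 0 = t (Fin.last 0) := rfl
      rw [t0, t1] at this; norm_num at this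
    · have := PW.of_part k t ht h
      rwa [t0, t1] at this
  · rintro ⟨h1, h2⟩
    exact ⟨h1.cont, h2, h1.to_part⟩

lemma d_le {p q : Cn n} {γ : ℝ → Cn n} (h : PW γ 0 1) (hm : MapsTo γ (Icc 0 1) Ω) (h0 : γ 0 = p) (h1 : γ 1 = q) :
    integratedKRDist n Ω J p q ≤ kobayashiRoydenLength n Ω J γ :=
  iInf_le (fun γ : {γ : ℝ → Cn n // IsPiecewiseC1PathIn n Ω γ ∧ γ 0 = p ∧ γ 1 = q} => kobayashiRoydenLength n Ω J γ) ⟨γ, path_iff.2 ⟨h, hm⟩, h0, h1⟩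

lemma d_self {p : Cn n} (hp : p ∈ Ω) : integratedKRDist n Ω J p p = 0 := by
  refine le_antisymm ((d_le (γ := fun _ => p) (PW.single _ _ one_pos contDiffOn_const) (fun _ _ => hp) rfl rfl).trans ?_) bot_le
  unfold kobayashiRoydenLength
  simp [F_zero hp]

lemma d_symm_le (p q : Cn n) : integratedKRDist n Ω J p q ≤ integratedKRDist n Ω J q p := by
  refine le_iInf ?_
  rintro ⟨γ, hγ, h0, h1⟩
  rw [path_iff] at hγ
  have h := hγ.1.rev
  norm_num at h
  refine (d_le (γ := fun t => γ (-1 * t + 1)) (by simpa using h) (fun t ht => hγ.2 ?_) (by simpa using h1) (by simpa using h0)).trans ?_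
  · constructor <;> linarith [ht.1, ht.2]
  · exact len_aff _ γ 0 1 (-1) 1 (by norm_num) _ (fun t _ => rfl) fun t ht => by constructor <;> linarith [ht.1, ht.2]

lemma d_tri (p q s : Cn n) : integratedKRDist n Ω J p q ≤ integratedKRDist n Ω J p s + integratedKRDist n Ω J s q := by
  rw [integratedKRDist.eq_1 n Ω J p s, ENNReal.iInf_add]
  refine le_iInf ?_
  rintro ⟨γ, hγ, h0, h1⟩
  rw [integratedKRDist.eq_1 n Ω J s q, ENNReal.add_iInf]
  refine le_iInf ?_
  rintro ⟨δ, hδ, k0, k1⟩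
  rw [path_iff] at hγ hδ
  let η : ℝ → Cn n := fun t => if t ≤ 1 / 2 then γ (2 * t + 0) else δ (2 * t + (-1))
  have e1 : ∀ t ≤ 1 / 2, η t = γ (2 * t + 0) := fun t ht => if_pos ht
  have e2 : ∀ t, 1 / 2 ≤ t → η t = δ (2 * t + (-1)) := fun t ht => by
    rcases ht.eq_or_lt with rfl | ht
    · rw [e1 _ le_rfl]; norm_num [h1, k0]
    · exact if_neg (not_le.2 ht)
  have P1 : PW η 0 (1 / 2) := by
    have := hγ.1.aff 2 0 two_pos
    norm_num at this
    exact PW.congr (γ := fun t => γ (2 * t)) (by norm_num; exact this) fun t ht => by rw [e1 t ht.2, add_zero]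
  have P2 : PW η (1 / 2) 1 := by
    have := hδ.1.aff 2 (-1) two_pos
    norm_num at this
    exact PW.congr (γ := fun t => δ (2 * t + (-1))) (by norm_num; exact this) fun t ht => by rw [e2 t ht.1]
  refine (d_le (γ := η) (P1.trans P2) (fun t ht => ?_) (by rw [e1 0 (by norm_num)]; simpa using h0) (by rw [e2 1 (by norm_num)]; norm_num [k1])).trans ?_
  · rcases le_total t (1 / 2) with h | h
    · rw [e1 t h]; exact hγ.2 (by constructor <;> linarith [ht.1, ht.2])
    · rw [e2 t h]; exact hδ.2 (by constructor <;> linarith [ht.1, ht.2])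
  · unfold kobayashiRoydenLength
    conv_lhs => rw [← Icc_union_Icc_eq_Icc (show (0 : ℝ) ≤ 1 / 2 by norm_num) (show (1 / 2 : ℝ) ≤ 1 by norm_num)]
    refine (lintegral_union_le _ _ _).trans (add_le_add ?_ ?_)
    · exact len_aff η γ 0 (1 / 2) 2 0 two_ne_zero _ (fun t ht => e1 t ht.2.le) fun t ht => by constructor <;> linarith [ht.1, ht.2]
    · exact len_aff η δ (1 / 2) 1 2 (-1) two_ne_zero _ (fun t ht => e2 t ht.1.le) fun t ht => by constructor <;> linarith [ht.1, ht.2]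

lemma d_loc (hΩ : IsOpen Ω) (hJ : IsAlmostComplexOn n Ω J) {p : Cn n} (hp : p ∈ Ω) : ∀ᶠ q in 𝓝[Ω] p, integratedKRDist n Ω J p q < ⊤ := by
  obtain ⟨ρ, C, hρ, hC, hsub, H⟩ := F_bound hΩ hJ hp
  refine nhdsWithin_le_nhds ?_
  filter_upwards [ball_mem_nhds p hρ, ball_mem_nhds p one_pos] with q hq hq1
  have hV : ‖q - p‖ ≤ 1 := by rw [mem_ball, dist_eq_norm] at hq1; exact hq1.le
  have hmem : ∀ t ∈ Icc (0 : ℝ) 1, p + t • (q - p) ∈ ball p ρ := fun t ht => by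
    have := (convex_ball p ρ).add_smul_sub_mem (mem_ball_self hρ) hq ht
    exact this
  have hd : ∀ t, HasDerivAt (fun t : ℝ => p + t • (q - p)) (q - p) t := fun t => by
    have := ((hasDerivAt_id t).smul_const (q - p)).const_add p
    simpa using this
  refine (d_le (γ := fun t : ℝ => p + t • (q - p)) (PW.single _ _ one_pos (by fun_prop)) (fun t ht => hsub (hmem t ht)) (by simp) (by simp)).trans_lt ?_
  have : kobayashiRoydenLength n Ω J (fun t : ℝ => p + t • (q - p)) ≤ ∫⁻ t in Icc (0 : ℝ) 1, C := by
    refine setLIntegral_mono' measurableSet_Icc fun t ht => ?_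
    rw [(hd t).deriv]
    exact H _ (hmem t ht) _ hV
  refine this.trans_lt ?_
  simpa using hC

lemma d_main (hΩ : IsOpen Ω) (hconn : IsConnected Ω) (hJ : IsAlmostComplexOn n Ω J) :
    (∀ p ∈ Ω, ∀ q ∈ Ω, integratedKRDist n Ω J p q < ⊤) ∧
    (∀ p ∈ Ω, ∀ q ∈ Ω, 0 ≤ integratedKRDist n Ω J p q) ∧
    (∀ p ∈ Ω, integratedKRDist n Ω J p p = 0) ∧
    (∀ p ∈ Ω, ∀ q ∈ Ω, integratedKRDist n Ω J p q = integratedKRDist n Ω J q p) ∧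
    (∀ p ∈ Ω, ∀ q ∈ Ω, ∀ s ∈ Ω,
      integratedKRDist n Ω J p q ≤
        integratedKRDist n Ω J p s + integratedKRDist n Ω J s q) := by
  refine ⟨fun p hp q hq => ?_, fun _ _ _ _ => bot_le, fun p hp => d_self hp, fun p _ q _ => le_antisymm (d_symm_le p q) (d_symm_le q p), fun p _ q _ s _ => d_tri p q s⟩
  exact hconn.isPreconnected.induction₂ (fun p q => integratedKRDist n Ω J p q < ⊤) (fun x hx => d_loc hΩ hJ hx)
    (fun x y z _ _ _ h1 h2 => (d_tri x z y).trans_lt (ENNReal.add_lt_top.2 ⟨h1, h2⟩))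
    (fun x y _ _ h => (d_symm_le y x).trans_lt h) hp hq
end
end HP14

/-- on a connected `Ω` the integrated Kobayashi–Royden pseudodistance
`d̄_Ω` is a well-defined finite-valued pseudodistance. -/
theorem integratedKRDist_pseudodistance
    (n : ℕ) (hn : 1 ≤ n) (Ω : Set (Cn n)) (hΩ : IsOpen Ω) (hconn : IsConnected Ω)
    (J : Cn n → (Cn n →L[ℝ] Cn n)) (hJ : IsAlmostComplexOn n Ω J) :
    (∀ p ∈ Ω, ∀ q ∈ Ω, integratedKRDist n Ω J p q < ⊤) ∧
    (∀ p ∈ Ω, ∀ q ∈ Ω, 0 ≤ integratedKRDist n Ω J p q) ∧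
    (∀ p ∈ Ω, integratedKRDist n Ω J p p = 0) ∧
    (∀ p ∈ Ω, ∀ q ∈ Ω, integratedKRDist n Ω J p q = integratedKRDist n Ω J q p) ∧
    (∀ p ∈ Ω, ∀ q ∈ Ω, ∀ s ∈ Ω,
      integratedKRDist n Ω J p q ≤
        integratedKRDist n Ω J p s + integratedKRDist n Ω J s q) := by
  exact d_main hΩ hconn hJ
end
end
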